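/- arXiv:2405.04117 — 4 statements merged into one kernel-verified Lean document; each statement's English description precedes it below -/
import Mathlib

section
/- For every finite group 𝔊 and every natural number N, there exists a nut graph G on more than N vertices whose automorphism group Aut(G) is isomorphic (as a group) to 𝔊. In particular, every finite group is the automorphism group of infinitely many pairwise non-isomorphic nut graphs. -/
open scoped Classical

/-- A *nut graph*: a finite simple graph on at least 2 vertices whose real adjacency
matrix has nullity (kernel dimension) exactly 1 and such that every nonzero vector in
the kernel of the adjacency matrix has all entries nonzero. -/
def SimpleGraph.IsNut {V : Type*} [Fintype V] (G : SimpleGraph V) : Prop :=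
  2 ≤ Fintype.card V ∧
  Module.finrank ℝ (LinearMap.ker (Matrix.mulVecLin (G.adjMatrix ℝ))) = 1 ∧
  ∀ x : V → ℝ, Matrix.mulVecLin (G.adjMatrix ℝ) x = 0 → x ≠ 0 → ∀ v : V, x v ≠ 0

/-- The automorphism group of a simple graph, realised as the subgroup of the
permutations of the vertex set that preserve adjacency (and non-adjacency). -/
def SimpleGraph.autGroup {V : Type*} (G : SimpleGraph V) : Subgroup (Equiv.Perm V) where
  carrier := { σ | ∀ u v : V, G.Adj (σ u) (σ v) ↔ G.Adj u v }
  mul_mem' := by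
    intro σ τ hσ hτ u v
    simpa [hσ (τ u) (τ v)] using hτ u v
  one_mem' := by intro u v; rfl
  inv_mem' := by
    intro σ hσ u v
    have := hσ (σ⁻¹ u) (σ⁻¹ v)
    simpa using this.symm

set_option linter.unusedSimpArgs false

namespace NutU

/-- partner level -/
def par (i : ℕ) : ℕ := if i % 4 < 2 then i + 2 else i - 2

/-- connection element at a level -/
def elt {Γ : Type*} [Group Γ] (c : ℕ → Γ) (i : ℕ) : Γ :=
  if i % 4 < 2 then c (i / 4) else (c (i / 4))⁻¹

abbrev Vt (Γ : Type*) (K : ℕ) := Option ((Γ × Fin (4 * K)) ⊕ (Γ × Fin (4 * K)))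

def nadj {Γ : Type*} [Group Γ] (K : ℕ) (c : ℕ → Γ) : Vt Γ K → Vt Γ K → Prop
  | none, none => False
  | none, some (Sum.inl (_, i)) => i.val % 2 = 0 ∨ i.val + 1 = 4 * K
  | some (Sum.inl (_, i)), none => i.val % 2 = 0 ∨ i.val + 1 = 4 * K
  | none, some (Sum.inr (_, i)) => i.val = 0
  | some (Sum.inr (_, i)), none => i.val = 0
  | some (Sum.inl (g, i)), some (Sum.inl (h, j)) =>
      (j.val = par i.val ∧ h = g * elt c i.val) ∨
        (h = g ∧ ((i.val = 0 ∧ j.val = 1) ∨ (i.val = 1 ∧ j.val = 0)))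
  | some (Sum.inl (g, i)), some (Sum.inr (h, j)) => h = g ∧ (j.val = i.val ∨ j.val = i.val + 1)
  | some (Sum.inr (h, j)), some (Sum.inl (g, i)) => h = g ∧ (j.val = i.val ∨ j.val = i.val + 1)
  | some (Sum.inr _), some (Sum.inr _) => False

section
variable {Γ : Type*} [Group Γ] (K : ℕ) (c : ℕ → Γ) (g h : Γ) (i j : Fin (4 * K))

lemma n_zz : nadj K c none none ↔ False := ⟨fun h => h, fun h => h⟩
lemma n_za : nadj K c none (some (Sum.inl (g, i))) ↔ (i.val % 2 = 0 ∨ i.val + 1 = 4 * K) :=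
  ⟨fun h => h, fun h => h⟩
lemma n_az : nadj K c (some (Sum.inl (g, i))) none ↔ (i.val % 2 = 0 ∨ i.val + 1 = 4 * K) :=
  ⟨fun h => h, fun h => h⟩
lemma n_zb : nadj K c none (some (Sum.inr (g, i))) ↔ i.val = 0 := ⟨fun h => h, fun h => h⟩
lemma n_bz : nadj K c (some (Sum.inr (g, i))) none ↔ i.val = 0 := ⟨fun h => h, fun h => h⟩
lemma n_aa : nadj K c (some (Sum.inl (g, i))) (some (Sum.inl (h, j))) ↔
      ((j.val = par i.val ∧ h = g * elt c i.val) ∨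
        (h = g ∧ ((i.val = 0 ∧ j.val = 1) ∨ (i.val = 1 ∧ j.val = 0)))) :=
  ⟨fun h => h, fun h => h⟩
lemma n_ab : nadj K c (some (Sum.inl (g, i))) (some (Sum.inr (h, j))) ↔
    (h = g ∧ (j.val = i.val ∨ j.val = i.val + 1)) := ⟨fun h => h, fun h => h⟩
lemma n_ba : nadj K c (some (Sum.inr (h, j))) (some (Sum.inl (g, i))) ↔
    (h = g ∧ (j.val = i.val ∨ j.val = i.val + 1)) := ⟨fun h => h, fun h => h⟩
lemma n_bb : nadj K c (some (Sum.inr (h, j))) (some (Sum.inr (g, i))) ↔ False :=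
  ⟨fun h => h, fun h => h⟩

end

lemma par_par (i : ℕ) : par (par i) = i := by
  unfold par; split_ifs <;> omega

lemma par_lt {K i : ℕ} (h : i < 4 * K) : par i < 4 * K := by
  unfold par; split_ifs <;> omega

lemma par_ne (i : ℕ) : par i ≠ i := by
  unfold par; split_ifs <;> omega

lemma elt_par {Γ : Type*} [Group Γ] (c : ℕ → Γ) (i : ℕ) : elt c (par i) = (elt c i)⁻¹ := by
  unfold elt par
  by_cases h : i % 4 < 2
  · have h1 : ¬ ((i + 2) % 4 < 2) := by omega
    have h2 : (i + 2) / 4 = i / 4 := by omega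
    simp [h, h1, h2]
  · have h1 : ((i - 2) % 4 < 2) := by omega
    have h2 : (i - 2) / 4 = i / 4 := by omega
    simp [h, h1, h2]

def nG {Γ : Type*} [Group Γ] (K : ℕ) (c : ℕ → Γ) : SimpleGraph (Vt Γ K) where
  Adj := nadj K c
  symm := ⟨by
    rintro (_ | ⟨g, i⟩ | ⟨g, i⟩) (_ | ⟨h, j⟩ | ⟨h, j⟩) H <;> simp only [n_zz, n_za, n_az, n_zb, n_bz, n_aa, n_ab, n_ba, n_bb] at H ⊢
    · exact H
    · exact H
    · exact H
    · rcases H with ⟨h1, h2⟩ | ⟨h1, h2⟩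
      · left
        rw [h1, par_par, elt_par, h2]
        simp
      · right
        exact ⟨h1.symm, by omega⟩
    · exact H
    · exact H
    · exact H⟩
  loopless := ⟨by
    rintro (_ | ⟨g, i⟩ | ⟨g, i⟩) H <;> simp only [n_zz, n_za, n_az, n_zb, n_bz, n_aa, n_ab, n_ba, n_bb] at H
    rcases H with ⟨h1, h2⟩ | ⟨h1, h2⟩
    · exact par_ne _ h1.symm
    · omega⟩

/-- signs -/
def sg (i : ℕ) : ℝ := if i % 2 = 0 then -1 else 1

/-- tail sums -/
def tl (K i : ℕ) : ℤ :=
  if i = 0 then 2 * K - 1 else if i = 1 then 2 * K else ((4 * K - i + 1 : ℤ) / 2 + 1)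

def x0 (Γ : Type*) (K : ℕ) : Vt Γ K → ℝ
  | none => 1
  | some (Sum.inl (_, i)) => sg i.val
  | some (Sum.inr (_, i)) => - sg i.val * tl K i.val

lemma sum_fin_succ {m : ℕ} (i : ℕ) (f : Fin m → ℝ) :
    (∑ j : Fin m, if j.val = i then f j else 0) = if h : i < m then f ⟨i, h⟩ else 0 := by
  split_ifs with h
  · rw [Finset.sum_eq_single ⟨i, h⟩]
    · simp
    · intro b _ hb
      rw [if_neg]
      intro h'
      exact hb (Fin.ext h')
    · simp
  · apply Finset.sum_eq_zero
    intro j _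
    rw [if_neg]
    have := j.2
    omega

lemma sum_pair {Γ : Type*} [Fintype Γ] {m : ℕ} (g : Γ) (i : ℕ) (f : Γ → Fin m → ℝ) :
    (∑ p : Γ × Fin m, if p.1 = g ∧ p.2.val = i then f p.1 p.2 else 0)
      = if h : i < m then f g ⟨i, h⟩ else 0 := by
  rw [Fintype.sum_prod_type]
  simp only [ite_and]
  rw [Finset.sum_eq_single g]
  · simp only [if_true]
    exact sum_fin_succ i (f g)
  · intro b _ hb
    simp [hb]
  · simp

section
variable {Γ : Type*} [Group Γ] [Fintype Γ] (K : ℕ) (c : ℕ → Γ)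

/-- the row equation -/
noncomputable def row (x : Vt Γ K → ℝ) (v : Vt Γ K) : ℝ := ∑ u, if (nG K c).Adj v u then x u else 0

lemma row_split (x : Vt Γ K → ℝ) (v : Vt Γ K) : row K c x v =
    (if nadj K c v none then x none else 0) +
    ((∑ p : Γ × Fin (4 * K), if nadj K c v (some (Sum.inl p)) then x (some (Sum.inl p)) else 0) +
    ∑ p : Γ × Fin (4 * K), if nadj K c v (some (Sum.inr p)) then x (some (Sum.inr p)) else 0) := by
  unfold row
  rw [Fintype.sum_option, Fintype.sum_sum_type]
  rfl

lemma row_b (x : Vt Γ K → ℝ) (g : Γ) (i : ℕ) (hi : i < 4 * K) :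
    row K c x (some (Sum.inr (g, ⟨i, hi⟩))) =
      (if h : i = 0 then x none else x (some (Sum.inl (g, ⟨i - 1, by omega⟩))))
        + x (some (Sum.inl (g, ⟨i, hi⟩))) := by
  rw [row_split]
  have h2 : (∑ p : Γ × Fin (4 * K), if nadj K c (some (Sum.inr (g, ⟨i, hi⟩))) (some (Sum.inr p))
      then x (some (Sum.inr p)) else 0) = 0 := by
    apply Finset.sum_eq_zero
    rintro ⟨h, j⟩ _
    simp [n_zz, n_za, n_az, n_zb, n_bz, n_aa, n_ab, n_ba, n_bb]
  have h1 : (∑ p : Γ × Fin (4 * K), if nadj K c (some (Sum.inr (g, ⟨i, hi⟩))) (some (Sum.inl p))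
      then x (some (Sum.inl p)) else 0) =
      (if h : i = 0 then 0 else x (some (Sum.inl (g, ⟨i - 1, by omega⟩))))
        + x (some (Sum.inl (g, ⟨i, hi⟩))) := by
    have e1 : ∀ p : Γ × Fin (4 * K), (if nadj K c (some (Sum.inr (g, ⟨i, hi⟩))) (some (Sum.inl p))
      then x (some (Sum.inl p)) else 0) =
      (if p.1 = g ∧ p.2.val = i then x (some (Sum.inl (p.1, p.2))) else 0) +
      (if i = 0 then 0 else
        (if p.1 = g ∧ p.2.val = i - 1 then x (some (Sum.inl (p.1, p.2))) else 0)) := by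
      rintro ⟨h, j⟩
      simp only [n_zz, n_za, n_az, n_zb, n_bz, n_aa, n_ab, n_ba, n_bb]
      by_cases hg : h = g
      · subst hg
        simp only [true_and]
        by_cases h0 : i = 0
        · by_cases hj : i = j.val
          · have : j.val = 0 := by omega
            simp [h0, this]
          · have : ¬ (j.val = i) := by omega
            have : ¬ (i = j.val + 1) := by omega
            rw [if_neg (by omega), if_neg (by omega), if_pos h0, add_zero]
        · by_cases hj : i = j.val
          · have : ¬ (j.val = i - 1) := by omega
            have : ¬ (i = j.val + 1) := by omega
            have : ¬ (j.val = j.val - 1) := by omega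
            have : ¬ (j.val = 0) := by omega
            simp [*]
          · have h3 : ¬ (j.val = i) := by omega
            by_cases h4 : i = j.val + 1
            · have : j.val = i - 1 := by omega
              simp [h4]
            · have : ¬ (j.val = i - 1) := by omega
              simp [*]
      · have : ¬ (g = h) := fun h' => hg h'.symm
        simp [hg, this]
    rw [Finset.sum_congr rfl (fun p _ => e1 p), Finset.sum_add_distrib,
      sum_pair g i (fun h j => x (some (Sum.inl (h, j))))]
    by_cases h0 : i = 0
    · simp [h0, show 0 < K by omega]
    · simp only [h0, if_false, dite_false]
      rw [sum_pair g (i - 1) (fun h j => x (some (Sum.inl (h, j))))]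
      rw [dif_pos hi, dif_pos (by omega)]
      ring
  rw [h1, h2]
  simp only [n_zz, n_za, n_az, n_zb, n_bz, n_aa, n_ab, n_ba, n_bb]
  by_cases h0 : i = 0 <;> simp [h0]

lemma row_a_b (x : Vt Γ K → ℝ) (g : Γ) (i : ℕ) (hi : i < 4 * K) :
    (∑ p : Γ × Fin (4 * K), if nadj K c (some (Sum.inl (g, ⟨i, hi⟩))) (some (Sum.inr p))
      then x (some (Sum.inr p)) else 0) =
      x (some (Sum.inr (g, ⟨i, hi⟩))) +
        (if h : i + 1 < 4 * K then x (some (Sum.inr (g, ⟨i + 1, h⟩))) else 0) := by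
  have e1 : ∀ p : Γ × Fin (4 * K), (if nadj K c (some (Sum.inl (g, ⟨i, hi⟩))) (some (Sum.inr p))
      then x (some (Sum.inr p)) else 0) =
      (if p.1 = g ∧ p.2.val = i then x (some (Sum.inr (p.1, p.2))) else 0) +
      (if p.1 = g ∧ p.2.val = i + 1 then x (some (Sum.inr (p.1, p.2))) else 0) := by
    rintro ⟨h, j⟩
    simp only [n_zz, n_za, n_az, n_zb, n_bz, n_aa, n_ab, n_ba, n_bb]
    by_cases hg : h = g
    · subst hg
      simp only [true_and]
      by_cases hj : j.val = i
      · simp [hj]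
      · simp [hj]
    · simp [hg]
  rw [Finset.sum_congr rfl (fun p _ => e1 p), Finset.sum_add_distrib,
      sum_pair g i (fun h j => x (some (Sum.inr (h, j)))),
      sum_pair g (i + 1) (fun h j => x (some (Sum.inr (h, j)))), dif_pos hi]

lemma row_a_a (x : Vt Γ K → ℝ) (g : Γ) (i : ℕ) (hi : i < 4 * K) :
    (∑ p : Γ × Fin (4 * K), if nadj K c (some (Sum.inl (g, ⟨i, hi⟩))) (some (Sum.inl p))
      then x (some (Sum.inl p)) else 0) =
      x (some (Sum.inl (g * elt c i, ⟨par i, par_lt hi⟩))) +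
        (if h : i < 2 then x (some (Sum.inl (g, ⟨1 - i, by omega⟩))) else 0) := by
  have e1 : ∀ p : Γ × Fin (4 * K), (if nadj K c (some (Sum.inl (g, ⟨i, hi⟩))) (some (Sum.inl p))
      then x (some (Sum.inl p)) else 0) =
      (if p.1 = g * elt c i ∧ p.2.val = par i then x (some (Sum.inl (p.1, p.2))) else 0) +
      (if i < 2 then (if p.1 = g ∧ p.2.val = 1 - i then x (some (Sum.inl (p.1, p.2))) else 0)
        else 0) := by
    rintro ⟨h, j⟩
    simp only [n_zz, n_za, n_az, n_zb, n_bz, n_aa, n_ab, n_ba, n_bb]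
    by_cases hj : h = g * elt c i ∧ j.val = par i
    · have h1 : ¬ (i < 2 ∧ (h = g ∧ j.val = 1 - i)) := by
        rintro ⟨h1, _, h2⟩
        have := hj.2
        unfold par at this
        split_ifs at this <;> omega
      rw [if_pos (Or.inl ⟨hj.2, hj.1⟩), if_pos hj, ← ite_and, if_neg h1, add_zero]
    · rw [if_neg hj, zero_add, ← ite_and]
      congr 1
      apply propext
      constructor
      · rintro (⟨h1, h2⟩ | ⟨h1, h2⟩)
        · exact absurd ⟨h2, h1⟩ hj
        · exact ⟨by omega, h1, by omega⟩
      · rintro ⟨h1, h2, h3⟩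
        exact Or.inr ⟨h2, by omega⟩
  rw [Finset.sum_congr rfl (fun p _ => e1 p), Finset.sum_add_distrib,
      sum_pair (g * elt c i) (par i) (fun h j => x (some (Sum.inl (h, j)))), dif_pos (par_lt hi)]
  by_cases h : i < 2
  · simp only [h, if_true, dite_true]
    rw [sum_pair g (1 - i) (fun h j => x (some (Sum.inl (h, j)))), dif_pos (by omega)]
  · simp [h]

lemma x0_row_a (hK : 3 ≤ K) (g : Γ) (i : ℕ) (hi : i < 4 * K) :
    row K c (x0 Γ K) (some (Sum.inl (g, ⟨i, hi⟩))) = 0 := by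
  rw [row_split, row_a_b, row_a_a]
  simp only [n_zz, n_za, n_az, n_zb, n_bz, n_aa, n_ab, n_ba, n_bb, x0]
  have hpar : sg (par i) = sg i := by
    unfold sg
    have : par i % 2 = i % 2 := by unfold par; split_ifs <;> omega
    rw [this]
  rw [hpar]
  by_cases he : i % 2 = 0
  · have hs : sg i = -1 := by simp [sg, he]
    have hs' : sg (i + 1) = 1 := by simp [sg, show (i + 1) % 2 ≠ 0 by omega]
    have hlt : i + 1 < 4 * K := by omega
    rw [if_pos (Or.inl he), dif_pos hlt, hs, hs']
    by_cases h2 : i < 2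
    · have h0 : i = 0 := by omega
      subst h0
      simp [sg, tl]
      ring
    · have : tl K i = tl K (i + 1) := by
        unfold tl
        rw [if_neg (by omega), if_neg (by omega), if_neg (by omega), if_neg (by omega)]
        push_cast
        omega
      rw [dif_neg h2, this]
      ring
  · have hs : sg i = 1 := by simp [sg, he]
    have hs' : sg (i + 1) = -1 := by simp [sg, show (i + 1) % 2 = 0 by omega]
    rw [hs, hs']
    by_cases hlt : i + 1 < 4 * K
    · rw [if_neg (by omega), dif_pos hlt]
      by_cases h2 : i < 2
      · have h0 : i = 1 := by omega
        subst h0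
        have : tl K 1 = tl K 2 := by
          unfold tl
          norm_num
          omega
        simp [sg, this]
      · have : tl K i = tl K (i + 1) + 1 := by
          unfold tl
          rw [if_neg (by omega), if_neg (by omega), if_neg (by omega), if_neg (by omega)]
          push_cast
          omega
        rw [dif_neg h2, this]
        push_cast
        ring
    · rw [if_pos (by omega), dif_neg hlt, dif_neg (by omega)]
      have : tl K i = 2 := by
        unfold tl
        rw [if_neg (by omega), if_neg (by omega)]
        omega
      rw [this]
      norm_num

lemma x0_row_b (g : Γ) (i : ℕ) (hi : i < 4 * K) :
    row K c (x0 Γ K) (some (Sum.inr (g, ⟨i, hi⟩))) = 0 := by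
  rw [row_b]
  simp only [x0]
  by_cases h : i = 0
  · simp [h, sg]
  · rw [dif_neg h]
    unfold sg
    by_cases he : i % 2 = 0
    · rw [if_neg (by omega), if_pos he]; norm_num
    · rw [if_pos (by omega), if_neg he]; norm_num

lemma count_even (K : ℕ) :
    (∑ i ∈ Finset.range (4 * K), if i % 2 = 0 then (-1 : ℝ) else 0) = - (2 * K) := by
  induction K with
  | zero => simp
  | succ k ih =>
    rw [show 4 * (k + 1) = 4 * k + 1 + 1 + 1 + 1 by ring]
    simp only [Finset.sum_range_succ, ih]
    rw [if_pos (by omega), if_neg (by omega), if_pos (by omega), if_neg (by omega)]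
    push_cast
    ring

lemma x0_row_z (hK : 3 ≤ K) : row K c (x0 Γ K) none = 0 := by
  rw [row_split]
  rw [Fintype.sum_prod_type, Fintype.sum_prod_type, ← Finset.sum_add_distrib]
  simp only [n_zz, n_za, n_az, n_zb, n_bz, n_aa, n_ab, n_ba, n_bb, x0, if_false, zero_add]
  apply Finset.sum_eq_zero
  intro g _
  rw [sum_fin_succ 0 (fun j : Fin (4 * K) => - sg j.val * tl K j.val), dif_pos (by omega)]
  rw [Fin.sum_univ_eq_sum_range (fun i => if i % 2 = 0 ∨ i + 1 = 4 * K then sg i else 0)]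
  have : ∀ i ∈ Finset.range (4 * K), (if i % 2 = 0 ∨ i + 1 = 4 * K then sg i else 0) =
      (if i % 2 = 0 then (-1 : ℝ) else 0) + (if i = 4 * K - 1 then 1 else 0) := by
    intro i hi
    by_cases he : i % 2 = 0
    · rw [if_pos (Or.inl he), if_pos he, if_neg (by omega)]
      simp [sg, he]
    · by_cases ht : i + 1 = 4 * K
      · rw [if_pos (Or.inr ht), if_neg he, if_pos (by omega)]
        simp [sg, he]
      · rw [if_neg (by tauto), if_neg he, if_neg (by omega)]
        simp
  rw [Finset.sum_congr rfl this, Finset.sum_add_distrib, count_even]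
  rw [Finset.sum_ite_eq', if_pos (Finset.mem_range.2 (by omega))]
  simp [sg, tl]

lemma x0_ker (hK : 3 ≤ K) (v : Vt Γ K) : row K c (x0 Γ K) v = 0 := by
  rcases v with _ | ⟨g, i⟩ | ⟨g, i⟩
  · exact x0_row_z K c hK
  · exact x0_row_a K c hK g i.1 i.2
  · exact x0_row_b K c g i.1 i.2

lemma x0_ne {Γ : Type*} (K : ℕ) (hK : 3 ≤ K) (v : Vt Γ K) : x0 Γ K v ≠ 0 := by
  have hs : ∀ i, sg i ≠ 0 := by intro i; unfold sg; split_ifs <;> norm_num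
  rcases v with _ | ⟨g, i⟩ | ⟨g, i⟩
  · simp [x0]
  · exact hs _
  · simp only [x0]
    apply mul_ne_zero (neg_ne_zero.2 (hs _))
    have : tl K i.val ≠ 0 := by
      have := i.2
      unfold tl
      split_ifs <;> omega
    exact_mod_cast this

lemma ker_zero (y : Vt Γ K → ℝ) (hy : ∀ v, row K c y v = 0) (hz : y none = 0) : y = 0 := by
  have ha : ∀ (g : Γ) (i : ℕ) (hi : i < 4 * K), y (some (Sum.inl (g, ⟨i, hi⟩))) = 0 := by
    intro g i
    induction i with
    | zero =>
      intro hi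
      have := hy (some (Sum.inr (g, ⟨0, hi⟩)))
      rw [row_b] at this
      simpa [hz] using this
    | succ i ih =>
      intro hi
      have := hy (some (Sum.inr (g, ⟨i + 1, hi⟩)))
      rw [row_b, dif_neg (by omega)] at this
      have h2 := ih (by omega)
      simpa [h2] using this
  have hb : ∀ (g : Γ) (k i : ℕ) (hi : i < 4 * K), 4 * K - i ≤ k →
      y (some (Sum.inr (g, ⟨i, hi⟩))) = 0 := by
    intro g k
    induction k with
    | zero => intro i hi h; omega
    | succ k ih =>
      intro i hi h
      have := hy (some (Sum.inl (g, ⟨i, hi⟩)))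
      rw [row_split, row_a_b, row_a_a] at this
      have e : ∀ h : i + 1 < 4 * K, y (some (Sum.inr (g, ⟨i + 1, h⟩))) = 0 :=
        fun h => ih _ h (by omega)
      simpa [hz, ha, e] using this
  funext v
  rcases v with _ | ⟨g, i⟩ | ⟨g, i⟩
  · exact hz
  · exact ha g i.1 i.2
  · exact hb g _ i.1 i.2 le_rfl

lemma ker_unique (hK : 3 ≤ K) (x : Vt Γ K → ℝ) (hx : ∀ v, row K c x v = 0) :
    x = (x none) • x0 Γ K := by
  have := ker_zero K c (x - (x none) • x0 Γ K) (by
    intro v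
    have h1 := hx v
    have h2 := x0_ker K c hK v
    have : row K c (x - (x none) • x0 Γ K) v = row K c x v - x none * row K c (x0 Γ K) v := by
      unfold row
      rw [Finset.mul_sum, ← Finset.sum_sub_distrib]
      apply Finset.sum_congr rfl
      intro u _
      split_ifs <;> simp
    rw [this, h1, h2]
    simp) (by simp [x0])
  exact sub_eq_zero.1 this

end

/-! ### Automorphisms -/

/-- at most `k` neighbours -/
def few {V : Type*} (G : SimpleGraph V) (k : ℕ) (v : V) : Prop :=
  ∃ s : Finset V, s.card ≤ k ∧ ∀ w, G.Adj v w → w ∈ s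

lemma few_aut {V : Type*} (G : SimpleGraph V) (k : ℕ) (σ : Equiv.Perm V) (hσ : σ ∈ G.autGroup)
    (v : V) : few G k (σ v) ↔ few G k v := by
  have hσ' : ∀ u v : V, G.Adj (σ u) (σ v) ↔ G.Adj u v := hσ
  constructor
  · rintro ⟨s, hs, h⟩
    refine ⟨s.map σ.symm.toEmbedding, by simpa using hs, ?_⟩
    intro w hw
    have := h (σ w) ((hσ' _ _).2 hw)
    simpa [Finset.mem_map_equiv] using this
  · rintro ⟨s, hs, h⟩
    refine ⟨s.map σ.toEmbedding, by simpa using hs, ?_⟩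
    intro w hw
    have := h (σ.symm w) ((hσ' _ _).1 (by simpa using hw))
    simpa [Finset.mem_map_equiv] using this

lemma not_few {V : Type*} (G : SimpleGraph V) (k : ℕ) (v : V) (f : Fin (k + 1) → V)
    (hf : Function.Injective f) (h : ∀ i, G.Adj v (f i)) : ¬ few G k v := by
  rintro ⟨s, hs, hw⟩
  have h1 : Finset.univ.map ⟨f, hf⟩ ⊆ s := by
    intro w hw'
    obtain ⟨i, _, rfl⟩ := Finset.mem_map.1 hw'
    exact hw _ (h i)
  have := Finset.card_le_card h1
  simp at this
  omega

section
variable {Γ : Type*} [Group Γ] (K : ℕ) (c : ℕ → Γ)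

lemma few_b (g : Γ) (i : Fin (4 * K)) : few (nG K c) 2 (some (Sum.inr (g, i))) := by
  refine ⟨{if h : i.val = 0 then none else some (Sum.inl (g, ⟨i.val - 1, by omega⟩)),
    some (Sum.inl (g, i))}, Finset.card_le_two, ?_⟩
  rintro (_ | ⟨h, j⟩ | ⟨h, j⟩) H <;> simp only [nG, n_zz, n_za, n_az, n_zb, n_bz, n_aa, n_ab, n_ba, n_bb] at H
  · simp [H]
  · obtain ⟨rfl, H | H⟩ := H
    · have : j = i := Fin.ext H.symm
      simp [this]
    · have h2 : ¬ (i.val = 0) := by omega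
      have : j = ⟨i.val - 1, by omega⟩ := Fin.ext (by simp; omega)
      rw [dif_neg h2, this]
      simp

lemma few_a (g : Γ) (i : Fin (4 * K)) : few (nG K c) 5 (some (Sum.inl (g, i))) := by
  refine ⟨{none, some (Sum.inr (g, i)),
    (if h : i.val + 1 < 4 * K then some (Sum.inr (g, ⟨i.val + 1, h⟩)) else none),
    some (Sum.inl (g * elt c i, ⟨par i, par_lt i.2⟩)),
    (if h : 1 - i.val < 4 * K then some (Sum.inl (g, ⟨1 - i.val, h⟩)) else none)},
    Finset.card_le_five, ?_⟩
  rintro (_ | ⟨h, j⟩ | ⟨h, j⟩) H <;> simp only [nG, n_zz, n_za, n_az, n_zb, n_bz, n_aa, n_ab, n_ba, n_bb] at H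
  · simp
  · rcases H with ⟨h1, h2⟩ | ⟨h1, h2⟩
    · have : j = ⟨par i, par_lt i.2⟩ := Fin.ext h1
      simp [h2, this]
    · have h3 : 1 - i.val < 4 * K := by omega
      have : j = ⟨1 - i.val, h3⟩ := Fin.ext (by simp; omega)
      rw [dif_pos h3, this, h1]
      simp
  · obtain ⟨rfl, H | H⟩ := H
    · have : j = i := Fin.ext H
      simp [this]
    · have h3 : i.val + 1 < 4 * K := by omega
      have : j = ⟨i.val + 1, h3⟩ := Fin.ext H
      rw [dif_pos h3, this]
      simp

lemma not_few_a (g : Γ) (i : Fin (4 * K)) : ¬ few (nG K c) 2 (some (Sum.inl (g, i))) := by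
  apply not_few (nG K c) 2 _ ![some (Sum.inr (g, i)),
    some (Sum.inl (g * elt c i, ⟨par i, par_lt i.2⟩)),
    (if h : i.val + 1 < 4 * K then some (Sum.inr (g, ⟨i.val + 1, h⟩)) else none)]
  · by_cases h : i.val + 1 < 4 * K
    · have h1 : ¬ (i = ⟨i.val + 1, h⟩) := by
        intro h'
        have := congrArg Fin.val h'
        simp at this
      intro p q hpq
      fin_cases p <;> fin_cases q <;> simp_all
    · intro p q hpq
      fin_cases p <;> fin_cases q <;> simp_all
  · intro p
    fin_cases p
    · simp [nG, n_zz, n_za, n_az, n_zb, n_bz, n_aa, n_ab, n_ba, n_bb]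
    · simp [nG, n_zz, n_za, n_az, n_zb, n_bz, n_aa, n_ab, n_ba, n_bb]
    · by_cases h : i.val + 1 < 4 * K
      · simp [nG, n_zz, n_za, n_az, n_zb, n_bz, n_aa, n_ab, n_ba, n_bb, h]
      · have : i.val + 1 = 4 * K := by omega
        simp [nG, n_zz, n_za, n_az, n_zb, n_bz, n_aa, n_ab, n_ba, n_bb, this]

lemma not_few_z (hK : 3 ≤ K) : ¬ few (nG K c) 5 none := by
  apply not_few (nG K c) 5 _
    (fun k : Fin 6 => some (Sum.inl (1, ⟨2 * k.val, by omega⟩)))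
  · intro p q hpq
    simp at hpq
    exact Fin.ext (by omega)
  · intro p
    simp [nG, n_zz, n_za, n_az, n_zb, n_bz, n_aa, n_ab, n_ba, n_bb]

lemma few_mono {V : Type*} (G : SimpleGraph V) {k l : ℕ} (h : k ≤ l) {v : V} (hv : few G k v) :
    few G l v := by
  obtain ⟨s, hs, hw⟩ := hv
  exact ⟨s, hs.trans h, hw⟩

lemma aut_leg (hK : 3 ≤ K) (σ : Equiv.Perm (Vt Γ K)) (hσ : σ ∈ (nG K c).autGroup) :
    σ none = none ∧ ∀ g : Γ, ∃ h : Γ, ∀ i : Fin (4 * K),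
      σ (some (Sum.inr (g, i))) = some (Sum.inr (h, i)) ∧
      σ (some (Sum.inl (g, i))) = some (Sum.inl (h, i)) := by
  have hσ' : ∀ u v, nadj K c (σ u) (σ v) ↔ nadj K c u v := hσ
  have hz : σ none = none := by
    have h1 : ¬ few (nG K c) 5 (σ none) := by
      rw [few_aut _ _ _ hσ]; exact not_few_z K c hK
    rcases h : σ none with _ | ⟨g, i⟩ | ⟨g, i⟩
    · rfl
    · rw [h] at h1; exact absurd (few_a K c g i) h1
    · rw [h] at h1; exact absurd (few_mono _ (by norm_num) (few_b K c g i)) h1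
  have hB : ∀ p, ∃ q, σ (some (Sum.inr p)) = some (Sum.inr q) := by
    rintro ⟨g, i⟩
    have h1 : few (nG K c) 2 (σ (some (Sum.inr (g, i)))) := by
      rw [few_aut _ _ _ hσ]; exact few_b K c g i
    rcases h : σ (some (Sum.inr (g, i))) with _ | ⟨g', j⟩ | ⟨g', j⟩
    · rw [h] at h1; exact absurd (few_mono _ (by norm_num) h1) (not_few_z K c hK)
    · rw [h] at h1; exact absurd h1 (not_few_a K c g' j)
    · exact ⟨_, rfl⟩
  have hA : ∀ p, ∃ q, σ (some (Sum.inl p)) = some (Sum.inl q) := by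
    rintro ⟨g, i⟩
    have h1 : ¬ few (nG K c) 2 (σ (some (Sum.inl (g, i)))) := by
      rw [few_aut _ _ _ hσ]; exact not_few_a K c g i
    rcases h : σ (some (Sum.inl (g, i))) with _ | ⟨g', j⟩ | ⟨g', j⟩
    · have := σ.injective (h.trans hz.symm)
      simp at this
    · exact ⟨_, rfl⟩
    · rw [h] at h1; exact absurd (few_b K c g' j) h1
  refine ⟨hz, fun g => ?_⟩
  have pos : 0 < 4 * K := by omega
  obtain ⟨⟨h, j⟩, hq⟩ := hB (g, ⟨0, pos⟩)
  have hj : j = ⟨0, pos⟩ := by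
    have := (hσ' none (some (Sum.inr (g, ⟨0, pos⟩)))).2 (by simp [n_zz, n_za, n_az, n_zb, n_bz, n_aa, n_ab, n_ba, n_bb])
    rw [hz, hq] at this
    exact Fin.ext this
  subst hj
  refine ⟨h, ?_⟩
  suffices H : ∀ (i : ℕ) (hi : i < 4 * K),
      σ (some (Sum.inr (g, ⟨i, hi⟩))) = some (Sum.inr (h, ⟨i, hi⟩)) ∧
      σ (some (Sum.inl (g, ⟨i, hi⟩))) = some (Sum.inl (h, ⟨i, hi⟩)) from fun i => H i.1 i.2
  intro i
  induction i with
  | zero =>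
    intro hi
    refine ⟨hq, ?_⟩
    obtain ⟨⟨h', j⟩, hp⟩ := hA (g, ⟨0, hi⟩)
    have := (hσ' (some (Sum.inr (g, ⟨0, pos⟩))) (some (Sum.inl (g, ⟨0, pos⟩)))).2 (by simp [n_zz, n_za, n_az, n_zb, n_bz, n_aa, n_ab, n_ba, n_bb])
    rw [hq, hp] at this
    simp only [n_zz, n_za, n_az, n_zb, n_bz, n_aa, n_ab, n_ba, n_bb] at this
    rw [hp, this.1]
    have : j = ⟨0, hi⟩ := Fin.ext (by simp; omega)
    rw [this]
  | succ i ih =>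
    intro hi
    obtain ⟨ih1, ih2⟩ := ih (by omega)
    have hb : σ (some (Sum.inr (g, ⟨i + 1, hi⟩))) = some (Sum.inr (h, ⟨i + 1, hi⟩)) := by
      obtain ⟨⟨h', j⟩, hp⟩ := hB (g, ⟨i + 1, hi⟩)
      have := (hσ' (some (Sum.inl (g, ⟨i, by omega⟩))) (some (Sum.inr (g, ⟨i + 1, hi⟩)))).2
        (by simp [n_zz, n_za, n_az, n_zb, n_bz, n_aa, n_ab, n_ba, n_bb])
      rw [ih2, hp] at this
      simp only [n_zz, n_za, n_az, n_zb, n_bz, n_aa, n_ab, n_ba, n_bb] at this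
      obtain ⟨rfl, h1 | h1⟩ := this
      · have h2 : j = ⟨i, by omega⟩ := Fin.ext h1
        rw [h2] at hp
        have := σ.injective (hp.trans ih1.symm)
        simp at this
      · have h2 : j = ⟨i + 1, hi⟩ := Fin.ext h1
        rw [hp, h2]
    refine ⟨hb, ?_⟩
    obtain ⟨⟨h', j⟩, hp⟩ := hA (g, ⟨i + 1, hi⟩)
    have := (hσ' (some (Sum.inr (g, ⟨i + 1, hi⟩))) (some (Sum.inl (g, ⟨i + 1, hi⟩)))).2
      (by simp [n_zz, n_za, n_az, n_zb, n_bz, n_aa, n_ab, n_ba, n_bb])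
    rw [hb, hp] at this
    simp only [n_zz, n_za, n_az, n_zb, n_bz, n_aa, n_ab, n_ba, n_bb] at this
    obtain ⟨rfl, h1 | h1⟩ := this
    · have h2 : j = ⟨i + 1, hi⟩ := Fin.ext h1.symm
      rw [hp, h2]
    · have h2 : j = ⟨i, by omega⟩ := Fin.ext (by simp; omega)
      rw [h2] at hp
      have := σ.injective (hp.trans ih2.symm)
      simp at this

/-- left translation -/
def tr (K : ℕ) (k : Γ) : Vt Γ K → Vt Γ K
  | none => none
  | some (Sum.inl (g, i)) => some (Sum.inl (k * g, i))
  | some (Sum.inr (g, i)) => some (Sum.inr (k * g, i))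

def trP (K : ℕ) : Γ →* Equiv.Perm (Vt Γ K) where
  toFun k :=
    { toFun := tr K k
      invFun := tr K k⁻¹
      left_inv := by rintro (_ | ⟨g, i⟩ | ⟨g, i⟩) <;> simp [tr]
      right_inv := by rintro (_ | ⟨g, i⟩ | ⟨g, i⟩) <;> simp [tr] }
  map_one' := by
    ext1 v
    rcases v with (_ | ⟨g, i⟩ | ⟨g, i⟩) <;> simp [tr]
  map_mul' k l := by
    ext1 v
    rcases v with (_ | ⟨g, i⟩ | ⟨g, i⟩) <;> simp [tr, mul_assoc]

lemma trP_mem (k : Γ) : trP K k ∈ (nG K c).autGroup := by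
  intro u v
  rcases u with (_ | ⟨g, i⟩ | ⟨g, i⟩) <;> rcases v with (_ | ⟨h, j⟩ | ⟨h, j⟩) <;>
    simp [trP, tr, nG, n_zz, n_za, n_az, n_zb, n_bz, n_aa, n_ab, n_ba, n_bb, mul_assoc]

theorem aut_iso (hK : 3 ≤ K) (hc : ∀ s : Γ, ∃ k < K, c k = s) :
    Nonempty (Γ ≃* (nG K c).autGroup) := by
  refine ⟨MulEquiv.ofBijective ((trP K).codRestrict (nG K c).autGroup (trP_mem K c)) ⟨?_, ?_⟩⟩
  · intro k l hkl
    have h1 : trP K k = trP K l := congrArg Subtype.val hkl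
    have h2 := congrArg (fun σ : Equiv.Perm (Vt Γ K) =>
      σ (some (Sum.inl (1, ⟨0, by omega⟩)))) h1
    simpa [trP, tr] using h2
  · rintro ⟨σ, hσ⟩
    obtain ⟨hz, hl⟩ := aut_leg K c hK σ hσ
    choose φ hφ using hl
    have hφ1 : ∀ s, φ s = φ 1 * s := by
      intro s
      obtain ⟨k, hk, rfl⟩ := hc s
      have hσ' : ∀ u v, nadj K c (σ u) (σ v) ↔ nadj K c u v := hσ
      have h1 : (4 * k) % 4 < 2 := by omega
      have h2 : 4 * k / 4 = k := by omega
      have := (hσ' (some (Sum.inl (1, ⟨4 * k, by omega⟩)))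
        (some (Sum.inl (c k, ⟨4 * k + 2, by omega⟩)))).2 (by simp [n_zz, n_za, n_az, n_zb, n_bz, n_aa, n_ab, n_ba, n_bb, par, elt])
      rw [(hφ _ _).2, (hφ _ _).2] at this
      simp only [n_zz, n_za, n_az, n_zb, n_bz, n_aa, n_ab, n_ba, n_bb, par, elt, h1, h2, if_true] at this
      rcases this with h | h
      · exact h.2
      · omega
    refine ⟨φ 1, Subtype.ext ?_⟩
    ext1 v
    show tr K (φ 1) v = σ v
    rcases v with (_ | ⟨g, i⟩ | ⟨g, i⟩)
    · exact hz.symm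
    · rw [(hφ g i).2, hφ1 g]; rfl
    · rw [(hφ g i).1, hφ1 g]; rfl

end

/-! ### Transport to `Fin n` -/

lemma mulVec_row {V : Type*} [Fintype V] (G : SimpleGraph V) (x : V → ℝ) (v : V) :
    Matrix.mulVecLin (G.adjMatrix ℝ) x v = ∑ u, if G.Adj v u then x u else 0 := by
  simp only [Matrix.mulVecLin_apply, Matrix.mulVec, dotProduct, SimpleGraph.adjMatrix_apply,
    ite_mul, one_mul, zero_mul]

lemma isNut_of {V : Type*} [Fintype V] (G : SimpleGraph V) (h2 : 2 ≤ Fintype.card V)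
    (x : V → ℝ) (hx : ∀ v, x v ≠ 0)
    (hk : ∀ v, (∑ u, if G.Adj v u then x u else 0) = 0)
    (hu : ∀ y : V → ℝ, (∀ v, (∑ u, if G.Adj v u then y u else 0) = 0) → ∃ r : ℝ, y = r • x) :
    G.IsNut := by
  have hker : ∀ y : V → ℝ, Matrix.mulVecLin (G.adjMatrix ℝ) y = 0 → ∃ r : ℝ, y = r • x := by
    intro y hy
    apply hu
    intro v
    rw [← mulVec_row, hy]
    rfl
  have hne : Nonempty V := Fintype.card_pos_iff.1 (by omega)
  have hx0 : x ≠ 0 := by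
    obtain ⟨v⟩ := hne
    intro h
    exact hx v (by rw [h]; rfl)
  have hxk : Matrix.mulVecLin (G.adjMatrix ℝ) x = 0 := by
    funext v
    rw [mulVec_row]
    exact hk v
  refine ⟨h2, ?_, ?_⟩
  · apply finrank_eq_one (⟨x, hxk⟩ : LinearMap.ker (Matrix.mulVecLin (G.adjMatrix ℝ)))
    · intro h
      exact hx0 (congrArg Subtype.val h)
    · rintro ⟨y, hy⟩
      obtain ⟨r, hr⟩ := hker y hy
      exact ⟨r, Subtype.ext hr.symm⟩
  · intro y hy hy0 v
    obtain ⟨r, rfl⟩ := hker y hy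
    have : r ≠ 0 := by
      rintro rfl
      simp at hy0
    exact mul_ne_zero this (hx v)

lemma transport {V : Type*} [Fintype V] (G : SimpleGraph V) (h2 : 2 ≤ Fintype.card V)
    (x : V → ℝ) (hx : ∀ v, x v ≠ 0)
    (hk : ∀ v, (∑ u, if G.Adj v u then x u else 0) = 0)
    (hu : ∀ y : V → ℝ, (∀ v, (∑ u, if G.Adj v u then y u else 0) = 0) → ∃ r : ℝ, y = r • x) :
    ∃ G' : SimpleGraph (Fin (Fintype.card V)), G'.IsNut ∧
      Nonempty (G'.autGroup ≃* G.autGroup) := by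
  let e : V ≃ Fin (Fintype.card V) := Fintype.equivFin V
  let G' : SimpleGraph (Fin (Fintype.card V)) := G.comap e.symm
  have hadj : ∀ u v, G'.Adj u v ↔ G.Adj (e.symm u) (e.symm v) := fun u v => Iff.rfl
  have hsum : ∀ (y : V → ℝ) v, (∑ u, if G'.Adj v u then y (e.symm u) else 0) =
      ∑ u, if G.Adj (e.symm v) u then y u else 0 := by
    intro y v
    exact Equiv.sum_comp e.symm (fun u => if G.Adj (e.symm v) u then y u else 0)
  refine ⟨G', ?_, ?_⟩
  · apply isNut_of G' (by simpa using h2) (fun v => x (e.symm v)) (fun v => hx _)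
    · intro v
      exact (hsum x v).trans (hk _)
    · intro y hy
      obtain ⟨r, hr⟩ := hu (fun v => y (e v)) (by
        intro v
        have := hsum (fun v => y (e v)) (e v)
        simp only [Equiv.apply_symm_apply, Equiv.symm_apply_apply] at this
        rw [← this]
        exact hy _)
      refine ⟨r, ?_⟩
      funext v
      have := congrFun hr (e.symm v)
      simpa using this
  · refine ⟨?_⟩
    have m1 : ∀ σ : Equiv.Perm (Fin (Fintype.card V)), σ ∈ G'.autGroup →
        e.symm.permCongr σ ∈ G.autGroup := by
      intro σ hσ u v
      have := hσ (e u) (e v)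
      rw [hadj, hadj] at this
      simpa [Equiv.permCongr_apply] using this
    have m2 : ∀ σ : Equiv.Perm V, σ ∈ G.autGroup → e.permCongr σ ∈ G'.autGroup := by
      intro σ hσ u v
      have := hσ (e.symm u) (e.symm v)
      rw [hadj, hadj]
      simpa [Equiv.permCongr_apply] using this
    exact
      { toFun := fun σ => ⟨e.symm.permCongr σ.1, m1 _ σ.2⟩
        invFun := fun σ => ⟨e.permCongr σ.1, m2 _ σ.2⟩
        left_inv := by
          rintro ⟨σ, _⟩
          apply Subtype.ext
          ext1 v
          simp [Equiv.permCongr_apply]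
        right_inv := by
          rintro ⟨σ, _⟩
          apply Subtype.ext
          ext1 v
          simp [Equiv.permCongr_apply]
        map_mul' := by
          rintro ⟨σ, _⟩ ⟨τ, _⟩
          apply Subtype.ext
          ext1 v
          simp [Equiv.permCongr_apply] }

end NutU

/-- For every finite group `𝔊` and every natural number `N` there exists a nut graph on
more than `N` vertices whose automorphism group is isomorphic to `𝔊`; in particular every
finite group is the automorphism group of infinitely many pairwise non-isomorphic
nut graphs. -/
theorem nut_graphs_f_universal (𝔊 : Type*) [Group 𝔊] [Finite 𝔊] (N : ℕ) :
    ∃ (n : ℕ) (G : SimpleGraph (Fin n)),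
      G.IsNut ∧ N < n ∧ Nonempty (G.autGroup ≃* 𝔊) := by
  have : Fintype 𝔊 := Fintype.ofFinite 𝔊
  let f := Fintype.equivFin 𝔊
  let c : ℕ → 𝔊 := fun k => if h : k < Fintype.card 𝔊 then f.symm ⟨k, h⟩ else 1
  let K := Fintype.card 𝔊 + N + 3
  have hK : 3 ≤ K := by omega
  have hc : ∀ s : 𝔊, ∃ k < K, c k = s := by
    intro s
    refine ⟨(f s).val, ?_, ?_⟩
    · have := (f s).2
      omega
    · simp [c]
  have hcard : N + 2 < Fintype.card (NutU.Vt 𝔊 K) := by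
    have h1 : 1 ≤ Fintype.card 𝔊 := Fintype.card_pos
    have h2 : 4 * K ≤ Fintype.card 𝔊 * (4 * K) := Nat.le_mul_of_pos_left _ h1
    simp only [NutU.Vt, Fintype.card_option, Fintype.card_sum, Fintype.card_prod, Fintype.card_fin]
    omega
  obtain ⟨G', hn, ⟨ψ⟩⟩ := NutU.transport (NutU.nG K c) (by omega) (NutU.x0 𝔊 K)
    (NutU.x0_ne K hK) (NutU.x0_ker K c hK)
    (fun y hy => ⟨_, NutU.ker_unique K c hK y hy⟩)
  obtain ⟨χ⟩ := NutU.aut_iso K c hK hc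
  exact ⟨_, G', hn, by omega, ⟨ψ.trans χ.symm⟩⟩
end

section
/- For every finite group 𝔊, every d ∈ {8, 12, 16, 20, 24}, and every natural number N, there exists a d-regular nut graph G on more than N vertices whose automorphism group Aut(G) is isomorphic (as a group) to 𝔊. -/
open scoped Classical

/-- Gadget data: rows of the adjacency matrix as bit masks, an inverse modulo 7 of the
non-root part in base 8, the set of vertices where the kernel vector is `1`, and the
table of (twice the) triangle numbers. -/
structure Gad where
  rows : List ℕ
  inv : List ℕ
  pos : ℕ
  tt : List ℕ

def smN : ℕ → (ℕ → ℕ) → ℕ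
  | 0, _ => 0
  | k + 1, f => smN k f + f k

def allN : ℕ → (ℕ → Bool) → Bool
  | 0, _ => true
  | k + 1, f => f k && allN k f

def Gad.adj (g : Gad) (i j : ℕ) : ℕ := g.rows.getD i 0 / 2 ^ j % 2
def Gad.iv (g : Gad) (i j : ℕ) : ℕ := g.inv.getD i 0 / 8 ^ j % 8
def Gad.ps (g : Gad) (j : ℕ) : ℕ := g.pos / 2 ^ j % 2
def Gad.t (g : Gad) (j : ℕ) : ℕ := g.tt.getD j 0

def dl (i j a : ℕ) : ℕ := bif Nat.beq i j then a else 0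

def Gad.okSym (g : Gad) (n : ℕ) : Bool :=
  allN (n + 1) fun i => Nat.beq (g.adj i i) 0 &&
    allN (n + 1) fun j => Nat.beq (g.adj i j) (g.adj j i)

def Gad.okDeg (g : Gad) (n d D : ℕ) : Bool :=
  allN (n + 1) fun i => Nat.beq (smN (n + 1) (fun j => g.adj i j) + dl i 0 D) d

def Gad.okKer (g : Gad) (n d D : ℕ) : Bool :=
  Nat.beq (g.ps 0) 1 && allN (n + 1) fun i =>
    Nat.beq (2 * smN (n + 1) (fun j => g.adj i j * g.ps j) + dl i 0 (2 * D)) d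

def Gad.okInv (g : Gad) (n : ℕ) : Bool :=
  allN n fun i => allN n fun k =>
    Nat.beq (smN n (fun j => g.adj (i + 1) (j + 1) * g.iv j k) % 7) (dl i k 1)

def Gad.okT (g : Gad) (n K : ℕ) : Bool :=
  (allN (n + 1) fun i =>
    Nat.beq (smN (n + 1) fun a => g.adj i a * smN (n + 1) fun b => g.adj i b * g.adj a b) (g.t i)) &&
  Nat.ble (g.t 0) K && allN n fun i => Nat.ble (K + 1) (g.t (i + 1))

def Gad.okF (g : Gad) (n : ℕ) : Bool :=
  allN n fun i => allN i fun j =>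
    !(Nat.beq (smN (n + 1) fun a => g.adj (i + 1) a * (g.t a * g.t a))
      (smN (n + 1) fun a => g.adj (j + 1) a * (g.t a * g.t a)))

def Gad.okC (g : Gad) (n : ℕ) : Bool :=
  allN n fun i => Nat.ble 1 (g.adj 0 (i + 1)) ||
    !(allN n fun j => !(Nat.ble 1 (g.adj 0 (j + 1) * g.adj (j + 1) (i + 1))))

def Gad.ok (g : Gad) (n d D K : ℕ) : Bool :=
  g.okSym n && (g.okDeg n d D && (g.okKer n d D && (g.okInv n && (g.okT n K &&
    (g.okF n && g.okC n)))))


def gads8 : List Gad := [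
  ⟨[30, 11157, 36259, 18161, 13131, 23756, 52536, 61486, 45654, 27930, 39532, 22118, 44464,
     54162, 43752, 30148],
   [10472355740597, 22225223206230, 20004037285486, 12099611474645, 29692001273699,
     3353406966926, 21996054791314, 28064602034464, 11585700451185, 24957252561521, 6329141152145,
     1932943097883, 2238080614616, 4702676937987, 13745687651626],
   65025,
   [6, 26, 22, 24, 26, 32, 26, 26, 28, 26, 28, 26, 24, 32, 28, 28]⟩,
  ⟨[1566, 11549, 22867, 49891, 53415, 42840, 13996, 20312, 47270, 25833, 6883, 58758, 58708,
     39778, 39580, 31032],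
   [15201191965507, 15828607062144, 15819552244757, 19538910128257, 19608094717227,
     15828271604035, 20158473574017, 20227990900133, 457921429, 3711585792033, 14343021, 4793425,
     819419573, 814888739, 9554139],
   65025,
   [14, 22, 24, 22, 20, 24, 26, 22, 26, 28, 20, 26, 24, 26, 26, 28]⟩,
  ⟨[1566, 22897, 42217, 10965, 19851, 54598, 38446, 43804, 29362, 22985, 53365, 45722, 12130,
     55692, 42802, 27876],
   [28452518751456, 28502859723788, 2596738966915, 20708604449430, 15837023113886,
     20717357132803, 3215209431401, 29052510310770, 10859086938742, 10360573540051, 22579870653578,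
     17623070389680, 3299455200118, 10309323901723, 23129787349046],
   65025,
   [12, 24, 28, 28, 24, 32, 26, 30, 28, 20, 26, 26, 26, 26, 24, 28]⟩,
  ⟨[1566, 45397, 3787, 7525, 37795, 59608, 26158, 22324, 59546, 50389, 13005, 61740, 27802,
     40290, 39904, 27442],
   [21191947085388, 231963405641, 16725035499881, 16731468063795, 16731473198358, 21191944963660,
     240561363702, 17834215293827, 549760602706, 13752894371524, 549757938688, 68863243995,
     558352971484, 4467990949254, 13744306534084],
   65025,
   [16, 22, 26, 22, 24, 24, 24, 24, 24, 26, 28, 28, 20, 26, 26, 30]⟩,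
  ⟨[1566, 37949, 21803, 13127, 42211, 11926, 23448, 59760, 51916, 7529, 25143, 58336, 57934,
     40120, 40388, 31122],
   [21063666341069, 25394086557457, 24845140843427, 17705156005210, 7871150852441,
     18263655175075, 25394083632262, 7243802778018, 27015488428908, 14311523173248, 68724236945,
     1185703742244, 4407729365578, 1116988825974, 13263365871980],
   65025,
   [18, 28, 26, 26, 26, 26, 28, 34, 30, 22, 26, 32, 24, 24, 28, 28]⟩,
  ⟨[30, 43349, 19611, 12981, 21583, 52168, 46386, 50988, 15074, 59816, 30932, 38694, 44376,
     22346, 42676, 23266],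
   [7545908577636, 10038083892356, 5020478761237, 11892423270674, 21316554597788, 19461124737294,
     17606790718876, 19530937129881, 25759298803427, 5026211842925, 30099377637091, 30099368087558,
     23903883881045, 28301928294997, 25690574570577],
   65025,
   [10, 22, 26, 20, 26, 30, 28, 28, 28, 32, 26, 24, 26, 24, 26, 26]⟩]

def gads12 : List Gad := [
  ⟨[6270, 679157, 734931, 221041, 325263, 367563, 862639, 975222, 454376, 775484, 895774, 193899,
     887359, 1002964, 994202, 991152, 718444, 387982, 718320, 390854],
   [54080720290985037, 103925104830264353, 72481060679125377, 18131887705834258,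
     55650910437455899, 18881176001650864, 73941407793461641, 36065822165568873, 91379657328708258,
     18735727349699597, 109452217120512035, 73765311299529360, 19585140079901354,
     111562037546994356, 18114839022064680, 73615883959031561, 50281066507391048,
     19703798125559856, 38992090600878891],
   1046529,
   [40, 70, 76, 74, 70, 74, 72, 82, 84, 80, 72, 72, 74, 82, 76, 78, 76, 74, 76, 80]⟩,
  ⟨[30846, 931737, 648177, 212931, 826279, 710485, 937645, 228446, 375870, 909438, 510442,
     1000921, 901563, 508815, 573157, 751412, 442252, 896234, 737106, 449142],
   [84529776104167260, 86251071239472467, 41249955297839917, 24952069327791955, 4176065669465381,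
     61024562300270491, 23985933589620848, 64508803353537325, 120848129079601461, 515782719936301,
     284825152127880, 114917294641604497, 81358448994031734, 55408666925975118, 81851090898113243,
     59350556177034010, 91279326337851540, 11347260739262133, 1532495978136228],
   1046529,
   [48, 74, 78, 78, 76, 78, 78, 74, 76, 74, 78, 74, 70, 74, 76, 80, 80, 78, 76, 80]⟩,
  ⟨[30846, 255921, 372409, 556517, 710343, 605519, 372537, 449310, 996074, 1003990, 968830,
     386285, 746425, 432495, 925339, 994518, 957286, 653202, 651204, 513848],
   [104481138914272777, 69185830212375337, 105862967378720, 6987712637764683, 61707234116129034,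
     115765571026814029, 29303200152078621, 29303200152111381, 115204982821425930,
     62303428195031330, 116326684867480619, 59802489137346837, 94050850605197584,
     55530668546345986, 92738353121290268, 42165268352408817, 113336462056992811,
     81702599622243894, 28804832184184861],
   1046529,
   [56, 70, 72, 78, 78, 80, 72, 76, 82, 82, 76, 82, 78, 74, 78, 80, 76, 84, 78, 78]⟩,
  ⟨[30846, 358249, 188265, 250103, 634825, 894287, 420031, 751448, 969398, 892310, 932534,
     194389, 732815, 859379, 887247, 1002300, 455354, 892364, 780130, 456624],
   [66723709875530385, 78032366835728738, 38352705046070890, 115214550991267013,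
     117991688752745730, 2478742587684, 31595811320509750, 54838282263350473, 27614700918824977,
     68498212002604082, 61809507232264449, 14549954644149918, 24937282990395461, 36072801890868449,
     113475550504306739, 103095480426697864, 41319676403266093, 104330721129678421,
     66068626568146083],
   1046529,
   [58, 74, 76, 78, 70, 72, 74, 76, 76, 78, 76, 74, 76, 78, 70, 82, 74, 74, 80, 78]⟩,
  ⟨[30846, 433397, 878035, 212913, 186735, 967387, 500535, 867886, 882268, 773608, 588686,
     497307, 839067, 968141, 735029, 867954, 969676, 879226, 244198, 260004],
   [31652775251692874, 9665124328065457, 83679342258934645, 32216345348269158, 80269720413654372,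
     61132030616843976, 59969887233271826, 103732334961440464, 7698837965945265, 84240992145300185,
     76611912081875744, 96317683359062340, 2715298055742384, 95189880074867424, 23962313334569645,
     120652513266407059, 55895993334682704, 13696705128676710, 1062725781144321],
   1046529,
   [52, 80, 76, 72, 76, 72, 78, 76, 78, 80, 80, 78, 74, 70, 74, 72, 76, 74, 76, 80]⟩,
  ⟨[6270, 194229, 1016635, 294757, 953287, 873807, 243129, 896850, 715004, 482462, 621290,
     128921, 740971, 970186, 474922, 993750, 843492, 848726, 778940, 505268],
   [91309671639799150, 83603050845288757, 92554218652144997, 102459254304934050,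
     83604977800732765, 87158015766659291, 65718173406795657, 78025042025524341, 5479024016273758,
     117940928941824099, 93924780250083398, 45077102781285988, 75848969216214082, 4937924685711563,
     80503368146522377, 49542015094784387, 68425706805565452, 44698550933084776, 23450682238323557],
   1046529,
   [34, 68, 76, 76, 78, 76, 68, 82, 78, 80, 84, 72, 78, 80, 82, 86, 78, 80, 78, 78]⟩]

def gads16 : List Gad := [
  ⟨[123390, 1833405, 12267227, 10214519, 16194447, 7175627, 7778221, 15520631, 7173875, 14024148,
     12254060, 16221822, 13559738, 14587751, 15177643, 7569099, 12372799, 15531102, 8092656,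
     16201134, 15576670, 10472948, 10419184, 8093340],
   [488987959180842771301, 358185945140217620868, 470755974926399818293, 444401340173387354465,
     484473431256301939474, 378935856358117880536, 49611738806120219702, 234598352458768467338,
     397517863310834412833, 407271969858582100994, 104529472809524701212, 226291376802879146221,
     198454313348747323945, 227872806638812254388, 450594271880268418357, 113283033920027900481,
     127276725192659909986, 504982541223583601234, 148330861352823937816, 428689585352518833833,
     161856655675257274928, 334074065218497200373, 187543744144528829862],
   16769025,
   [90, 154, 160, 158, 154, 156, 156, 154, 160, 162, 162, 164, 166, 154, 154, 150, 156, 160, 162,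
     160, 164, 158, 162, 162]⟩,
  ⟨[516606, 3135473, 12470265, 8043765, 12970863, 14466143, 16454463, 9830159, 7007959, 11794902,
     5765550, 15562680, 16715498, 14127033, 15437719, 3631035, 15269587, 14219087, 16301239,
     16210286, 15644396, 14539598, 4160888, 4160244],
   [96598582072712020624, 278103408844752032690, 77305178355665249522, 420186799802505880201,
     205307404267001756812, 320905859679741118021, 407516004534494307418, 75899881515263269227,
     416637080285304078530, 246906228651377871017, 454917685896828622448, 61864334368201595980,
     449370649569307747505, 240337454565699551501, 246244008429294989974, 369750258013816927856,
     332708217803389232875, 382348933787014357170, 108556373545442527978, 41535769086404658702,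
     224358096816281430219, 332675284922895788594, 40382843143241214553],
   16769025,
   [122, 156, 154, 154, 156, 158, 162, 156, 156, 162, 158, 162, 166, 160, 160, 158, 154, 154,
     154, 162, 166, 158, 160, 160]⟩,
  ⟨[516606, 10187765, 3647467, 7839653, 15495139, 8212959, 12238007, 14080127, 11759167, 8248606,
     13499228, 13613016, 15396586, 16358743, 16357299, 9928397, 15789871, 16554447, 16420541,
     16154226, 3138542, 6255484, 11501240, 5242322],
   [467154116664389813254, 173696125468769106568, 14625022992520514960, 446245303421978645418,
     402722376062161555996, 476809173829996894104, 256143395555680594326, 172717184461776991786,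
     376615000169691767646, 90388169090586292304, 385968819799604435682, 157404265546557327250,
     78876528967577949608, 23289038526929792092, 265690846713797354612, 4368827356054662438,
     235413335757471046560, 334797767045730060674, 319723012753237620436, 417977336189006782825,
     424659179986210182965, 321278090393833812050, 412395475588877343766],
   16769025,
   [120, 160, 164, 164, 160, 158, 158, 160, 156, 160, 162, 164, 160, 154, 156, 160, 158, 156,
     156, 166, 160, 158, 164, 164]⟩,
  ⟨[516606, 11435829, 7839187, 14131153, 9696719, 14221251, 6803133, 13351293, 16419519,
     15531370, 12415614, 8217582, 4155070, 13360819, 6209139, 15885309, 8273117, 10875359,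
     12279375, 16088994, 15588668, 14655302, 12184556, 8300474],
   [371591460487714201813, 246385878854506466314, 409639554175735538243, 298959412955334982768,
     305315147840360736422, 260251039345018362068, 464174216460611405715, 309526546159224504342,
     426582696132311854234, 166720351999038382252, 151486526315814762206, 200180929077241618724,
     469026588505045161136, 256573256230638004273, 34703346962007439604, 38148304799023604248,
     309191903236767521558, 79809606849100724491, 155388746054516819691, 503072628708639696042,
     19143741445761435370, 270648760443089850640, 28574215817033009501],
   16769025,
   [124, 162, 158, 154, 162, 160, 158, 162, 160, 166, 162, 158, 158, 158, 156, 162, 162, 162,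
     162, 170, 160, 162, 164, 160]⟩,
  ⟨[516606, 13822957, 14589115, 5208439, 11890157, 5996063, 11919131, 15548183, 11450075,
     12312034, 16618484, 7267070, 7596012, 13883835, 14465659, 15826759, 16299769, 16530223,
     16403933, 16207788, 3143286, 14655440, 3144878, 3139542],
   [179916932743615011204, 152816521978862126960, 127293239426921640878, 206044486497674266716,
     418038361930441998565, 345937851412199576769, 302088076570506343041, 96926637397918096112,
     24252257859254446981, 373629234451743016013, 99297766270606316715, 481346255783231753363,
     29572960325401336137, 267540321404898206546, 421459437068460517622, 258275902207113871570,
     175993235285114692361, 22602499798988352579, 171168642609524890267, 301697564383650007776,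
     78045151817132287396, 175285611241020775747, 93999823618334413906],
   16769025,
   [118, 158, 154, 162, 156, 162, 160, 154, 156, 164, 168, 156, 156, 158, 154, 156, 156, 156,
     160, 160, 154, 168, 160, 156]⟩,
  ⟨[123390, 3800549, 14618355, 7782369, 11983845, 11335327, 8230687, 5991743, 13481691, 15980924,
     15428078, 13104798, 12479354, 15637931, 14622387, 7809915, 14340039, 7995036, 16316796,
     12023270, 11522782, 14595706, 11005900, 8224564],
   [454308510325718320371, 169130572971664096654, 261457187035577456435, 416644626369651494130,
     352869003551077947480, 104287241249077867814, 250220740566180706148, 417083709776024504018,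
     132355732139762271505, 233223782603739010378, 12273899591989564754, 104287241798833681694,
     452856744103187523393, 194033765463343571206, 156906081077063755843, 194198186448905486624,
     452415373750806718084, 36997106400812341161, 193774861273826771043, 156798276147926370216,
     19631776402, 129370867535316904721, 452271258514601331414],
   16769025,
   [86, 154, 152, 156, 154, 152, 156, 158, 150, 162, 162, 158, 164, 160, 152, 156, 162, 160, 160,
     164, 160, 164, 162, 162]⟩]

def gads20 : List Gad := [
  ⟨[2066430, 246903293, 215965051, 242851703, 190807631, 176089039, 132983743, 61865827,
     265873135, 100268537, 255261117, 233567964, 265744030, 66559986, 229613494, 263028649,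
     259320543, 267943095, 258602231, 132566013, 266549055, 127921898, 262093692, 259718086,
     150994896, 150975994, 150986574, 131587390],
   [1719849192601074531781356, 484273342120079837475365, 28579216836515568142211,
     196126119710601370567373, 1377186273959450669887772, 1301836485937144321493726,
     1059375274120160907641093, 44519082793757914997982, 144266806312632553986413,
     355388846792639182384461, 1572699396667786107967832, 2049663948853637966275088,
     1138351240055691379999370, 1404508339051677640200390, 1939586468857400960516969,
     760785911737646647403824, 840592886010260359059888, 78226899205358566263405,
     1863995898747401213916240, 120546392203723149464843, 1938139131119671876903171,
     919263193380863598698634, 192826365078694601786588, 627387123646996473894945,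
     191276775894860597146548, 741784388166080059755045, 1587930426258616667226125],
   268402689,
   [170, 270, 274, 272, 270, 268, 272, 276, 266, 272, 268, 280, 276, 276, 276, 272, 264, 268,
     266, 270, 272, 276, 278, 278, 276, 272, 272, 280]⟩,
  ⟨[8357886, 231976829, 194901371, 263092951, 83795695, 125034391, 199114399, 264011129,
     242876071, 128841083, 167201783, 250865146, 256893948, 99605454, 176144300, 267025207,
     267157287, 199031931, 266565341, 116650973, 267013623, 253620153, 220200307, 253734622,
     116897518, 163568620, 167623610, 116907470],
   [1833368094731483953693258, 1051821862435903268292833, 1078066085637507404974681,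
     516733720543633238350689, 191637625427214758959872, 1215232621190512448748894,
     1953993040505733367141790, 164234915992459075216283, 1165701694824985380149617,
     2008870088904087272827521, 2003106788207399548774056, 1034511929950142311278728,
     1160286370077688491371445, 349759548951264452298275, 834737150199202163942315,
     1918833422960242853450771, 605724812703972780300916, 1229265106087124643814172,
     1834551272865039066633813, 1249994407127221957890178, 1957745656735888180983409,
     42772930732920749003062, 1360517242488807200577206, 1083788499287389704373929,
     1060777793393027196422964, 626021533234897110194968, 1300724429992419422503646],
   268402689,
   [214, 276, 262, 272, 270, 274, 276, 266, 278, 268, 274, 274, 276, 272, 274, 266, 268, 268,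
     272, 268, 272, 270, 270, 276, 268, 274, 274, 270]⟩,
  ⟨[8357886, 233732477, 123597563, 246800279, 230352623, 259682135, 64732599, 115866461,
     213777643, 199687357, 182418297, 100513770, 190828494, 263426038, 258938814, 129711069,
     266927565, 243070707, 265969551, 83352951, 196001149, 253488059, 261054183, 257798106,
     251001462, 167245548, 166717886, 133658426],
   [925900346398496914968787, 2055620197538560097755994, 477463459636634121026283,
     1153712184795675425360200, 927624971573750582798545, 1068445150455620132542233,
     930949276378298466259010, 324860211635493944121640, 39444508576659084563747,
     303196739160515049272148, 1149179486359849813883635, 1402747660580833261991987,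
     760563027123163486654682, 947500655846323317791470, 391185782391757247756526,
     194816897647833573499982, 926934488356001210882321, 511923441261386330605737,
     1932688946426576701630106, 453520477688442912357652, 394182507699979609713522,
     1447480677376151321369522, 334419008537167711451028, 1823906875755126570955792,
     1597805118388572729461084, 160618748441337176132912, 1538422970484760140166771],
   268402689,
   [216, 268, 268, 272, 272, 274, 276, 270, 272, 270, 272, 272, 274, 276, 278, 276, 270, 270,
     272, 272, 270, 272, 276, 272, 274, 276, 276, 278]⟩,
  ⟨[8357886, 115290077, 62781411, 199946195, 258800107, 242941845, 227539743, 183367231,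
     215964799, 131558639, 167197615, 129947514, 259386868, 234067710, 255564796, 257849597,
     265713607, 150859627, 199466967, 265472511, 246152999, 265714877, 95401915, 125775822,
     250478172, 230546110, 200932210, 121632248],
   [999745042011963320501853, 1350855814766782135329131, 1296512321024119047272233,
     2062165469873775071769283, 1036203917244957267683056, 1742560319768483351831210,
     556337266676517439635555, 1616903613416958941227627, 2046218666336049385068978,
     1633973038959066119529115, 2014735522251879840062473, 519715514732248427603561,
     516162133015619814631682, 1627261755501932725228891, 1560854724128660403110444,
     1413465439243604899458376, 323722733098890225410142, 1428043617223692790375705,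
     1111687360913406614341326, 1996016404066292406212204, 1257748077703289679328836,
     92488543625574906075168, 955888844009743720396509, 761152642403150790671109,
     1351365593308556256655539, 658864188976294180633754, 1607012096599858975522083],
   268402689,
   [220, 276, 268, 270, 278, 274, 272, 270, 270, 270, 278, 274, 280, 272, 278, 270, 274, 272,
     270, 272, 272, 266, 270, 278, 276, 276, 276, 274]⟩,
  ⟨[8357886, 222247805, 113158139, 231669047, 265480143, 263372687, 64880279, 225173365,
     223337151, 180080119, 259355389, 266728426, 50327018, 117398654, 201146328, 117316605,
     232685507, 198030271, 121371983, 245887951, 258340471, 199032487, 229899737, 258734716,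
     251088378, 230620788, 199077310, 133910458],
   [1700926029111699136218862, 760338637239245177652341, 912719786514662134153227,
     458973731702691305246739, 956632647686466979310080, 961762814062778466478157,
     628748823050891527750162, 100739442321597919841328, 966996951528525025422032,
     1611730467033187847910408, 2024716446094082386911606, 1219017729231241441463512,
     2047516198104944902066604, 931858403735884702954273, 1613953059139181513349968,
     1948260581855666723163330, 1225502237473220767833514, 1013226660587229994304000,
     166636037099416168739210, 1005069213416160325092457, 1618965618335941432320134,
     853973765426024699749734, 961644520015219623544899, 477981414244456031765121,
     1103528686531219526361672, 1915051406761503316023333, 1450602818793884193764053],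
   268402689,
   [222, 268, 276, 270, 270, 270, 270, 268, 274, 272, 270, 274, 270, 274, 278, 272, 272, 268,
     272, 270, 270, 266, 272, 272, 272, 276, 270, 276]⟩,
  ⟨[2066430, 183422845, 116346619, 166968279, 131922159, 82829207, 252688287, 230585981,
     209583723, 192359919, 263320551, 265941822, 58715640, 263643096, 266026422, 226180475,
     200859501, 230486767, 133837815, 244832759, 57671577, 249018286, 263576382, 258960574,
     249036504, 234716758, 200207860, 132902858],
   [1988307674300013775856348, 250637092323944174364787, 1230799536820307299522059,
     364678305454282421474017, 1701282616113489429259090, 957828844666369566456557,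
     306024833215416895613108, 403439752291447465902964, 2033247056427269110729376,
     2028122240489780094591489, 804229192109634205923531, 352085286252002416415384,
     407804500584411472238261, 1957587889517592609634628, 686591561753749725942561,
     493651260370267108663953, 621697623797034484980112, 1685106650299430550063200,
     1870512141265146696351944, 1841849120635397744111808, 855129566710014589548814,
     801743513733485757748468, 747034599806863542225954, 472956086380318034699072,
     2005103228423968997313325, 1424067917111411603460660, 784672443153220309996294],
   268402689,
   [180, 268, 272, 270, 272, 272, 270, 272, 270, 270, 264, 278, 272, 280, 276, 270, 270, 266,
     270, 270, 268, 274, 278, 278, 280, 278, 276, 278]⟩]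

def gads24 : List Gad := [
  ⟨[33431550, 3199982525, 1337981403, 1535108983, 3615358159, 4256759755, 804222909, 4216843127,
     4241993455, 3219504619, 3201825657, 3808417719, 4122734199, 4125054972, 4025138430,
     3690749886, 2137931742, 4291132879, 3748376541, 4225103999, 4276665791, 4288010879,
     4188008409, 2121989991, 3195007741, 4122988254, 4223104886, 3858745326, 2818553786,
     1610317794, 2936011196, 1602158514],
   [6298568731998587990548537434, 2703208666137923785303090947, 2056852111497580008264517665,
     6756628292844185009620887832, 5208547101356299727882036534, 4298541584398570227069175443,
     5169863708103148693445950706, 6499427480672894827120765833, 4141318354520919320888361477,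
     1481286226092379191209498371, 4509389117926343175859702049, 1329223509133917035149408390,
     8328495556609405466886842640, 5231806786638721654761471141, 4687854601597770607300632640,
     5268883510229302430990471252, 8227407572787736974674926788, 6312447770058678207197071211,
     2553374511492105388392112990, 218658789442888493128847473, 6703243985490078444504852402,
     8078883287423112849568433718, 6833388899775751847797229603, 3716623065756471994295413486,
     4502876371789797715133957845, 2500126388389466857037815049, 4445834832801670181692053312,
     940044505704719710260077749, 5050023244751471993250863773, 7598122723756136770723747656,
     2244764941508922738788649557],
   4294836225,
   [280, 414, 418, 410, 418, 416, 416, 408, 418, 414, 410, 414, 414, 420, 420, 422, 420, 412,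
     420, 408, 414, 412, 416, 416, 416, 416, 422, 416, 418, 422, 418, 418]⟩,
  ⟨[134094846, 3069697529, 935328633, 3883726775, 4158226319, 2665475023, 1526722471, 2141707899,
     3418259071, 2121756157, 3455957979, 3210393591, 4257738143, 4226523004, 3991901182,
     4260986094, 4215207670, 4283268071, 4059781103, 2667048317, 2142080895, 4217235407,
     3484352123, 4267505143, 4000841117, 1039870975, 4091207359, 4093378528, 4005542646,
     3753376414, 3187144664, 2112879930],
   [7869248206908795617727227988, 2117514045436317905780860530, 8391779463416741605164503625,
     4766425329845505037059053660, 1954631833416256953093831538, 58416047303980593798591576,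
     6217329318190449177701571858, 4676583530812981131340750148, 6476596580825420564188148786,
     7998927725906957391201088547, 7481764862843696267680981139, 4568694922337152677333042965,
     903231510232164909742069413, 3276973683546901453434999466, 4740222421004525494687357076,
     7481173842043887520649930161, 844345855942429068316329801, 4052813666191744547213580320,
     1895615252630897440492497746, 682494374696548219584843883, 275198689295815829755923761,
     7868087505620605305292065312, 4450514875546847977845987536, 3146132734773866517780249793,
     5387211456059427099658244874, 6725399275352874508102741009, 5690263692861018433913664949,
     4130203623654786766813792158, 5372005236494894506694794350, 2984963306742345080506437034,
     6585228180883908433011808142],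
   4294836225,
   [358, 412, 416, 416, 414, 418, 424, 412, 414, 414, 418, 416, 420, 420, 418, 422, 418, 416,
     414, 414, 416, 414, 412, 410, 416, 420, 418, 422, 422, 424, 424, 424]⟩,
  ⟨[134094846, 4208715741, 2071755771, 1325329911, 3753097967, 4271767325, 2918971807,
     1325383263, 4284741231, 3185040823, 4185783211, 4287092477, 4155338741, 2818495998,
     4185866094, 939470842, 3622756338, 3925732315, 4154195629, 1995961583, 1869539071, 4217107933,
     4206618575, 4249860859, 3199729493, 3716004287, 4221418489, 4159852542, 4025343798,
     2650734438, 2667535806, 2145877874],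
   [6231625450830029065879230723, 242712428903213641811146480, 4055086788074310880711427100,
     243826632281865870168756380, 931673817463690230413787929, 2902576765104198805704035342,
     5231861609383884277339822848, 6430457186881276630965632171, 8282564973091564764611843634,
     1287934351801168928003266444, 5853619617273577131331304280, 7952627227690249506401859674,
     83199921233781396029079916, 7710885505530876084342625653, 6457688694017927651775619755,
     960013291898287634713725841, 6301666143299641305907672733, 3874011110565875558713933156,
     1901414065239990351459792145, 7660803654515549188207331404, 1631262311367390901689767697,
     7635957165884388891130188209, 6234431676391091261974079089, 6562253795589050803355796496,
     5148542941391491864709173414, 5319994379863671953054981189, 8481006891642069043226717274,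
     1441952379565906812589578593, 8227469389049684921950079074, 5826499460202390522131997320,
     1977371560971089962052157637],
   4294836225,
   [340, 414, 414, 422, 418, 416, 418, 422, 414, 418, 410, 418, 422, 416, 424, 416, 418, 416,
     418, 420, 420, 416, 420, 416, 418, 414, 416, 418, 426, 422, 418, 424]⟩,
  ⟨[134094846, 1609038585, 4210686937, 2943344551, 4213159911, 3858464219, 2030026551,
     1572798015, 3199925885, 4269108703, 4187978745, 3488016367, 803194367, 4158492662, 4159152046,
     3086711262, 3749508734, 4141669883, 2145615579, 3992172029, 4268472309, 3751660527,
     4188011119, 3144613351, 3203267771, 4189584159, 4181719979, 2013077470, 3489130454,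
     3487496060, 3196022518, 2012999484],
   [6353305458492527645274737373, 5619616611005657530511985411, 646287481921686125008761955,
     2217564033888345372778124461, 4089873390490568190438423232, 2798316180786833433233065170,
     683374673526298776300562700, 6906791854749471345191951241, 5598316217482909373236102721,
     8313237063320529699591299266, 1580520410111931436284631603, 4226802398522819955090196396,
     6695856143378200204426656912, 4345278546672693284040130629, 5282026562359050961994191714,
     3064507596176929337191465810, 1987821391859819075709003568, 6966082385811208368414921614,
     8318151817863975546518766812, 692360429493753021704706339, 7165155272544196483823518832,
     8262813653942038840187821422, 5133827806944964621198690608, 3739288639296703876770969414,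
     5807307364508929182291133956, 1323841311552454003771254002, 5605971015690123673446204045,
     357357054361621004185942755, 1823533067228229999115646032, 3468431915807185384093330721,
     1568035583697861321592746533],
   4294836225,
   [346, 422, 416, 418, 416, 416, 418, 412, 418, 420, 412, 416, 420, 416, 422, 418, 420, 416,
     420, 422, 422, 416, 408, 416, 418, 412, 410, 414, 420, 418, 422, 424]⟩,
  ⟨[134094846, 3824680677, 2482958323, 2613051313, 2012413805, 4242231263, 1006107063,
     1337966191, 3971997309, 2136724927, 3755324351, 4251836927, 4004505563, 4285258974,
     3085908862, 4259069918, 4269572074, 4285035519, 4281982415, 3950508973, 4224550911,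
     4124015071, 1606151799, 4285584895, 1560211167, 3168761567, 3152543665, 3890200552,
     3891785340, 3737123698, 3120545714, 2126511406],
   [4416312586261683115738453237, 3836630974199293280947614422, 2249512117753589267095106075,
     6765971422672326113961327178, 646334547082805170704758493, 8074344896202441693892806677,
     4992118423553022692079103349, 1306412398577842568682334409, 6889557551480385721364767051,
     5674794871875852394901741592, 6742045109001778686850049600, 4605447193152859273402698435,
     1056920984868773104466462646, 3037984188551443802829133909, 6920063324716438316486074508,
     1243495498588116020123776357, 6666945246869735095955221150, 4404847201662515798587311187,
     2852032997311142725234023772, 6867117484455683651125969970, 252968616107405225910012200,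
     4508464725775598488214685210, 956959626240457625975203756, 3337448728596584176772469580,
     2277189165230889442923293750, 1820059828906789172805847570, 1401401708148976515548554484,
     370864189610178841728367762, 5210723018414010490834950964, 798338385488097127447021444,
     2553597272805908946657413723],
   4294836225,
   [352, 410, 416, 408, 418, 412, 412, 414, 416, 414, 420, 414, 420, 420, 422, 416, 422, 412,
     414, 414, 420, 418, 416, 410, 418, 414, 408, 420, 418, 422, 416, 422]⟩,
  ⟨[33431550, 4118248925, 3883726715, 4142571511, 1004533103, 4288921309, 3808392895, 4258918251,
     2679078559, 3925342701, 2583620095, 1342044075, 2127547263, 4284190710, 4290093014,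
     1056931516, 3745446898, 2129508219, 2111561559, 4147625437, 4218285783, 3751530351,
     4271292127, 3211190265, 4240273335, 4244371836, 3689937326, 3891789744, 2818569658,
     3688821502, 2944367342, 2147051502],
   [7862878786353159262163232388, 3065084340675438317033802280, 1741873452397162447920226498,
     7933084611990279178729242667, 6206137587696254412028479910, 3374476991827016493504773193,
     6510007234668652262315210138, 3192170195144682628656471345, 5830576632498439316612915906,
     3014359913368885928156835920, 7668038118393911967621231105, 4425828777187259590778775449,
     663484346669091334210101904, 8209086484442081599384200453, 4343259720898708214148313521,
     6008430176890406402945825713, 4346218359879442240343828371, 7026902628874828138679028082,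
     3975261696528202445210354782, 6271357736943564693988813365, 6519173473650093065367863361,
     4433065683676378792321358514, 2052968579651254299170013430, 1051417204309491208974327858,
     8298892447237766095014100997, 1476126004929793102309799648, 1039840337968164538420224232,
     255764632536468146873295388, 1948060191706033292524586166, 81667833527970613227587290,
     1257349073538554267786632278],
   4294836225,
   [292, 412, 412, 418, 416, 410, 414, 412, 414, 412, 414, 412, 418, 420, 420, 420, 424, 416,
     414, 408, 420, 412, 414, 418, 420, 424, 422, 422, 418, 422, 424, 424]⟩]

def colD (c : ℕ) : ℕ := bif Nat.beq c 0 || Nat.beq c 5 then 4 else 2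

def dflt : Gad := ⟨[], [], 0, []⟩

def okFam (l : List Gad) (n d K : ℕ) : Bool :=
  (allN 6 fun c => (l.getD c dflt).ok n d (colD c) K) &&
  allN 6 fun c => allN 6 fun e => Nat.beq c e || !(Nat.beq ((l.getD c dflt).t 0) ((l.getD e dflt).t 0))


theorem ok8 : okFam gads8 15 8 18 = true := by decide +kernel
theorem ok12 : okFam gads12 19 12 58 = true := by decide +kernel
theorem ok16 : okFam gads16 23 16 124 = true := by decide +kernel
theorem ok20 : okFam gads20 27 20 222 = true := by decide +kernel
theorem ok24 : okFam gads24 31 24 358 = true := by decide +kernel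

/-- What is needed of a rooted gadget (with root `0`). -/
structure GadSpec (n d D K : ℕ) (R : Fin (n + 1) → Fin (n + 1) → Prop)
    (tt : Fin (n + 1) → ℕ) (z : Fin (n + 1) → ℝ) : Prop where
  symm : ∀ i j, R i j → R j i
  irrefl : ∀ i, ¬ R i i
  deg : ∀ i, (∑ j, if R i j then 1 else 0) + (if i = 0 then D else 0) = d
  z0 : z 0 = 1
  zne : ∀ i, z i ≠ 0
  ker : ∀ i, ∑ j, (if R i j then z j else 0) = if i = 0 then -(D : ℝ) else 0
  inj : ∀ x : Fin (n + 1) → ℝ, x 0 = 0 →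
    (∀ i, i ≠ 0 → ∑ j, (if R i j then x j else 0) = 0) → x = 0
  tri : ∀ i, ∑ a, (if R i a then ∑ b, (if R i b then (if R a b then 1 else 0) else 0) else 0) = tt i
  t0 : tt 0 ≤ K
  t1 : ∀ i, i ≠ 0 → K < tt i
  finj : ∀ i j, i ≠ 0 → j ≠ 0 → ∑ a, (if R i a then tt a * tt a else 0) =
    ∑ a, (if R j a then tt a * tt a else 0) → i = j
  conn : ∀ i, i ≠ 0 → R 0 i ∨ ∃ j, j ≠ 0 ∧ R 0 j ∧ R j i

/-- What is needed of the coloured base graph. -/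
structure BaseSpec {B : Type*} [Fintype B] (Γ : Type*) [Group Γ] (H : SimpleGraph B)
    (col : B → Fin 6) (D : Fin 6 → ℕ) (ρ : Γ →* Equiv.Perm B) (b₀ : B) : Prop where
  deg : ∀ b, (∑ b', if H.Adj b b' then 1 else 0) = D (col b)
  conn : ∀ b, H.Reachable b₀ b
  sep : ∀ b b' b'', H.Adj b b' → H.Adj b b'' → col b' = col b'' → b' = b''
  tri : ∀ b b' b'', H.Adj b b' → H.Adj b b'' → ¬ H.Adj b' b''
  adj : ∀ g b b', H.Adj (ρ g b) (ρ g b') ↔ H.Adj b b'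
  colInv : ∀ g b, col (ρ g b) = col b
  trans : ∀ b, col b = col b₀ → ∃ g, ρ g b₀ = b
  free : ∀ g, ρ g b₀ = b₀ → g = 1

/-- The base graph with gadgets attached. -/
def glue {B : Type*} {n : ℕ} (H : SimpleGraph B) (R : B → Fin (n + 1) → Fin (n + 1) → Prop)
    (hs : ∀ b i j, R b i j → R b j i) (hi : ∀ b i, ¬ R b i i) :
    SimpleGraph (B × Fin (n + 1)) where
  Adj u v := (u.1 = v.1 ∧ R u.1 u.2 v.2) ∨ (u.2 = 0 ∧ v.2 = 0 ∧ H.Adj u.1 v.1)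
  symm := ⟨by
    rintro ⟨b, i⟩ ⟨b', j⟩ (⟨h, h'⟩ | ⟨h, h', h''⟩)
    · simp only at h h'
      subst h
      exact Or.inl ⟨rfl, hs _ _ _ h'⟩
    · exact Or.inr ⟨h', h, h''.symm⟩⟩
  loopless := ⟨by
    rintro ⟨b, i⟩ (⟨h, h'⟩ | ⟨h, h', h''⟩)
    · exact hi _ _ h'
    · exact H.loopless.irrefl _ h''⟩

section glue

variable {B : Type*} [Fintype B] {n : ℕ} {H : SimpleGraph B}
  {R : B → Fin (n + 1) → Fin (n + 1) → Prop}
  {hs : ∀ b i j, R b i j → R b j i} {hi : ∀ b i, ¬ R b i i}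

theorem glue_adj (b b' : B) (i j : Fin (n + 1)) : (glue H R hs hi).Adj (b, i) (b', j) ↔
    (b = b' ∧ R b i j) ∨ (i = 0 ∧ j = 0 ∧ H.Adj b b') := Iff.rfl

theorem glue_sum {M : Type*} [AddCommMonoid M] (b : B) (i : Fin (n + 1))
    (f : B × Fin (n + 1) → M) :
    ∑ v, (if (glue H R hs hi).Adj (b, i) v then f v else 0) =
      ∑ j, (if R b i j then f (b, j) else 0) +
        if i = 0 then ∑ b', (if H.Adj b b' then f (b', 0) else 0) else 0 := by
  have key : ∀ b' j, (if (glue H R hs hi).Adj (b, i) (b', j) then f (b', j) else 0) =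
      (if b = b' then (if R b i j then f (b', j) else 0) else 0) +
      (if j = 0 then (if i = 0 then (if H.Adj b b' then f (b', j) else 0) else 0) else 0) := by
    intro b' j
    rw [glue_adj]
    by_cases hb : b = b'
    · subst hb
      simp
    · simp only [hb, false_and, false_or, if_false, zero_add]
      by_cases hj : j = 0 <;> by_cases h0 : i = 0 <;> by_cases hH : H.Adj b b' <;>
        simp [hj, h0, hH]
  rw [Fintype.sum_prod_type]
  simp only [key, Finset.sum_add_distrib]
  congr 1
  · rw [Finset.sum_comm]
    simp
  · by_cases h0 : i = 0 <;> simp [h0]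

end glue

theorem mulVec_sum {V : Type*} [Fintype V] (G : SimpleGraph V) (x : V → ℝ) (v : V) :
    Matrix.mulVecLin (G.adjMatrix ℝ) x v = ∑ u, if G.Adj v u then x u else 0 := by
  simp [Matrix.mulVec, dotProduct, SimpleGraph.adjMatrix_apply]

theorem degree_sum {V : Type*} [Fintype V] (G : SimpleGraph V) (v : V) :
    G.degree v = ∑ u, if G.Adj v u then 1 else 0 := by
  rw [← SimpleGraph.card_neighborFinset_eq_degree, SimpleGraph.neighborFinset_eq_filter,
    Finset.card_filter]

noncomputable def triN {V : Type*} [Fintype V] (G : SimpleGraph V) (v : V) : ℕ :=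
  ∑ a, (if G.Adj v a then ∑ b, (if G.Adj v b then (if G.Adj a b then 1 else 0) else 0) else 0)

noncomputable def triF {V : Type*} [Fintype V] (G : SimpleGraph V) (v : V) : ℕ :=
  ∑ a, (if G.Adj v a then triN G a * triN G a else 0)

theorem triN_aut {V : Type*} [Fintype V] (G : SimpleGraph V) (φ : Equiv.Perm V)
    (h : ∀ u v, G.Adj (φ u) (φ v) ↔ G.Adj u v) (v : V) : triN G (φ v) = triN G v := by
  unfold triN
  rw [← Equiv.sum_comp φ]
  refine Finset.sum_congr rfl fun a _ => ?_
  rw [← Equiv.sum_comp φ]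
  simp only [h]

theorem triF_aut {V : Type*} [Fintype V] (G : SimpleGraph V) (φ : Equiv.Perm V)
    (h : ∀ u v, G.Adj (φ u) (φ v) ↔ G.Adj u v) (v : V) : triF G (φ v) = triF G v := by
  unfold triF
  rw [← Equiv.sum_comp φ]
  simp only [h, triN_aut G φ h]

section main

variable {B : Type*} [Fintype B] {Γ : Type*} [Group Γ] {H : SimpleGraph B}
    {col : B → Fin 6} {D : Fin 6 → ℕ} {ρ : Γ →* Equiv.Perm B} {b₀ : B}
    {n d K : ℕ} {R : Fin 6 → Fin (n + 1) → Fin (n + 1) → Prop}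
    {tt : Fin 6 → Fin (n + 1) → ℕ} {z : Fin 6 → Fin (n + 1) → ℝ}

/-- The final graph. -/
def fin_graph (H : SimpleGraph B) (col : B → Fin 6)
    (hg : ∀ c, GadSpec n d (D c) K (R c) (tt c) (z c)) : SimpleGraph (B × Fin (n + 1)) :=
  glue H (fun b => R (col b)) (fun b => (hg (col b)).symm) (fun b => (hg (col b)).irrefl)

theorem fg_adj (hg : ∀ c, GadSpec n d (D c) K (R c) (tt c) (z c)) (b b' : B)
    (i j : Fin (n + 1)) : (fin_graph H col hg).Adj (b, i) (b', j) ↔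
    (b = b' ∧ R (col b) i j) ∨ (i = 0 ∧ j = 0 ∧ H.Adj b b') := Iff.rfl

theorem fg_sum (hg : ∀ c, GadSpec n d (D c) K (R c) (tt c) (z c))
    {M : Type*} [AddCommMonoid M] (b : B) (i : Fin (n + 1)) (f : B × Fin (n + 1) → M) :
    ∑ v, (if (fin_graph H col hg).Adj (b, i) v then f v else 0) =
      ∑ j, (if R (col b) i j then f (b, j) else 0) +
        if i = 0 then ∑ b', (if H.Adj b b' then f (b', 0) else 0) else 0 :=
  glue_sum b i f

theorem fg_regular (hB : BaseSpec Γ H col D ρ b₀)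
    (hg : ∀ c, GadSpec n d (D c) K (R c) (tt c) (z c)) :
    (fin_graph H col hg).IsRegularOfDegree d := by
  rintro ⟨b, i⟩
  rw [degree_sum, fg_sum, hB.deg]
  exact (hg (col b)).deg i

theorem fg_nut (hB : BaseSpec Γ H col D ρ b₀) (hn : 1 ≤ n)
    (hg : ∀ c, GadSpec n d (D c) K (R c) (tt c) (z c)) :
    (fin_graph H col hg).IsNut := by
  have hker : ∀ x : B × Fin (n + 1) → ℝ,
      Matrix.mulVecLin ((fin_graph H col hg).adjMatrix ℝ) x = 0 →
      x = x (b₀, 0) • (fun v : B × Fin (n + 1) => z (col v.1) v.2) := by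
    intro x hx
    have hx' : ∀ b i, ∑ j, (if R (col b) i j then x (b, j) else 0) +
        (if i = 0 then ∑ b', (if H.Adj b b' then x (b', 0) else 0) else 0) = 0 := by
      intro b i
      rw [← fg_sum hg, ← mulVec_sum, hx]
      rfl
    have h1 : ∀ b i, x (b, i) = x (b, 0) * z (col b) i := by
      intro b
      have := (hg (col b)).inj (fun i => x (b, i) - x (b, 0) * z (col b) i)
        (by simp [(hg (col b)).z0]) (by
          intro i hi
          have h2 := hx' b i
          have h3 := (hg (col b)).ker i
          simp only [hi, if_false, add_zero] at h2 h3
          have : ∀ j, (if R (col b) i j then x (b, j) - x (b, 0) * z (col b) j else 0) =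
              (if R (col b) i j then x (b, j) else 0) -
              x (b, 0) * (if R (col b) i j then z (col b) j else 0) := by
            intro j; split_ifs <;> simp
          simp only [this, Finset.sum_sub_distrib, ← Finset.mul_sum, h2, h3]
          simp)
      intro i
      have := congrFun this i
      simp only [Pi.zero_apply] at this
      linarith
    have h2 : Matrix.mulVec (H.lapMatrix ℝ) (fun b => x (b, 0)) = 0 := by
      funext b
      have h3 := hx' b 0
      simp only [if_true] at h3
      have h4 : ∑ j, (if R (col b) 0 j then x (b, j) else 0) = x (b, 0) * -(D (col b) : ℝ) := by
        have := (hg (col b)).ker 0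
        simp only [if_true] at this
        rw [← this, Finset.mul_sum]
        refine Finset.sum_congr rfl fun j _ => ?_
        rw [h1 b j]
        split_ifs <;> simp
      have h5 := mulVec_sum H (fun b => x (b, 0)) b
      have h6 : (H.degree b : ℝ) = D (col b) := by
        rw [degree_sum, hB.deg]
      rw [SimpleGraph.lapMatrix, Matrix.sub_mulVec, SimpleGraph.degMatrix, Pi.sub_apply,
        Matrix.mulVec_diagonal]
      rw [Matrix.mulVecLin_apply] at h5
      rw [h5, h6, Pi.zero_apply]
      linarith
    have h3 := (SimpleGraph.lapMatrix_mulVec_eq_zero_iff_forall_reachable H).1 h2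
    funext v
    obtain ⟨b, i⟩ := v
    simp only [Pi.smul_apply, smul_eq_mul]
    rw [h1 b i, h3 _ _ (hB.conn b)]
  have hz : Matrix.mulVecLin ((fin_graph H col hg).adjMatrix ℝ)
      (fun v : B × Fin (n + 1) => z (col v.1) v.2) = 0 := by
    funext v
    obtain ⟨b, i⟩ := v
    rw [mulVec_sum, fg_sum]
    simp only [(hg _).ker, (hg _).z0, Pi.zero_apply]
    split_ifs
    · have := hB.deg b
      have h6 : (∑ b', if H.Adj b b' then (1 : ℝ) else 0) = D (col b) := by
        rw [← this]; push_cast; rfl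
      rw [h6]; ring
    · simp
  have hzne : ∀ v : B × Fin (n + 1), z (col v.1) v.2 ≠ 0 := fun v => (hg _).zne _
  refine ⟨?_, ?_, ?_⟩
  · have : Nonempty B := ⟨b₀⟩
    have h1 : 0 < Fintype.card B := Fintype.card_pos
    rw [Fintype.card_prod, Fintype.card_fin]
    nlinarith
  · rw [finrank_eq_one_iff']
    refine ⟨⟨_, hz⟩, ?_, ?_⟩
    · intro h
      exact hzne (b₀, 0) (congrFun (congrArg Subtype.val h) (b₀, 0))
    · rintro ⟨x, hx⟩
      exact ⟨x (b₀, 0), Subtype.ext (hker x hx).symm⟩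
  · intro x hx hx0 v hv
    apply hx0
    rw [hker x hx] at hv ⊢
    simp only [Pi.smul_apply, smul_eq_mul, mul_eq_zero, hzne v, or_false] at hv
    simp [hv]

theorem fg_triN (hB : BaseSpec Γ H col D ρ b₀)
    (hg : ∀ c, GadSpec n d (D c) K (R c) (tt c) (z c)) (b : B) (i : Fin (n + 1)) :
    triN (fin_graph H col hg) (b, i) = tt (col b) i := by
  have hR : ∀ a j, (fin_graph H col hg).Adj (b, a) (b, j) ↔ R (col b) a j := by
    intro a j
    simp [fg_adj]
  unfold triN
  rw [fg_sum, ← (hg (col b)).tri i]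
  have h2 : (if i = 0 then ∑ b', (if H.Adj b b' then
      ∑ w, (if (fin_graph H col hg).Adj (b, i) w then
        (if (fin_graph H col hg).Adj (b', 0) w then 1 else 0) else 0) else 0) else 0) = 0 := by
    split_ifs with h0
    · refine Finset.sum_eq_zero fun b' _ => ?_
      split_ifs with hH
      · rw [fg_sum]
        have e1 : ∀ j, (if R (col b) i j then
            (if (fin_graph H col hg).Adj (b', 0) (b, j) then 1 else 0) else 0) = 0 := by
          intro j
          split_ifs with h3 h4
          · rw [fg_adj] at h4
            rcases h4 with ⟨h4, _⟩ | ⟨_, h4, _⟩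
            · exact absurd h4.symm hH.ne
            · subst h0 h4
              exact absurd h3 ((hg _).irrefl _)
          · rfl
          · rfl
        have e2 : ∀ b'', (if H.Adj b b'' then
            (if (fin_graph H col hg).Adj (b', 0) (b'', 0) then 1 else 0) else 0) = 0 := by
          intro b''
          split_ifs with h3 h4
          · rw [fg_adj] at h4
            rcases h4 with ⟨_, h4⟩ | ⟨_, _, h4⟩
            · exact absurd h4 ((hg _).irrefl _)
            · exact absurd h4 (hB.tri _ _ _ hH h3)
          · rfl
          · rfl
        simp only [e1, e2]
        simp
      · rfl
    · rfl
  rw [h2, add_zero]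
  refine Finset.sum_congr rfl fun a _ => ?_
  split_ifs with ha
  · rw [fg_sum]
    simp only [hR]
    rw [Nat.add_eq_left]
    split_ifs with h0
    · refine Finset.sum_eq_zero fun b' _ => ?_
      split_ifs with hH h4
      · rw [fg_adj] at h4
        rcases h4 with ⟨h4, _⟩ | ⟨h4, _, _⟩
        · exact absurd h4 hH.ne
        · subst h0 h4
          exact absurd ha ((hg _).irrefl _)
      · rfl
      · rfl
    · rfl
  · rfl

theorem fg_triF (hB : BaseSpec Γ H col D ρ b₀)
    (hg : ∀ c, GadSpec n d (D c) K (R c) (tt c) (z c)) (b : B) (i : Fin (n + 1)) (hi : i ≠ 0) :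
    triF (fin_graph H col hg) (b, i) =
      ∑ a, (if R (col b) i a then tt (col b) a * tt (col b) a else 0) := by
  unfold triF
  rw [fg_sum]
  simp only [fg_triN hB hg, hi, if_false, add_zero]

/-- An automorphism maps roots to roots, preserving the colour. -/
theorem fg_root (hB : BaseSpec Γ H col D ρ b₀)
    (hg : ∀ c, GadSpec n d (D c) K (R c) (tt c) (z c))
    (ht : ∀ c c', tt c 0 = tt c' 0 → c = c')
    (φ : Equiv.Perm (B × Fin (n + 1)))
    (hφ : ∀ u v, (fin_graph H col hg).Adj (φ u) (φ v) ↔ (fin_graph H col hg).Adj u v) (b : B) :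
    ∃ b', φ (b, 0) = (b', 0) ∧ col b' = col b := by
  obtain ⟨b', j, hj⟩ : ∃ b' j, φ (b, 0) = (b', j) := ⟨_, _, rfl⟩
  have h1 := triN_aut _ φ hφ (b, 0)
  rw [hj, fg_triN hB hg, fg_triN hB hg] at h1
  have h0 : j = 0 := by
    by_contra h
    have h2 := (hg (col b')).t1 j h
    have h3 := (hg (col b)).t0
    omega
  subst h0
  exact ⟨b', hj, ht _ _ h1⟩

theorem fg_nonroot (hB : BaseSpec Γ H col D ρ b₀)
    (hg : ∀ c, GadSpec n d (D c) K (R c) (tt c) (z c))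
    (φ : Equiv.Perm (B × Fin (n + 1)))
    (hφ : ∀ u v, (fin_graph H col hg).Adj (φ u) (φ v) ↔ (fin_graph H col hg).Adj u v)
    (b : B) (i j : Fin (n + 1)) (hi : i ≠ 0) (hj : R (col b) j i)
    (hf : φ (b, j) = (b, j)) : φ (b, i) = (b, i) := by
  obtain ⟨b', k, hk⟩ : ∃ b' k, φ (b, i) = (b', k) := ⟨_, _, rfl⟩
  have h1 := triN_aut _ φ hφ (b, i)
  rw [hk, fg_triN hB hg, fg_triN hB hg] at h1
  have hk0 : k ≠ 0 := by
    rintro rfl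
    have h2 := (hg (col b)).t1 i hi
    have h3 := (hg (col b')).t0
    omega
  have h2 : (fin_graph H col hg).Adj (b, j) (b', k) := by
    rw [← hk, ← hf, hφ]
    exact Or.inl ⟨rfl, hj⟩
  rw [fg_adj] at h2
  rcases h2 with ⟨rfl, _⟩ | ⟨_, h, _⟩
  · have h3 := triF_aut _ φ hφ (b, i)
    rw [hk, fg_triF hB hg _ _ hk0, fg_triF hB hg _ _ hi] at h3
    rw [hk, (hg _).finj _ _ hk0 hi h3]
  · exact absurd h hk0

theorem fg_id (hB : BaseSpec Γ H col D ρ b₀)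
    (hg : ∀ c, GadSpec n d (D c) K (R c) (tt c) (z c))
    (ht : ∀ c c', tt c 0 = tt c' 0 → c = c')
    (φ : Equiv.Perm (B × Fin (n + 1)))
    (hφ : ∀ u v, (fin_graph H col hg).Adj (φ u) (φ v) ↔ (fin_graph H col hg).Adj u v)
    (h0 : φ (b₀, 0) = (b₀, 0)) : φ = 1 := by
  have step : ∀ b b', H.Adj b b' → φ (b, 0) = (b, 0) → φ (b', 0) = (b', 0) := by
    intro b b' hH hb
    obtain ⟨b'', h1, h2⟩ := fg_root hB hg ht φ hφ b'
    have h3 : (fin_graph H col hg).Adj (b, 0) (b'', 0) := by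
      rw [← h1, ← hb, hφ]
      exact Or.inr ⟨rfl, rfl, hH⟩
    rw [fg_adj] at h3
    rcases h3 with ⟨_, h⟩ | ⟨_, _, h⟩
    · exact absurd h ((hg _).irrefl _)
    · rw [h1, hB.sep _ _ _ h hH h2]
  have roots : ∀ b, φ (b, 0) = (b, 0) := by
    intro b
    obtain ⟨w⟩ := hB.conn b
    have : ∀ (u v : B) (w : H.Walk u v), φ (u, 0) = (u, 0) → φ (v, 0) = (v, 0) := by
      intro u v w
      induction w with
      | nil => exact id
      | cons h _ ih => exact fun hu => ih (step _ _ h hu)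
    exact this _ _ w h0
  ext1 v
  obtain ⟨b, i⟩ := v
  rw [Equiv.Perm.one_apply]
  by_cases hi : i = 0
  · subst hi; exact roots b
  · rcases (hg (col b)).conn i hi with h | ⟨j, hj, h, h'⟩
    · exact fg_nonroot hB hg φ hφ b i 0 hi h (roots b)
    · exact fg_nonroot hB hg φ hφ b i j hi h' (fg_nonroot hB hg φ hφ b j 0 hj h (roots b))

theorem fg_aut (hB : BaseSpec Γ H col D ρ b₀)
    (hg : ∀ c, GadSpec n d (D c) K (R c) (tt c) (z c))
    (ht : ∀ c c', tt c 0 = tt c' 0 → c = c') :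
    Nonempty ((fin_graph H col hg).autGroup ≃* Γ) := by
  let A : Γ → Equiv.Perm (B × Fin (n + 1)) := fun g => Equiv.prodCongr (ρ g) (Equiv.refl _)
  have hA : ∀ g, A g ∈ (fin_graph H col hg).autGroup := by
    rintro g ⟨b, i⟩ ⟨b', j⟩
    change (fin_graph H col hg).Adj (ρ g b, i) (ρ g b', j) ↔ _
    rw [fg_adj, fg_adj, hB.adj, hB.colInv, (ρ g).injective.eq_iff]
  let f : Γ →* (fin_graph H col hg).autGroup :=
    { toFun := fun g => ⟨A g, hA g⟩
      map_one' := by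
        apply Subtype.ext
        ext1 v
        simp [A]
      map_mul' := by
        intro g h
        apply Subtype.ext
        ext1 v
        obtain ⟨b, i⟩ := v
        simp [A] }
  have hf : ∀ g b i, (f g).1 (b, i) = (ρ g b, i) := fun _ _ _ => rfl
  have hbij : Function.Bijective f := by
    constructor
    · rw [injective_iff_map_eq_one]
      intro g hg1
      apply hB.free
      have := hf g b₀ 0
      rw [hg1] at this
      exact (congrArg Prod.fst this).symm
    · rintro ⟨φ, hφ⟩
      obtain ⟨b', h1, h2⟩ := fg_root hB hg ht φ hφ b₀
      obtain ⟨g, hgb⟩ := hB.trans b' h2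
      refine ⟨g, ?_⟩
      obtain ⟨ψ, hψ⟩ : ∃ ψ : (fin_graph H col hg).autGroup, ψ = (f g)⁻¹ * ⟨φ, hφ⟩ := ⟨_, rfl⟩
      have h3 := fg_id hB hg ht ψ.1 ψ.2 (by
          rw [hψ]
          change ((f g).1)⁻¹ (φ (b₀, 0)) = _
          rw [h1, Equiv.Perm.inv_eq_iff_eq, hf, hgb])
      have h4 : (f g)⁻¹ * ⟨φ, hφ⟩ = 1 := hψ ▸ Subtype.ext h3
      exact (inv_mul_eq_one.1 h4)
  exact ⟨(MulEquiv.ofBijective f hbij).symm⟩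

end main

/-- Transport to `Fin`. -/
theorem transport {V : Type*} [Fintype V] (G : SimpleGraph V) (Γ : Type*) [Group Γ] (d N : ℕ)
    (h1 : G.IsNut) (h2 : G.IsRegularOfDegree d) (h3 : N < Fintype.card V)
    (h4 : Nonempty (G.autGroup ≃* Γ)) :
    ∃ (n : ℕ) (G : SimpleGraph (Fin n)),
      G.IsNut ∧ G.IsRegularOfDegree d ∧ N < n ∧ Nonempty (G.autGroup ≃* Γ) := by
  let e := Fintype.equivFin V
  obtain ⟨G', hadj⟩ : ∃ G' : SimpleGraph (Fin (Fintype.card V)),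
      ∀ u v, G'.Adj u v ↔ G.Adj (e.symm u) (e.symm v) := ⟨G.comap e.symm, fun _ _ => Iff.rfl⟩
  have hmv : ∀ (x : Fin (Fintype.card V) → ℝ) v,
      Matrix.mulVecLin (G'.adjMatrix ℝ) x (e v) = Matrix.mulVecLin (G.adjMatrix ℝ) (x ∘ e) v := by
    intro x v
    rw [mulVec_sum, mulVec_sum, ← Equiv.sum_comp e]
    simp [hadj]
  have hk : ∀ x : Fin (Fintype.card V) → ℝ, Matrix.mulVecLin (G'.adjMatrix ℝ) x = 0 ↔
      Matrix.mulVecLin (G.adjMatrix ℝ) (x ∘ e) = 0 := by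
    intro x
    constructor
    · intro h
      funext v
      rw [← hmv, h]; rfl
    · intro h
      funext v
      obtain ⟨v, rfl⟩ := e.surjective v
      rw [hmv, h]; rfl
  refine ⟨_, G', ⟨by simpa using h1.1, ?_, ?_⟩, ?_, h3, ?_⟩
  · have h5 := h1.2.1
    rw [finrank_eq_one_iff'] at h5 ⊢
    obtain ⟨⟨v, hv⟩, hv0, hv1⟩ := h5
    have hve : (v ∘ e.symm) ∘ e = v := by funext; simp
    refine ⟨⟨v ∘ e.symm, (hk _).2 (by rw [hve]; exact hv)⟩, ?_, ?_⟩
    · intro h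
      apply hv0
      apply Subtype.ext
      have := congrArg Subtype.val h
      funext w
      have := congrFun this (e w)
      simpa using this
    · rintro ⟨x, hx⟩
      obtain ⟨c, hc⟩ := hv1 ⟨x ∘ e, (hk x).1 hx⟩
      refine ⟨c, Subtype.ext ?_⟩
      have := congrArg Subtype.val hc
      funext w
      have := congrFun this (e.symm w)
      simpa using this
  · intro x hx hx0 v
    have := h1.2.2 (x ∘ e) ((hk x).1 hx) (by
      intro h
      apply hx0
      funext w
      have := congrFun h (e.symm w)
      simpa using this) (e.symm v)
    simpa using this
  · intro v
    rw [← h2 (e.symm v), degree_sum, degree_sum, ← Equiv.sum_comp e]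
    simp [hadj]
  · obtain ⟨f⟩ := h4
    refine ⟨MulEquiv.trans ?_ f⟩
    let q : Equiv.Perm (Fin (Fintype.card V)) ≃* Equiv.Perm V := e.symm.permCongrHom
    have hq : ∀ σ v, q σ v = e.symm (σ (e v)) := fun _ _ => rfl
    exact
      { toFun := fun σ => ⟨q σ.1, by
          intro u v
          have := σ.2 (e u) (e v)
          rw [hadj, hadj] at this
          rw [hq, hq]
          simpa using this⟩
        invFun := fun σ => ⟨q.symm σ.1, by
          intro u v
          have := σ.2 (e.symm u) (e.symm v)
          rw [hadj, hadj]
          have h5 : ∀ w, e.symm (q.symm σ.1 w) = σ.1 (e.symm w) := by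
            intro w
            have := hq (q.symm σ.1) (e.symm w)
            rw [q.apply_symm_apply, e.apply_symm_apply] at this
            exact this.symm
          rw [h5, h5]
          exact this⟩
        left_inv := fun σ => Subtype.ext (q.symm_apply_apply _)
        right_inv := fun σ => Subtype.ext (q.apply_symm_apply _)
        map_mul' := fun σ τ => Subtype.ext (q.map_mul _ _) }


theorem allN_iff (n : ℕ) (f : ℕ → Bool) : allN n f = true ↔ ∀ i, i < n → f i = true := by
  induction n with
  | zero => simp [allN]
  | succ k ih =>
    rw [allN, Bool.and_eq_true, ih]
    constructor
    · rintro ⟨h1, h2⟩ i hi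
      rcases Nat.lt_succ_iff_lt_or_eq.1 hi with h | h
      · exact h2 i h
      · rw [h]; exact h1
    · intro h
      exact ⟨h k (Nat.lt_succ_self k), fun i hi => h i (Nat.lt_succ_of_lt hi)⟩

theorem smN_eq (n : ℕ) (f : ℕ → ℕ) : smN n f = ∑ i : Fin n, f i := by
  rw [Fin.sum_univ_eq_sum_range]
  induction n with
  | zero => rfl
  | succ k ih => rw [smN, ih, Finset.sum_range_succ]

theorem dl_eq (i j a : ℕ) : dl i j a = if i = j then a else 0 := by
  unfold dl
  by_cases h : i = j
  · subst h; simp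
  · have : Nat.beq i j = false := by
      rw [Bool.eq_false_iff]; simpa [Nat.beq_eq] using h
    simp [this, h]

theorem Gad.adj_ite (g : Gad) (i j a : ℕ) [Decidable (g.adj i j = 1)] :
    (if g.adj i j = 1 then a else 0) = g.adj i j * a := by
  have : g.adj i j < 2 := Nat.mod_lt _ (by norm_num)
  rcases (by omega : g.adj i j = 0 ∨ g.adj i j = 1) with h | h <;> simp [h]

theorem Gad.adj_iteR (g : Gad) (i j : ℕ) (a : ℝ) [Decidable (g.adj i j = 1)] :
    (if g.adj i j = 1 then a else 0) = (g.adj i j : ℝ) * a := by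
  have : g.adj i j < 2 := Nat.mod_lt _ (by norm_num)
  rcases (by omega : g.adj i j = 0 ∨ g.adj i j = 1) with h | h <;> simp [h]

theorem mat_inj (n : ℕ) (a b : ℕ → ℕ → ℕ)
    (h : ∀ i k : Fin n, (∑ j : Fin n, a i j * b j k) % 7 = if (i : ℕ) = k then 1 else 0)
    (x : Fin n → ℝ) (hx : ∀ i : Fin n, ∑ j : Fin n, (a i j : ℝ) * x j = 0) : x = 0 := by
  let M : Matrix (Fin n) (Fin n) ℤ := fun i j => a i j
  have : Fact (Nat.Prime 7) := ⟨by norm_num⟩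
  let Bm : Matrix (Fin n) (Fin n) (ZMod 7) := fun i j => (b i j : ZMod 7)
  have h1 : M.map (Int.castRingHom (ZMod 7)) * Bm = 1 := by
    ext i k
    rw [Matrix.mul_apply, Matrix.one_apply]
    have h2 : ((∑ j : Fin n, a i j * b j k : ℕ) : ZMod 7) =
        ((if (i : ℕ) = k then 1 else 0 : ℕ) : ZMod 7) := by
      rw [← h i k, ZMod.natCast_mod]
    push_cast at h2
    simp only [← Fin.ext_iff] at h2
    change ∑ j : Fin n, (((a i j : ℕ) : ℤ) : ZMod 7) * ((b j k : ℕ) : ZMod 7) = _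
    simpa using h2
  have h2 : M.det ≠ 0 := by
    intro h0
    have h3 := congrArg Matrix.det h1
    rw [Matrix.det_mul, ← RingHom.mapMatrix_apply, ← RingHom.map_det, h0, map_zero, zero_mul,
      Matrix.det_one] at h3
    exact zero_ne_one h3
  have h3 : (M.map (Int.castRingHom ℝ)).det ≠ 0 := by
    rw [← RingHom.mapMatrix_apply, ← RingHom.map_det]
    simpa using h2
  apply Matrix.eq_zero_of_mulVec_eq_zero h3
  funext i
  change ∑ j, ((M i j : ℤ) : ℝ) * x j = 0
  simpa [M] using hx i

theorem Gad.ok_spec (g : Gad) (n d D K : ℕ) (h : g.ok n d D K = true) :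
    GadSpec n d D K (fun i j => g.adj i j = 1) (fun i => g.t i)
      (fun i => if g.ps i = 1 then 1 else -1) := by
  simp only [Gad.ok, Bool.and_eq_true] at h
  obtain ⟨hSym, hDeg, hKer, hInv, hT, hF, hC⟩ := h
  simp only [Gad.okSym, allN_iff, Bool.and_eq_true, Nat.beq_eq] at hSym
  simp only [Gad.okDeg, allN_iff, Nat.beq_eq, smN_eq, dl_eq] at hDeg
  simp only [Gad.okKer, allN_iff, Bool.and_eq_true, Nat.beq_eq, smN_eq, dl_eq] at hKer
  simp only [Gad.okInv, allN_iff, Nat.beq_eq, smN_eq, dl_eq] at hInv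
  simp only [Gad.okT, allN_iff, Bool.and_eq_true, Nat.beq_eq, smN_eq, Nat.ble_eq] at hT
  simp only [Gad.okF, allN_iff, Bool.not_eq_true', smN_eq] at hF
  simp only [Gad.okC, allN_iff, Bool.or_eq_true, Nat.ble_eq, Bool.not_eq_true'] at hC
  have val0 : ∀ i : Fin (n + 1), (i : ℕ) = 0 ↔ i = 0 := fun i => Fin.val_eq_zero_iff
  have hlt : ∀ i j, g.adj i j < 2 := fun _ _ => Nat.mod_lt _ (by norm_num)
  refine ⟨?_, ?_, ?_, ?_, ?_, ?_, ?_, ?_, ?_, ?_, ?_, ?_⟩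
  · intro i j hij
    have := (hSym i i.2).2 j j.2
    omega
  · intro i hii
    have := (hSym i i.2).1
    omega
  · intro i
    have := hDeg i i.2
    simp only [val0] at this
    simpa only [Gad.adj_ite, mul_one] using this
  · have := hKer.1
    simp [this]
  · intro i
    split_ifs <;> norm_num
  · intro i
    have h1 := hDeg i i.2
    have h2 := hKer.2 i i.2
    have h1' : (∑ j : Fin (n + 1), (g.adj i j : ℝ)) + (if (i : ℕ) = 0 then (D : ℝ) else 0) = d := by
      rw [← h1]; push_cast; rfl
    have h2' : 2 * (∑ j : Fin (n + 1), (g.adj i j : ℝ) * (g.ps j : ℝ)) +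
        (if (i : ℕ) = 0 then (2 * D : ℝ) else 0) = d := by
      rw [← h2]; push_cast; rfl
    have h3 : ∀ j : Fin (n + 1), (g.adj i j : ℝ) * (if g.ps j = 1 then (1 : ℝ) else -1)
        = 2 * ((g.adj i j : ℝ) * (g.ps j : ℝ)) - (g.adj i j : ℝ) := by
      intro j
      have hp : g.ps j < 2 := Nat.mod_lt _ (by norm_num)
      rcases (by omega : g.ps j = 0 ∨ g.ps j = 1) with h | h <;> simp [h] <;> ring
    simp only [Gad.adj_iteR, h3, Finset.sum_sub_distrib, ← Finset.mul_sum]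
    simp only [val0] at h1' h2'
    split_ifs at h1' h2' ⊢ <;> linarith
  · intro x hx0 hx
    have h1 := mat_inj n (fun i j => g.adj (i + 1) (j + 1)) (fun i j => g.iv i j)
      (fun i k => hInv i i.2 k k.2) (fun i => x i.succ) (by
        intro i
        have := hx i.succ (Fin.succ_ne_zero i)
        simp only [Gad.adj_iteR] at this
        rw [Fin.sum_univ_succ, hx0] at this
        simpa using this)
    funext i
    refine Fin.cases hx0 (fun j => congrFun h1 j) i
  · intro i
    have := hT.1.1 i i.2
    simp only [Gad.adj_ite]
    rw [← this]
    simp only [mul_one]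
  · exact hT.1.2
  · intro i hi
    obtain ⟨j, rfl⟩ := Fin.exists_succ_eq.2 hi
    have := hT.2 j j.2
    simpa using this
  · intro i j hi hj hij
    obtain ⟨i, rfl⟩ := Fin.exists_succ_eq.2 hi
    obtain ⟨j, rfl⟩ := Fin.exists_succ_eq.2 hj
    simp only [Gad.adj_ite, Fin.val_succ] at hij
    rcases lt_trichotomy (i : ℕ) j with h | h | h
    · have := hF j j.2 i h
      rw [hij] at this
      rw [Bool.eq_false_iff, ne_eq, Nat.beq_eq] at this
      exact absurd rfl this
    · rw [Fin.ext h]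
    · have := hF i i.2 j h
      rw [hij] at this
      rw [Bool.eq_false_iff, ne_eq, Nat.beq_eq] at this
      exact absurd rfl this
  · intro i hi
    obtain ⟨i, rfl⟩ := Fin.exists_succ_eq.2 hi
    rcases hC i i.2 with h | h
    · left
      have := hlt 0 (i + 1)
      simp only [Fin.val_zero, Fin.val_succ]
      omega
    · right
      rw [Bool.eq_false_iff, ne_eq, allN_iff] at h
      push Not at h
      obtain ⟨j, hj, h⟩ := h
      simp only [Bool.not_eq_true', Bool.not_eq_false, ne_eq, Nat.ble_eq] at h
      have h1 := hlt 0 (j + 1)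
      have h2 := hlt (j + 1) (i + 1)
      have h3 : 0 < g.adj 0 (j + 1) := Nat.pos_of_mul_pos_right h
      have h4 : 0 < g.adj (j + 1) (i + 1) := Nat.pos_of_mul_pos_left h
      refine ⟨(⟨j, hj⟩ : Fin n).succ, Fin.succ_ne_zero _, ?_, ?_⟩
      · simp only [Fin.val_zero, Fin.val_succ]; omega
      · simp only [Fin.val_succ]; omega


section base

variable {Γ : Type*} [Group Γ] {m : ℕ}

/-- Neighbour lists of the base graph. -/
def nb (s : ZMod m → Γ) : Γ × ZMod m × Fin 5 → List (Γ × ZMod m × Fin 5)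
  | (g, k, 0) => [(g, k, 1), (g, k, 3), (g, k - 1, 2), (g * (s (k - 1))⁻¹, k - 1, 4)]
  | (g, k, 1) => [(g, k, 0), (g, k, 2)]
  | (g, k, 2) => [(g, k, 1), (g, k + 1, 0)]
  | (g, k, 3) => [(g, k, 0), (g, k, 4)]
  | (g, k, 4) => [(g, k, 3), (g * s k, k + 1, 0)]

theorem nb_symm (s : ZMod m → Γ) (u v : Γ × ZMod m × Fin 5) (h : v ∈ nb s u) : u ∈ nb s v := by
  obtain ⟨g, k, c⟩ := u
  fin_cases c <;> simp [nb] at h ⊢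
  · rcases h with rfl | rfl | rfl | rfl <;> simp [nb]
  · rcases h with rfl | rfl <;> simp [nb]
  · rcases h with rfl | rfl <;> simp [nb]
  · rcases h with rfl | rfl <;> simp [nb]
  · rcases h with rfl | rfl <;> simp [nb]

/-- The base graph. -/
def baseG (s : ZMod m → Γ) : SimpleGraph (Γ × ZMod m × Fin 5) where
  Adj u v := v ∈ nb s u
  symm := ⟨fun u v h => nb_symm s u v h⟩
  loopless := ⟨by
    rintro ⟨g, k, c⟩ h
    fin_cases c <;> simp [nb] at h⟩

def baseCol (b : Γ × ZMod m × Fin 5) : Fin 6 :=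
  if b.2.2 = 0 ∧ b.2.1 = 0 then 5 else b.2.2.castSucc

def shift (Γ : Type*) [Group Γ] (m : ℕ) : Γ →* Equiv.Perm (Γ × ZMod m × Fin 5) where
  toFun g := Equiv.prodCongr (Equiv.mulLeft g) (Equiv.refl _)
  map_one' := by ext1 ⟨g, k, c⟩; simp
  map_mul' a b := by ext1 ⟨g, k, c⟩; simp [mul_assoc]

theorem shift_apply (a g : Γ) (p : ZMod m × Fin 5) : shift Γ m a (g, p) = (a * g, p) := rfl

theorem nb_shift (s : ZMod m → Γ) (a : Γ) (u : Γ × ZMod m × Fin 5) :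
    nb s (shift Γ m a u) = (nb s u).map (shift Γ m a) := by
  obtain ⟨g, k, c⟩ := u
  fin_cases c <;> simp [nb, shift_apply, mul_assoc]

theorem base_spec [Fintype Γ] [NeZero m] (hm : 2 ≤ m) (s : ZMod m → Γ)
    (hs : Function.Surjective s) :
    BaseSpec Γ (baseG s) baseCol (fun c => colD c) (shift Γ m) ((1, 0, 0) : Γ × ZMod m × Fin 5) := by
  have hm1 : Fact (1 < m) := ⟨hm⟩
  have hadj : ∀ u v, (baseG s).Adj u v ↔ v ∈ nb s u := fun _ _ => Iff.rfl
  refine ⟨?_, ?_, ?_, ?_, ?_, ?_, ?_, ?_⟩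
  · have hnd : ∀ b, (nb s b).Nodup := by
      rintro ⟨g, k, c⟩
      fin_cases c <;> simp [nb]
    have hlen : ∀ b : Γ × ZMod m × Fin 5, (nb s b).length = colD (baseCol b) := by
      rintro ⟨g, k, c⟩
      by_cases hk : k = 0 <;> fin_cases c <;> simp [nb, baseCol, hk, colD] <;> rfl
    intro b
    simp only [hadj]
    rw [← hlen, ← List.toFinset_card_of_nodup (hnd b), ← Finset.card_filter]
    congr 1
    ext v
    simp
  · -- connectedness
    have hstep : ∀ u v, v ∈ nb s u → (baseG s).Reachable u v :=
      fun u v h => SimpleGraph.Adj.reachable (G := baseG s) h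
    have r1 : ∀ g k, (baseG s).Reachable (g, k, 0) (g, k, 1) := fun g k => hstep _ _ (by simp [nb])
    have r2 : ∀ g k, (baseG s).Reachable (g, k, 0) (g, k, 2) :=
      fun g k => (r1 g k).trans (hstep _ _ (by simp [nb]))
    have r3 : ∀ g k, (baseG s).Reachable (g, k, 0) (g, k, 3) := fun g k => hstep _ _ (by simp [nb])
    have r4 : ∀ g k, (baseG s).Reachable (g, k, 0) (g, k, 4) :=
      fun g k => (r3 g k).trans (hstep _ _ (by simp [nb]))
    have n1 : ∀ g k, (baseG s).Reachable (g, k, 0) (g, k + 1, 0) :=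
      fun g k => (r2 g k).trans (hstep _ _ (by simp [nb]))
    have n2 : ∀ g k, (baseG s).Reachable (g, k, 0) (g * s k, k + 1, 0) :=
      fun g k => (r4 g k).trans (hstep _ _ (by simp [nb]))
    have n3 : ∀ g (i : ℕ), (baseG s).Reachable (g, 0, 0) (g, (i : ZMod m), 0) := by
      intro g i
      induction i with
      | zero =>
        rw [Nat.cast_zero]
      | succ i ih =>
        push_cast
        exact ih.trans (n1 _ _)
    have n4 : ∀ g k, (baseG s).Reachable (g, 0, 0) (g, k, 0) := by
      intro g k
      have := n3 g k.val
      rwa [ZMod.natCast_zmod_val] at this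
    have n5 : ∀ g k, (baseG s).Reachable (1, 0, 0) (g, k, 0) := by
      intro g k
      obtain ⟨l, hl⟩ := hs g
      have := n2 1 l
      rw [one_mul, hl] at this
      exact (n4 1 l).trans (this.trans ((n4 g _).symm.trans (n4 g k)))
    rintro ⟨g, k, c⟩
    fin_cases c
    · exact n5 g k
    · exact (n5 g k).trans (r1 g k)
    · exact (n5 g k).trans (r2 g k)
    · exact (n5 g k).trans (r3 g k)
    · exact (n5 g k).trans (r4 g k)
  · rintro ⟨g, k, c⟩ v w hv hw
    rw [hadj] at hv hw
    fin_cases c <;> simp [nb] at hv hw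
    · rcases hv with rfl | rfl | rfl | rfl <;> rcases hw with rfl | rfl | rfl | rfl <;>
        simp [baseCol]
    all_goals
      rcases hv with rfl | rfl <;> rcases hw with rfl | rfl <;>
        simp [baseCol] <;> split_ifs <;> simp
  · rintro ⟨g, k, c⟩ v w hv hw
    rw [hadj] at hv hw ⊢
    have hk : ¬ k = k - 1 := fun e => one_ne_zero (sub_eq_self.1 e.symm)
    fin_cases c <;> simp [nb] at hv hw
    · rcases hv with rfl | rfl | rfl | rfl <;> rcases hw with rfl | rfl | rfl | rfl <;>
        simp [nb, hk]
    all_goals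
      rcases hv with rfl | rfl <;> rcases hw with rfl | rfl <;>
        simp [nb, hk]
  · intro a u v
    rw [hadj, hadj, nb_shift, List.mem_map]
    simp
  · rintro a ⟨g, k, c⟩
    rfl
  · rintro ⟨g, k, c⟩ h
    refine ⟨g, ?_⟩
    rw [shift_apply]
    simp only [baseCol] at h
    by_cases h1 : c = 0 ∧ k = 0
    · rw [h1.1, h1.2, mul_one]
    · exfalso
      revert h
      rw [if_neg h1, if_pos (by simp)]
      fin_cases c <;> simp
  · intro g h
    rw [shift_apply] at h
    simpa using h

end base

theorem final (𝔊 : Type*) [Group 𝔊] [Finite 𝔊] (l : List Gad) (n d K N : ℕ) (hn : 1 ≤ n)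
    (h : okFam l n d K = true) :
    ∃ (n : ℕ) (G : SimpleGraph (Fin n)),
      G.IsNut ∧ G.IsRegularOfDegree d ∧ N < n ∧ Nonempty (G.autGroup ≃* 𝔊) := by
  have := Fintype.ofFinite 𝔊
  let m := N + 2 + Fintype.card 𝔊
  have : NeZero m := ⟨by simp only [m]; omega⟩
  obtain ⟨s, hs⟩ : ∃ s : ZMod m → 𝔊, Function.Surjective s := by
    have hc : Fintype.card 𝔊 ≤ Fintype.card (ZMod m) := by
      rw [ZMod.card]; simp only [m]; omega
    obtain ⟨e⟩ := Function.Embedding.nonempty_of_card_le hc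
    exact ⟨Function.invFun e, Function.invFun_surjective e.injective⟩
  have hB := base_spec (m := m) (by simp only [m]; omega) s hs
  simp only [okFam, Bool.and_eq_true, allN_iff, Bool.or_eq_true, Nat.beq_eq,
    Bool.not_eq_true'] at h
  have hg : ∀ c : Fin 6, GadSpec n d (colD c) K (fun i j => (l.getD c dflt).adj i j = 1)
      (fun i => (l.getD c dflt).t i) (fun i => if (l.getD c dflt).ps i = 1 then 1 else -1) :=
    fun c => Gad.ok_spec _ _ _ _ _ (h.1 c c.2)
  have ht : ∀ c c' : Fin 6, (fun (c : Fin 6) (i : Fin (n + 1)) => (l.getD c dflt).t i) c 0 =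
      (fun (c : Fin 6) (i : Fin (n + 1)) => (l.getD c dflt).t i) c' 0 → c = c' := by
    intro c c' hcc
    rcases h.2 c c.2 c' c'.2 with h1 | h1
    · exact Fin.ext h1
    · rw [Bool.eq_false_iff, ne_eq, Nat.beq_eq] at h1
      exact absurd hcc h1
  refine transport (fin_graph (D := fun c => colD c) (baseG s) baseCol hg) 𝔊 d N (fg_nut hB hn hg)
    (fg_regular hB hg) ?_ (fg_aut hB hg ht)
  have h1 : 0 < Fintype.card 𝔊 := Fintype.card_pos
  simp only [Fintype.card_prod, Fintype.card_fin, ZMod.card]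
  calc N < m := by simp only [m]; omega
    _ = 1 * (m * 1) * 1 := by ring
    _ ≤ Fintype.card 𝔊 * (m * 5) * (n + 1) := by gcongr <;> omega


/-- For every finite group `𝔊`, every `d ∈ {8, 12, 16, 20, 24}` and every natural number
`N`, there exists a `d`-regular nut graph on more than `N` vertices whose automorphism
group is isomorphic to `𝔊`. -/
theorem regular_nut_graphs_f_universal (𝔊 : Type*) [Group 𝔊] [Finite 𝔊]
    (d : ℕ) (hd : d ∈ ({8, 12, 16, 20, 24} : Set ℕ)) (N : ℕ) :
    ∃ (n : ℕ) (G : SimpleGraph (Fin n)),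
      G.IsNut ∧ G.IsRegularOfDegree d ∧ N < n ∧ Nonempty (G.autGroup ≃* 𝔊) := by
  simp only [Set.mem_insert_iff, Set.mem_singleton_iff] at hd
  rcases hd with rfl | rfl | rfl | rfl | rfl
  · exact final 𝔊 gads8 15 8 18 N (by norm_num) ok8
  · exact final 𝔊 gads12 19 12 58 N (by norm_num) ok12
  · exact final 𝔊 gads16 23 16 124 N (by norm_num) ok16
  · exact final 𝔊 gads20 27 20 222 N (by norm_num) ok20
  · exact final 𝔊 gads24 31 24 358 N (by norm_num) ok24
end

section
/- For every finite group 𝔊 of order |𝔊| > 1, every integer d ≥ 3, and every natural number N, there exists a connected d-regular simple graph G on more than N vertices whose automorphism group Aut(G) is isomorphic (as a group) to 𝔊. -/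
open scoped Classical

namespace Sab

/-- House graph adjacency. -/
def hadj {W : Type*} (ρ τ : Equiv.Perm W) : W × Fin 5 → W × Fin 5 → Prop
  | (w, 0), (w', 0) => w' = τ w
  | (w, 0), (w', 1) => w = w'
  | (w, 1), (w', 0) => w = w'
  | (w, 1), (w', 2) => w = w'
  | (w, 2), (w', 1) => w = w'
  | (w, 2), (w', 3) => w = w'
  | (w, 3), (w', 2) => w = w'
  | (w, 3), (w', 4) => w = w'
  | (w, 4), (w', 3) => w = w'
  | (w, 4), (w', 0) => w = w'
  | (w, 0), (w', 4) => w = w'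
  | (w, 2), (w', 4) => w = w'
  | (w, 4), (w', 2) => w = w'
  | (w, 1), (w', 3) => w = ρ w'
  | (w, 3), (w', 1) => w' = ρ w
  | _, _ => False

def house {W : Type*} (ρ τ : Equiv.Perm W) (hτ : ∀ w, τ w ≠ w) (hττ : ∀ w, τ (τ w) = w) :
    SimpleGraph (W × Fin 5) where
  Adj := hadj ρ τ
  symm := ⟨by
    rintro ⟨w, i⟩ ⟨w', j⟩ h
    fin_cases i <;> fin_cases j <;> simp_all [hadj]⟩
  loopless := ⟨by
    rintro ⟨w, i⟩ h
    fin_cases i <;> simp_all [hadj]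
    exact hτ w h.symm⟩

section Inv
variable {V : Type*} (H : SimpleGraph V)

def Tri (v : V) : Prop := ∃ x y, H.Adj v x ∧ H.Adj v y ∧ H.Adj x y
def L1 (v : V) : Prop :=
  ¬ Tri H v ∧ ∃ x y, x ≠ y ∧ H.Adj v x ∧ H.Adj v y ∧ Tri H x ∧ Tri H y
def L0 (v : V) : Prop := ¬ Tri H v ∧ ¬ L1 H v
def L4 (v : V) : Prop := Tri H v ∧ ∃ x, L0 H x ∧ H.Adj v x
def L2 (v : V) : Prop := Tri H v ∧ ∃ x y z, L1 H x ∧ L0 H y ∧ L4 H z ∧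
  H.Adj v x ∧ H.Adj x y ∧ H.Adj y z ∧ H.Adj z v

variable {H} {σ : Equiv.Perm V}

lemma tri_inv (hσ : ∀ u v, H.Adj (σ u) (σ v) ↔ H.Adj u v) (v : V) : Tri H (σ v) ↔ Tri H v := by
  unfold Tri
  rw [σ.surjective.exists₂]
  simp only [hσ]

lemma L1_inv (hσ : ∀ u v, H.Adj (σ u) (σ v) ↔ H.Adj u v) (v : V) : L1 H (σ v) ↔ L1 H v := by
  unfold L1
  rw [σ.surjective.exists₂]
  simp only [hσ, tri_inv hσ, ne_eq, σ.injective.eq_iff]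

lemma L0_inv (hσ : ∀ u v, H.Adj (σ u) (σ v) ↔ H.Adj u v) (v : V) : L0 H (σ v) ↔ L0 H v := by
  simp only [L0, tri_inv hσ, L1_inv hσ]

lemma L4_inv (hσ : ∀ u v, H.Adj (σ u) (σ v) ↔ H.Adj u v) (v : V) : L4 H (σ v) ↔ L4 H v := by
  unfold L4
  rw [σ.surjective.exists]
  simp only [hσ, tri_inv hσ, L0_inv hσ]

lemma L2_inv (hσ : ∀ u v, H.Adj (σ u) (σ v) ↔ H.Adj u v) (v : V) : L2 H (σ v) ↔ L2 H v := by
  unfold L2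
  rw [σ.surjective.exists₃]
  simp only [hσ, tri_inv hσ, L0_inv hσ, L1_inv hσ, L4_inv hσ]
end Inv

section House
variable {W : Type*} {ρ τ : Equiv.Perm W} {hτ : ∀ w, τ w ≠ w} {hττ : ∀ w, τ (τ w) = w}

lemma house_adj (u v : W × Fin 5) : (house ρ τ hτ hττ).Adj u v ↔ hadj ρ τ u v := Iff.rfl


lemma h_triangle (hρ : ∀ w, ρ w ≠ w) {w w' w'' : W} {i j k : Fin 5} (h1 : hadj ρ τ (w, i) (w', j))
    (h2 : hadj ρ τ (w, i) (w'', k)) (h3 : hadj ρ τ (w', j) (w'', k))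
    (hτ : ∀ w, τ w ≠ w) (hττ : ∀ w, τ (τ w) = w) :
    w = w' ∧ w = w'' ∧ (i = 2 ∨ i = 3 ∨ i = 4) := by
  have hρ' : ∀ w, w ≠ ρ w := fun w h => hρ w h.symm
  have hτ' : ∀ w, w ≠ τ w := fun w h => hτ w h.symm
  fin_cases i <;> fin_cases j <;> first
    | exact (h1 : False).elim
    | (fin_cases k <;> first
        | exact (h2 : False).elim
        | exact (h3 : False).elim
        | (simp only [hadj] at h1 h2 h3; grind))

lemma tri_iff (hρ : ∀ w, ρ w ≠ w) (w : W) (i : Fin 5) :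
    Tri (house ρ τ hτ hττ) (w, i) ↔ (i = 2 ∨ i = 3 ∨ i = 4) := by
  constructor
  · rintro ⟨⟨w', j⟩, ⟨w'', k⟩, h1, h2, h3⟩
    exact (h_triangle hρ h1 h2 h3 hτ hττ).2.2
  · rintro (rfl | rfl | rfl)
    · exact ⟨(w, 3), (w, 4), by simp [house_adj, hadj]⟩
    · exact ⟨(w, 2), (w, 4), by simp [house_adj, hadj]⟩
    · exact ⟨(w, 2), (w, 3), by simp [house_adj, hadj]⟩

lemma L1_iff (hρ : ∀ w, ρ w ≠ w) (w : W) (i : Fin 5) : L1 (house ρ τ hτ hττ) (w, i) ↔ i = 1 := by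
  constructor
  · rintro ⟨h, ⟨w', j⟩, ⟨w'', k⟩, hn, h1, h2, h3, h4⟩
    rw [tri_iff hρ] at h h3 h4
    rw [house_adj] at h1 h2
    fin_cases i <;> simp at h ⊢
    rcases h3 with rfl | rfl | rfl <;> rcases h4 with rfl | rfl | rfl <;> simp_all [hadj]
  · rintro rfl
    refine ⟨by simp [tri_iff hρ], (w, 2), (ρ.symm w, 3), ?_⟩
    simp [tri_iff hρ, house_adj, hadj]

lemma L0_iff (hρ : ∀ w, ρ w ≠ w) (w : W) (i : Fin 5) : L0 (house ρ τ hτ hττ) (w, i) ↔ i = 0 := by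
  rw [L0, tri_iff hρ, L1_iff hρ]
  fin_cases i <;> simp

lemma L4_iff (hρ : ∀ w, ρ w ≠ w) (w : W) (i : Fin 5) : L4 (house ρ τ hτ hττ) (w, i) ↔ i = 4 := by
  simp only [L4, tri_iff hρ, Prod.exists, L0_iff hρ, house_adj]
  constructor
  · rintro ⟨h, w', j, rfl, h2⟩
    fin_cases i <;> simp_all [hadj]
  · rintro rfl
    exact ⟨by simp, w, 0, rfl, by simp [hadj]⟩

lemma L2_iff (hρ : ∀ w, ρ w ≠ w) (w : W) (i : Fin 5) : L2 (house ρ τ hτ hττ) (w, i) ↔ i = 2 := by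
  simp only [L2, tri_iff hρ, Prod.exists, L0_iff hρ, L1_iff hρ, L4_iff hρ, house_adj]
  constructor
  · rintro ⟨h, w1, j, w2, k, w3, l, rfl, rfl, rfl, h1, h2, h3, h4⟩
    have := hρ w
    fin_cases i <;> simp_all [hadj]
  · rintro rfl
    exact ⟨by simp, w, 1, w, 0, w, 4, by simp [hadj]⟩

lemma label_eq (hρ : ∀ w, ρ w ≠ w) {σ : Equiv.Perm (W × Fin 5)}
    (hσ : ∀ u v, (house ρ τ hτ hττ).Adj (σ u) (σ v) ↔ (house ρ τ hτ hττ).Adj u v)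
    (v : W × Fin 5) : (σ v).2 = v.2 := by
  have e0 := L0_inv hσ v
  have e1 := L1_inv hσ v
  have e2 := L2_inv hσ v
  have e4 := L4_inv hσ v
  obtain ⟨w, i⟩ := v
  rcases h : σ (w, i) with ⟨w', j⟩
  rw [h] at e0 e1 e2 e4
  rw [L0_iff hρ, L0_iff hρ] at e0
  rw [L1_iff hρ, L1_iff hρ] at e1
  rw [L2_iff hρ, L2_iff hρ] at e2
  rw [L4_iff hρ, L4_iff hρ] at e4
  simp only
  omega

lemma house_aut (hρ : ∀ w, ρ w ≠ w) {σ : Equiv.Perm (W × Fin 5)}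
    (hσ : ∀ u v, (house ρ τ hτ hττ).Adj (σ u) (σ v) ↔ (house ρ τ hτ hττ).Adj u v) :
    ∃ f : W → W, (∀ w i, σ (w, i) = (f w, i)) ∧ (∀ w, f (ρ w) = ρ (f w)) ∧
      ∀ w, f (τ w) = τ (f w) := by
  have hl : ∀ w i, σ (w, i) = ((σ (w, i)).1, i) := fun w i =>
    Prod.ext rfl (label_eq hρ hσ (w, i))
  obtain ⟨F, hF⟩ : ∃ F : Fin 5 → W → W, ∀ w i, σ (w, i) = (F i w, i) :=
    ⟨fun i w => (σ (w, i)).1, hl⟩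
  have key : ∀ w i w' j, hadj ρ τ (w, i) (w', j) → hadj ρ τ (F i w, i) (F j w', j) := by
    intro w i w' j h
    have := (hσ (w, i) (w', j)).2 h
    rwa [hF, hF] at this
  have h01 : ∀ w, F 0 w = F 1 w := fun w => key w 0 w 1 rfl
  have h12 : ∀ w, F 1 w = F 2 w := fun w => key w 1 w 2 rfl
  have h23 : ∀ w, F 2 w = F 3 w := fun w => key w 2 w 3 rfl
  have h34 : ∀ w, F 3 w = F 4 w := fun w => key w 3 w 4 rfl
  refine ⟨F 0, ?_, ?_, ?_⟩
  · intro w i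
    rw [hF]
    fin_cases i <;> simp [h01, h12, h23, h34]
  · intro w
    have : F 1 (ρ w) = ρ (F 3 w) := key w 3 (ρ w) 1 rfl
    rw [h01, this, h01, h12, h23]
  · intro w
    exact key w 0 (τ w) 0 rfl

lemma house_cliqueFree (hρ : ∀ w, ρ w ≠ w) : (house ρ τ hτ hττ).CliqueFree 4 := by
  classical
  intro s hs
  have hcl : ∀ x ∈ s, ∀ y ∈ s, x ≠ y → hadj ρ τ x y := fun x hx y hy h => hs.1 hx hy h
  have hc := hs.2
  obtain ⟨⟨w, i⟩, hx⟩ : s.Nonempty := by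
    rw [← Finset.card_pos]; omega
  have main : ∀ x ∈ s, ∀ z ∈ s, x.1 = z.1 ∧ (x.2 = 2 ∨ x.2 = 3 ∨ x.2 = 4) := by
    have main' : ∀ x ∈ s, ∀ z ∈ s, x ≠ z → x.1 = z.1 ∧ (x.2 = 2 ∨ x.2 = 3 ∨ x.2 = 4) := by
      intro x hx z hz hxz
      obtain ⟨y, hy, hy'⟩ : ∃ y ∈ s, y ∉ ({x, z} : Finset _) := by
        apply Finset.exists_mem_notMem_of_card_lt_card
        have := Finset.card_le_two (a := x) (b := z)
        omega
      simp only [Finset.mem_insert, Finset.mem_singleton, not_or] at hy'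
      have := h_triangle hρ (hcl x hx z hz hxz) (hcl x hx y hy (Ne.symm hy'.1))
        (hcl z hz y hy (Ne.symm hy'.2)) hτ hττ
      exact ⟨this.1, this.2.2⟩
    intro x hx z hz
    obtain ⟨y, hy, hy'⟩ : ∃ y ∈ s, y ∉ ({x} : Finset _) := by
      apply Finset.exists_mem_notMem_of_card_lt_card
      rw [Finset.card_singleton]; omega
    simp only [Finset.mem_singleton] at hy'
    refine ⟨?_, (main' x hx y hy (Ne.symm hy')).2⟩
    by_cases h : x = z
    · rw [h]
    · exact (main' x hx z hz h).1
  have hsub : s ⊆ {(w, 2), (w, 3), (w, 4)} := by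
    intro x hx'
    obtain ⟨w', j⟩ := x
    obtain ⟨h1, h2⟩ := main _ hx' _ hx
    simp only at h1 h2
    subst h1
    rcases h2 with rfl | rfl | rfl <;> simp
  have := Finset.card_le_card hsub
  have := Finset.card_le_three (a := (w, (2 : Fin 5))) (b := (w, 3)) (c := (w, 4))
  omega

lemma house_deg (hρ : ∀ w, ρ w ≠ w) (v : W × Fin 5) : {x | (house ρ τ hτ hττ).Adj v x}.ncard = 3 := by
  have hρ' : ∀ w, w ≠ ρ w := fun w h => hρ w h.symm
  have hτ' : ∀ w, w ≠ τ w := fun w h => hτ w h.symm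
  rw [Set.ncard_eq_three]
  obtain ⟨w, i⟩ := v
  have h5 : ∀ P : Fin 5 → Prop, P 0 → P 1 → P 2 → P 3 → P 4 → ∀ j, P j := by
    intro P _ _ _ _ _ j
    fin_cases j <;> assumption
  revert i
  apply h5
  · refine ⟨(w, 1), (w, 4), (τ w, 0), by simp, by simp, by simp, ?_⟩
    ext ⟨w', j⟩
    revert j
    apply h5 <;> simp [house_adj, hadj, eq_comm]
  · refine ⟨(w, 0), (w, 2), (ρ.symm w, 3), by simp, by simp, by simp, ?_⟩
    ext ⟨w', j⟩
    revert j
    apply h5 <;> simp [house_adj, hadj, eq_comm, Equiv.eq_symm_apply]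
  · refine ⟨(w, 1), (w, 3), (w, 4), by simp, by simp, by simp, ?_⟩
    ext ⟨w', j⟩
    revert j
    apply h5 <;> simp [house_adj, hadj, eq_comm]
  · refine ⟨(w, 2), (w, 4), (ρ w, 1), by simp, by simp, by simp, ?_⟩
    ext ⟨w', j⟩
    revert j
    apply h5 <;> simp [house_adj, hadj, eq_comm]
  · refine ⟨(w, 3), (w, 0), (w, 2), by simp, by simp, by simp, ?_⟩
    ext ⟨w', j⟩
    revert j
    apply h5 <;> simp [house_adj, hadj, eq_comm]

lemma house_reach (w : W) (i : Fin 5) : (house ρ τ hτ hττ).Reachable (w, i) (w, 0) := by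
  have h10 : (house ρ τ hτ hττ).Adj (w, 1) (w, 0) := by simp [house_adj, hadj]
  have h21 : (house ρ τ hτ hττ).Adj (w, 2) (w, 1) := by simp [house_adj, hadj]
  have h32 : (house ρ τ hτ hττ).Adj (w, 3) (w, 2) := by simp [house_adj, hadj]
  have h40 : (house ρ τ hτ hττ).Adj (w, 4) (w, 0) := by simp [house_adj, hadj]
  fin_cases i
  · exact SimpleGraph.Reachable.refl _
  · exact h10.reachable
  · exact h21.reachable.trans h10.reachable
  · exact h32.reachable.trans (h21.reachable.trans h10.reachable)
  · exact h40.reachable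

lemma house_reach_τ (w : W) : (house ρ τ hτ hττ).Reachable (w, 0) (τ w, 0) := by
  have h : (house ρ τ hτ hττ).Adj (w, 0) (τ w, 0) := by simp [house_adj, hadj]
  exact h.reachable

lemma house_reach_ρ (w : W) : (house ρ τ hτ hττ).Reachable (w, 0) (ρ w, 0) := by
  have h : (house ρ τ hτ hττ).Adj (w, 3) (ρ w, 1) := by simp [house_adj, hadj]
  exact (house_reach w 3).symm.trans (h.reachable.trans (house_reach _ 1))

end House

/-- The inductive property. -/
def Good (G : Type*) [Group G] (d M : ℕ) : Prop :=
  ∃ (X : Type) (_ : Finite X) (H : SimpleGraph (G × X)), Nonempty X ∧ M ∣ Nat.card X ∧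
    H.Connected ∧ (∀ v, {w | H.Adj v w}.ncard = d) ∧ H.CliqueFree (d + 1) ∧
    (∀ h g x g' x', H.Adj (h * g, x) (h * g', x') ↔ H.Adj (g, x) (g', x')) ∧
    ∀ σ : Equiv.Perm (G × X), (∀ u v, H.Adj (σ u) (σ v) ↔ H.Adj u v) →
      ∃ h, ∀ g x, σ (g, x) = (h * g, x)

section Layer
variable {V Z : Type*}

/-- Put `H` on layer `false`, the cliques given by fibres of `p` on layer `true`, and join
the layers by a perfect matching. -/
def layer (H : SimpleGraph V) (p : V → Z) : SimpleGraph (V × Bool) where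
  Adj u v := (u.2 = false ∧ v.2 = false ∧ H.Adj u.1 v.1) ∨
    (u.2 = true ∧ v.2 = true ∧ p u.1 = p v.1 ∧ u.1 ≠ v.1) ∨ (u.2 ≠ v.2 ∧ u.1 = v.1)
  symm := ⟨by
    rintro ⟨u, a⟩ ⟨v, b⟩ h
    have := H.adj_comm u v
    grind⟩
  loopless := ⟨by
    rintro ⟨u, a⟩ h
    have := H.loopless.irrefl u
    grind⟩

variable {H : SimpleGraph V} {p : V → Z}

lemma layer_ff (u v : V) : (layer H p).Adj (u, false) (v, false) ↔ H.Adj u v := by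
  simp [layer]
lemma layer_tt (u v : V) : (layer H p).Adj (u, true) (v, true) ↔ p u = p v ∧ u ≠ v := by
  simp [layer]
lemma layer_ft (u v : V) : (layer H p).Adj (u, false) (v, true) ↔ u = v := by
  simp [layer]
lemma layer_tf (u v : V) : (layer H p).Adj (u, true) (v, false) ↔ u = v := by
  simp [layer]

lemma layer_connected (h : H.Connected) : (layer H p).Connected := by
  have hn := h.nonempty
  have h1 : ∀ u v, (layer H p).Reachable (u, false) (v, false) := by
    intro u v
    let f : H →g layer H p := ⟨fun v => (v, false), fun {a b} hab => (layer_ff a b).2 hab⟩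
    exact (h.preconnected u v).map f
  have h2 : ∀ u b, (layer H p).Reachable (u, b) (u, false) := by
    intro u b
    cases b
    · exact SimpleGraph.Reachable.refl _
    · exact ((layer_tf u u).2 rfl).reachable
  have : Nonempty (V × Bool) := inferInstance
  refine SimpleGraph.Connected.mk ?_
  rintro ⟨u, a⟩ ⟨v, b⟩
  exact (h2 u a).trans ((h1 u v).trans (h2 v b).symm)

lemma layer_deg [Finite V] {d : ℕ} (h : ∀ v, {w | H.Adj v w}.ncard = d)
    (hp : ∀ v, {w | p w = p v}.ncard = d + 1) (v : V × Bool) :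
    {w | (layer H p).Adj v w}.ncard = d + 1 := by
  have gen : ∀ (b : Bool) (v : V) (S : Set V), S.ncard = d →
      (insert (v, !b) ((fun w => (w, b)) '' S)).ncard = d + 1 := by
    intro b v S hS
    rw [Set.ncard_insert_of_notMem, Set.ncard_image_of_injective, hS]
    · intro x y hxy
      simpa using hxy
    · simp
  obtain ⟨v, b⟩ := v
  cases b
  · rw [← gen false v _ (h v)]
    congr 1
    ext ⟨w, c⟩
    cases c <;> simp [layer_ff, layer_ft, eq_comm]
  · have : ({w | p w = p v} \ {v}).ncard = d := by
      rw [Set.ncard_sdiff_singleton_of_mem (by simp), hp]; simp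
    rw [← gen true v _ this]
    congr 1
    ext ⟨w, c⟩
    cases c <;> simp [layer_tt, layer_tf, eq_comm]

lemma layer_clique {n : ℕ} (hn : 3 ≤ n) {s : Finset (V × Bool)} (hs : (layer H p).IsNClique n s) :
    ∃ b, ∀ x ∈ s, x.2 = b := by
  have hc := hs.2
  obtain ⟨x, hx⟩ : s.Nonempty := by
    rw [← Finset.card_pos]; omega
  refine ⟨x.2, fun y hy => ?_⟩
  by_contra hne
  have hxy : x ≠ y := fun h => hne (by rw [h])
  obtain ⟨z, hz, hz'⟩ : ∃ z ∈ s, z ∉ ({x, y} : Finset _) := by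
    apply Finset.exists_mem_notMem_of_card_lt_card
    have := Finset.card_le_two (a := x) (b := y)
    omega
  simp only [Finset.mem_insert, Finset.mem_singleton, not_or] at hz'
  have h1 := hs.1 hx hy hxy
  have h2 := hs.1 hz hx hz'.1
  have h3 := hs.1 hz hy hz'.2
  obtain ⟨x, a⟩ := x
  obtain ⟨y, b⟩ := y
  obtain ⟨z, c⟩ := z
  cases a <;> cases b <;> cases c <;>
    simp_all [layer_ff, layer_ft, layer_tf, layer_tt]

lemma layer_clique_false {n : ℕ} {s : Finset (V × Bool)} (hs : (layer H p).IsNClique n s)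
    (hb : ∀ x ∈ s, x.2 = false) : ∃ t, H.IsNClique n t := by
  have hinj : Set.InjOn Prod.fst (s : Set (V × Bool)) := by
    rintro ⟨x, a⟩ hx ⟨y, b⟩ hy h
    have h1 := hb _ hx
    have h2 := hb _ hy
    simp_all
  refine ⟨s.image Prod.fst, ?_, ?_⟩
  · intro x hx y hy hxy
    simp only [Finset.coe_image, Set.mem_image, Finset.mem_coe] at hx hy
    obtain ⟨⟨x, a⟩, hx, rfl⟩ := hx
    obtain ⟨⟨y, b⟩, hy, rfl⟩ := hy
    have h1 := hb _ hx
    have h2 := hb _ hy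
    simp only at h1 h2 hxy
    subst h1 h2
    have := hs.1 hx hy (by simpa using hxy)
    simpa [layer_ff] using this
  · rw [Finset.card_image_of_injOn hinj, hs.2]

lemma layer_cliqueFree [Finite V] {d : ℕ} (hd : 3 ≤ d) (h : H.CliqueFree (d + 1))
    (hp : ∀ v, {w | p w = p v}.ncard = d + 1) : (layer H p).CliqueFree (d + 2) := by
  intro s hs
  obtain ⟨b, hb⟩ := layer_clique (by omega) hs
  cases b
  · obtain ⟨t, ht⟩ := layer_clique_false hs hb
    exact h.mono (by omega) t ht
  · have hc := hs.2
    obtain ⟨⟨x, a⟩, hx⟩ : s.Nonempty := by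
      rw [← Finset.card_pos]; omega
    have ha := hb _ hx
    simp only at ha
    subst ha
    have hsub : (s : Set (V × Bool)) ⊆ (fun w => (w, true)) '' {w | p w = p x} := by
      rintro ⟨y, b⟩ hy
      have hb' := hb _ hy
      simp only at hb'
      subst hb'
      refine ⟨y, ?_, rfl⟩
      by_cases hxy : y = x
      · simp [hxy]
      · have := hs.1 hy hx (by simpa using hxy)
        exact ((layer_tt _ _).1 this).1
    have h1 := Set.ncard_le_ncard hsub (Set.toFinite _)
    have h2 := Set.ncard_image_le (f := fun w => (w, true)) (Set.toFinite {w | p w = p x})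
    rw [hp] at h2
    rw [Set.ncard_coe_finset] at h1
    omega

lemma layer_true_iff [Finite V] {d : ℕ} (hd : 3 ≤ d) (h : H.CliqueFree (d + 1))
    (hp : ∀ v, {w | p w = p v}.ncard = d + 1) (v : V × Bool) :
    v.2 = true ↔ ∃ s, (layer H p).IsNClique (d + 1) s ∧ v ∈ s := by
  constructor
  · obtain ⟨v, b⟩ := v
    rintro h
    simp only at h
    subst h
    have hfin := Set.toFinite {w | p w = p v}
    refine ⟨hfin.toFinset.image (fun w => (w, true)), ⟨?_, ?_⟩, ?_⟩
    · intro x hx y hy hxy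
      simp only [Finset.coe_image, Set.mem_image, Set.Finite.coe_toFinset,
        Set.mem_ofPred_eq] at hx hy
      obtain ⟨x, hx, rfl⟩ := hx
      obtain ⟨y, hy, rfl⟩ := hy
      rw [layer_tt]
      exact ⟨hx.trans hy.symm, fun h => hxy (by rw [h])⟩
    · rw [Finset.card_image_of_injective _ (fun x y h => by simpa using h), ← hp v,
        Set.ncard_eq_toFinset_card _ hfin]
    · simp
  · rintro ⟨s, hs, hv⟩
    obtain ⟨b, hb⟩ := layer_clique (by omega) hs
    cases b
    · obtain ⟨t, ht⟩ := layer_clique_false hs hb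
      exact (h t ht).elim
    · exact hb v hv

lemma clique_map {U : Type*} {K : SimpleGraph U} {σ : Equiv.Perm U}
    (hσ : ∀ u v, K.Adj (σ u) (σ v) ↔ K.Adj u v) {n : ℕ} {v : U}
    (h : ∃ s, K.IsNClique n s ∧ v ∈ s) : ∃ s, K.IsNClique n s ∧ σ v ∈ s := by
  obtain ⟨s, hs, hv⟩ := h
  refine ⟨s.image σ, ⟨?_, ?_⟩, Finset.mem_image_of_mem _ hv⟩
  · intro x hx y hy hxy
    simp only [Finset.coe_image, Set.mem_image, Finset.mem_coe] at hx hy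
    obtain ⟨x, hx, rfl⟩ := hx
    obtain ⟨y, hy, rfl⟩ := hy
    rw [hσ]
    exact hs.1 hx hy (fun h => hxy (by rw [h]))
  · rw [Finset.card_image_of_injective _ σ.injective, hs.2]

lemma layer_aut [Finite V] {d : ℕ} (hd : 3 ≤ d) (h : H.CliqueFree (d + 1))
    (hp : ∀ v, {w | p w = p v}.ncard = d + 1) {σ : Equiv.Perm (V × Bool)}
    (hσ : ∀ u v, (layer H p).Adj (σ u) (σ v) ↔ (layer H p).Adj u v) :
    ∃ φ : Equiv.Perm V, (∀ u v, H.Adj (φ u) (φ v) ↔ H.Adj u v) ∧ ∀ v b, σ (v, b) = (φ v, b) := by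
  have hflag1 : ∀ v, v.2 = true → (σ v).2 = true := by
    intro v hv
    rw [layer_true_iff hd h hp] at hv ⊢
    exact clique_map hσ hv
  have hσ' : ∀ u v, (layer H p).Adj (σ.symm u) (σ.symm v) ↔ (layer H p).Adj u v := by
    intro u v
    rw [← hσ]
    simp
  have hflag2 : ∀ v, (σ v).2 = true → v.2 = true := by
    intro v hv
    rw [layer_true_iff hd h hp] at hv ⊢
    simpa using clique_map hσ' hv
  have hflag : ∀ v, (σ v).2 = v.2 := by
    intro v
    have h1 := hflag1 v
    have h2 := hflag2 v
    cases h3 : (σ v).2 <;> cases h4 : v.2 <;> simp_all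
  obtain ⟨F, hF⟩ : ∃ F : Bool → V → V, ∀ v b, σ (v, b) = (F b v, b) :=
    ⟨fun b v => (σ (v, b)).1, fun v b => Prod.ext rfl (hflag (v, b))⟩
  have hinj : Function.Injective (F false) := by
    intro x y hxy
    have : σ (x, false) = σ (y, false) := by rw [hF, hF, hxy]
    simpa using σ.injective this
  refine ⟨Equiv.ofBijective (F false) (Finite.injective_iff_bijective.1 hinj), ?_, ?_⟩
  · intro u v
    have := hσ (u, false) (v, false)
    rw [hF, hF, layer_ff, layer_ff] at this
    exact this
  · intro v b
    cases b
    · exact hF v false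
    · have := hσ (v, false) (v, true)
      rw [hF, hF, layer_ft, layer_ft] at this
      rw [hF, ← this.2 rfl]
      rfl

end Layer

lemma good_step {G : Type*} [Group G] [Finite G] {d : ℕ} (hd : 3 ≤ d)
    (hG : ∀ M, 0 < M → Good G d M) (M : ℕ) (hM : 0 < M) : Good G (d + 1) M := by
  obtain ⟨X, hX, H, hne, hdvd, hconn, hdeg, hcf, hinv, haut⟩ := hG (M * (d + 1)) (by positivity)
  obtain ⟨k, hk⟩ := hdvd
  have hcard : Nat.card X = Nat.card (Fin (M * k) × Fin (d + 1)) := by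
    rw [hk]; simp; ring
  let e : X ≃ Fin (M * k) × Fin (d + 1) := Classical.choice (Finite.card_eq.1 hcard |>.elim fun e => ⟨e⟩)
  let p : G × X → G × Fin (M * k) := fun v => (v.1, (e v.2).1)
  have hp : ∀ v, {w | p w = p v}.ncard = d + 1 := by
    rintro ⟨g, x⟩
    have : {w | p w = p (g, x)} = Set.range (fun i : Fin (d + 1) => (g, e.symm ((e x).1, i))) := by
      ext ⟨g', x'⟩
      simp only [p, Set.mem_ofPred_eq, Set.mem_range, Prod.mk.injEq]
      constructor
      · rintro ⟨rfl, h⟩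
        exact ⟨(e x').2, rfl, by rw [← h]; simp⟩
      · rintro ⟨i, rfl, rfl⟩
        simp
    rw [this, ← Set.image_univ, Set.ncard_image_of_injective, Set.ncard_univ]
    · simp
    · intro i j hij
      simpa using hij
  let E : (G × X) × Bool ≃ G × (X × Bool) := Equiv.prodAssoc _ _ _
  let K := layer H p
  have hconnK : K.Connected := layer_connected hconn
  let K' : SimpleGraph (G × (X × Bool)) := K.comap E.symm
  let I : K' ≃g K := SimpleGraph.Iso.comap E.symm K
  refine ⟨X × Bool, inferInstance, K', inferInstance, ?_, ?_, ?_, ?_, ?_, ?_⟩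
  · rw [Nat.card_prod, hk]
    exact ⟨(d + 1) * k * Nat.card Bool, by ring⟩
  · exact I.connected_iff.2 hconnK
  · intro v
    rw [← layer_deg hdeg hp (E.symm v)]
    have : {w | (layer H p).Adj (E.symm v) w} = E.symm '' {w | K'.Adj v w} := by
      ext w
      simp only [Set.mem_ofPred_eq, Set.mem_image]
      constructor
      · intro h
        exact ⟨E w, by simpa [K', K] using h, by simp⟩
      · rintro ⟨w, h, rfl⟩
        exact h
    rw [this, Set.ncard_image_of_injective _ E.symm.injective]
  · exact (layer_cliqueFree hd hcf hp).comap ⟨I.toEmbedding.toCopy⟩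
  · rintro h g ⟨x, a⟩ g' ⟨x', b⟩
    change K.Adj ((h * g, x), a) ((h * g', x'), b) ↔ K.Adj ((g, x), a) ((g', x'), b)
    cases a <;> cases b <;> simp [K, layer_ff, layer_ft, layer_tf, layer_tt, hinv, p]
  · intro σ hσ
    have hσ' : ∀ u v, K.Adj ((E.trans σ).trans E.symm u) ((E.trans σ).trans E.symm v) ↔ K.Adj u v := by
      intro u v
      have := hσ (E u) (E v)
      simpa [K'] using this
    obtain ⟨φ, hφ, hφ'⟩ := layer_aut hd hcf hp hσ'
    obtain ⟨h, hh⟩ := haut φ hφ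
    refine ⟨h, ?_⟩
    rintro g ⟨x, b⟩
    have h1 := hφ' (g, x) b
    rw [hh] at h1
    have h2 := congrArg E h1
    simpa [E] using h2

section Base
variable {G : Type*} [Group G] {r : ℕ}

/-- Cyclic successor. -/
def rho (G : Type*) (r : ℕ) : Equiv.Perm (G × (ZMod r × Bool)) where
  toFun w := if w.2.2 then (w.1, (w.2.1 + 1, false)) else (w.1, (w.2.1, true))
  invFun w := if w.2.2 then (w.1, (w.2.1, false)) else (w.1, (w.2.1 - 1, true))
  left_inv := by
    rintro ⟨g, j, b⟩
    cases b <;> simp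
  right_inv := by
    rintro ⟨g, j, b⟩
    cases b <;> simp

/-- Matching involution. -/
def tau (c : ZMod r → G) : Equiv.Perm (G × (ZMod r × Bool)) where
  toFun w := if w.2.2 then (w.1 * (c w.2.1)⁻¹, (w.2.1, false)) else (w.1 * c w.2.1, (w.2.1, true))
  invFun w := if w.2.2 then (w.1 * (c w.2.1)⁻¹, (w.2.1, false)) else (w.1 * c w.2.1, (w.2.1, true))
  left_inv := by
    rintro ⟨g, j, b⟩
    cases b <;> simp
  right_inv := by
    rintro ⟨g, j, b⟩
    cases b <;> simp

lemma rho_f (g : G) (j : ZMod r) : rho G r (g, (j, false)) = (g, (j, true)) := by simp [rho]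
lemma rho_t (g : G) (j : ZMod r) : rho G r (g, (j, true)) = (g, (j + 1, false)) := by simp [rho]
lemma tau_f (c : ZMod r → G) (g : G) (j : ZMod r) :
    tau c (g, (j, false)) = (g * c j, (j, true)) := by simp [tau]
lemma tau_t (c : ZMod r → G) (g : G) (j : ZMod r) :
    tau c (g, (j, true)) = (g * (c j)⁻¹, (j, false)) := by simp [tau]

lemma rho_ne (w : G × (ZMod r × Bool)) : rho G r w ≠ w := by
  obtain ⟨g, j, b⟩ := w
  cases b <;> simp [rho]
lemma tau_ne (c : ZMod r → G) (w : G × (ZMod r × Bool)) : tau c w ≠ w := by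
  obtain ⟨g, j, b⟩ := w
  cases b <;> simp [tau]
lemma tau_tau (c : ZMod r → G) (w : G × (ZMod r × Bool)) : tau c (tau c w) = w := by
  obtain ⟨g, j, b⟩ := w
  cases b <;> simp [tau]

lemma zmod_ind [NeZero r] {P : ZMod r → Prop} (h0 : P 0) (hs : ∀ j, P j → P (j + 1)) (j : ZMod r) :
    P j := by
  have : ∀ n : ℕ, P (n : ZMod r) := by
    intro n
    induction n with
    | zero => simpa using h0
    | succ n ih => simpa using hs _ ih
  have h := this j.val
  rwa [ZMod.natCast_zmod_val] at h

lemma centralizer_eq (hr : 2 ≤ r) {c : ZMod r → G} (hc0 : c 0 = 1) (hc : ∀ j, j ≠ 0 → c j ≠ 1)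
    (hsurj : Function.Surjective c) {f : G × (ZMod r × Bool) → G × (ZMod r × Bool)}
    (hfρ : ∀ w, f (rho G r w) = rho G r (f w)) (hfτ : ∀ w, f (tau c w) = tau c (f w)) :
    ∃ h, ∀ g y, f (g, y) = (h * g, y) := by
  have : NeZero r := ⟨by omega⟩
  have : Fact (1 < r) := ⟨by omega⟩
  have h0 : ∀ g, ∃ g', f (g, (0, false)) = (g', (0, false)) := by
    intro g
    have h1 : rho G r (g, (0, false)) = tau c (g, (0, false)) := by
      rw [rho_f, tau_f, hc0, mul_one]
    have h2 : rho G r (f (g, (0, false))) = tau c (f (g, (0, false))) := by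
      rw [← hfρ, ← hfτ, h1]
    generalize f (g, (0, false)) = w at h2 ⊢
    obtain ⟨g', j, b⟩ := w
    cases b
    · rw [rho_f, tau_f] at h2
      by_cases hj : j = 0
      · exact ⟨g', by rw [hj]⟩
      · simp only [Prod.mk.injEq, and_true] at h2
        exact absurd (by simpa using h2.symm) (hc j hj)
    · rw [rho_t, tau_t] at h2
      simp at h2
  choose π hπ using h0
  have hall : ∀ g j, f (g, (j, false)) = (π g, (j, false)) := by
    intro g j
    induction j using zmod_ind with
    | h0 => exact hπ g
    | hs j ih => rw [← rho_t, ← rho_f, hfρ, hfρ, ih, rho_f, rho_t]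
  have hallt : ∀ g j, f (g, (j, true)) = (π g, (j, true)) := by
    intro g j
    rw [← rho_f, hfρ, hall, rho_f]
  have hmul : ∀ g s, π (g * s) = π g * s := by
    intro g s
    obtain ⟨j, rfl⟩ := hsurj s
    have := hfτ (g, (j, false))
    rw [tau_f, hallt, hall, tau_f] at this
    exact congrArg Prod.fst this
  refine ⟨π 1, ?_⟩
  rintro g ⟨j, b⟩
  have hg : π g = π 1 * g := by rw [← hmul, one_mul]
  cases b
  · rw [hall, hg]
  · rw [hallt, hg]

lemma exists_c [Finite G] (hG : 1 < Nat.card G) (hr : Nat.card G ≤ r) :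
    ∃ c : ZMod r → G, c 0 = 1 ∧ (∀ j, j ≠ 0 → c j ≠ 1) ∧ Function.Surjective c := by
  have : NeZero r := ⟨by omega⟩
  have : Fintype G := Fintype.ofFinite G
  rw [Nat.card_eq_fintype_card] at hG hr
  have h1 : Fintype.card {g : G // g ≠ 1} ≤ Fintype.card {j : ZMod r // j ≠ 0} := by
    rw [Fintype.card_subtype_compl, Fintype.card_subtype_compl]
    simp [ZMod.card]
    omega
  obtain ⟨e⟩ := Function.Embedding.nonempty_of_card_le h1
  have : Nontrivial G := Fintype.one_lt_card_iff_nontrivial.1 hG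
  obtain ⟨g0, hg0⟩ := exists_ne (1 : G)
  have : Nonempty {g : G // g ≠ 1} := ⟨⟨g0, hg0⟩⟩
  refine ⟨fun j => if h : j = 0 then 1 else (Function.invFun e ⟨j, h⟩).1, by simp, ?_, ?_⟩
  · intro j hj
    simp only [hj, dite_false]
    exact (Function.invFun e ⟨j, hj⟩).2
  · intro g
    by_cases hg : g = 1
    · exact ⟨0, by simp [hg]⟩
    · refine ⟨(e ⟨g, hg⟩).1, ?_⟩
      simp only [(e ⟨g, hg⟩).2, dite_false, Subtype.coe_eta]
      rw [Function.leftInverse_invFun e.injective]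

lemma good_base [Finite G] (hG : 1 < Nat.card G) (M : ℕ) (hM : 0 < M) : Good G 3 M := by
  obtain ⟨r, hr, hMr⟩ : ∃ r, Nat.card G ≤ r ∧ M ∣ r :=
    ⟨M * Nat.card G, Nat.le_mul_of_pos_left _ hM, dvd_mul_right _ _⟩
  obtain ⟨c, hc0, hc, hsurj⟩ := exists_c hG hr
  have : NeZero r := ⟨by omega⟩
  let E : (G × (ZMod r × Bool)) × Fin 5 ≃ G × ((ZMod r × Bool) × Fin 5) := Equiv.prodAssoc _ _ _
  let K := house (rho G r) (tau c) (tau_ne c) (tau_tau c)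
  have hconnK : K.Connected := by
    have hA : ∀ g j, K.Reachable ((g, (0, false)), 0) ((g, (j, false)), 0) := by
      intro g j
      induction j using zmod_ind with
      | h0 => exact SimpleGraph.Reachable.refl _
      | hs j ih =>
        have h1 := house_reach_ρ (ρ := rho G r) (hτ := tau_ne c) (hττ := tau_tau c) (g, (j, false))
        rw [rho_f] at h1
        have h2 := house_reach_ρ (ρ := rho G r) (hτ := tau_ne c) (hττ := tau_tau c) (g, (j, true))
        rw [rho_t] at h2
        exact ih.trans (h1.trans h2)
    have hB : ∀ g j b, K.Reachable ((g, (0, false)), 0) ((g, (j, b)), 0) := by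
      intro g j b
      cases b
      · exact hA g j
      · have h1 := house_reach_ρ (ρ := rho G r) (hτ := tau_ne c) (hττ := tau_tau c) (g, (j, false))
        rw [rho_f] at h1
        exact (hA g j).trans h1
    have hC : ∀ g, K.Reachable ((1, (0, false)), 0) ((g, (0, false)), 0) := by
      intro g
      obtain ⟨j, rfl⟩ := hsurj g
      have h1 := house_reach_τ (ρ := rho G r) (hτ := tau_ne c) (hττ := tau_tau c) (1, (j, false))
      rw [tau_f, one_mul] at h1
      exact (hA 1 j).trans (h1.trans (hB _ _ _).symm)
    have hD : ∀ v, K.Reachable ((1, (0, false)), 0) v := by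
      rintro ⟨⟨g, j, b⟩, i⟩
      exact (hC g).trans ((hB g j b).trans (house_reach _ i).symm)
    have : Nonempty ((G × (ZMod r × Bool)) × Fin 5) := ⟨((1, (0, false)), 0)⟩
    exact SimpleGraph.Connected.mk fun u v => (hD u).symm.trans (hD v)
  let K' : SimpleGraph (G × ((ZMod r × Bool) × Fin 5)) := K.comap E.symm
  let I : K' ≃g K := SimpleGraph.Iso.comap E.symm K
  refine ⟨(ZMod r × Bool) × Fin 5, inferInstance, K', ⟨((0, false), 0)⟩, ?_, ?_, ?_, ?_, ?_, ?_⟩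
  · rw [Nat.card_prod, Nat.card_prod, Nat.card_zmod]
    exact (hMr.mul_right _).mul_right _
  · exact I.connected_iff.2 hconnK
  · intro v
    rw [← house_deg (hτ := tau_ne c) (hττ := tau_tau c) rho_ne (E.symm v)]
    have : {w | K.Adj (E.symm v) w} = E.symm '' {w | K'.Adj v w} := by
      ext w
      simp only [Set.mem_ofPred_eq, Set.mem_image]
      constructor
      · intro h
        exact ⟨E w, by simpa [K'] using h, by simp⟩
      · rintro ⟨w, h, rfl⟩
        exact h
    change _ = {w | K.Adj (E.symm v) w}.ncard
    rw [this, Set.ncard_image_of_injective _ E.symm.injective]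
  · exact (house_cliqueFree rho_ne).comap ⟨I.toEmbedding.toCopy⟩
  · rintro h g ⟨⟨j, b⟩, i⟩ g' ⟨⟨j', b'⟩, i'⟩
    change hadj _ _ ((h * g, (j, b)), i) ((h * g', (j', b')), i') ↔
      hadj _ _ ((g, (j, b)), i) ((g', (j', b')), i')
    fin_cases i <;> fin_cases i' <;> cases b <;> cases b' <;>
      simp [hadj, rho_f, rho_t, tau_f, tau_t, mul_assoc]
  · intro σ hσ
    have hσ' : ∀ u v, K.Adj ((E.trans σ).trans E.symm u) ((E.trans σ).trans E.symm v) ↔ K.Adj u v := by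
      intro u v
      have := hσ (E u) (E v)
      simpa [K'] using this
    obtain ⟨f, hf, hfρ, hfτ⟩ := house_aut rho_ne hσ'
    obtain ⟨h, hh⟩ := centralizer_eq (by omega) hc0 hc hsurj hfρ hfτ
    refine ⟨h, ?_⟩
    rintro g ⟨y, i⟩
    have h1 := hf (g, y) i
    rw [hh] at h1
    have h2 := congrArg E h1
    simpa [E] using h2

end Base

lemma good_all {G : Type*} [Group G] [Finite G] (hG : 1 < Nat.card G) (d : ℕ) (hd : 3 ≤ d) :
    ∀ M, 0 < M → Good G d M := by
  induction d, hd using Nat.le_induction with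
  | base => exact good_base hG
  | succ d hd ih => exact good_step hd ih

/-- Left multiplication as a permutation. -/
def lmul {G X : Type*} [Group G] : G →* Equiv.Perm (G × X) where
  toFun h := (Equiv.mulLeft h).prodCongr (Equiv.refl X)
  map_one' := by ext x <;> simp
  map_mul' a b := by ext x <;> simp [mul_assoc]

lemma lmul_apply {G X : Type*} [Group G] (h g : G) (x : X) : lmul h (g, x) = (h * g, x) := rfl

end Sab

/-- Sabidussi's theorem: for every finite group `𝔊` with `|𝔊| > 1`, every `d ≥ 3` and
every natural number `N`, there exists a connected `d`-regular graph on more than `N`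
vertices whose automorphism group is isomorphic to `𝔊`. -/
theorem sabidussi_regular (𝔊 : Type*) [Group 𝔊] [Finite 𝔊] (h𝔊 : 1 < Nat.card 𝔊)
    (d : ℕ) (hd : 3 ≤ d) (N : ℕ) :
    ∃ (n : ℕ) (G : SimpleGraph (Fin n)),
      G.Connected ∧ G.IsRegularOfDegree d ∧ N < n ∧ Nonempty (G.autGroup ≃* 𝔊) := by
  obtain ⟨X, hX, H, hne, hdvd, hconn, hdeg, hcf, hinv, haut⟩ :=
    Sab.good_all h𝔊 d hd (N + 1) (by omega)
  let e : 𝔊 × X ≃ Fin (Nat.card (𝔊 × X)) := Finite.equivFin _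
  let K : SimpleGraph (Fin (Nat.card (𝔊 × X))) := H.comap e.symm
  let I : K ≃g H := SimpleGraph.Iso.comap e.symm H
  refine ⟨Nat.card (𝔊 × X), K, I.connected_iff.2 hconn, ?_, ?_, ?_⟩
  · intro v
    have h1 : {w | H.Adj (e.symm v) w} = e.symm '' {w | K.Adj v w} := by
      ext w
      simp only [Set.mem_ofPred_eq, Set.mem_image]
      constructor
      · intro h
        exact ⟨e w, by simpa [K] using h, by simp⟩
      · rintro ⟨w, h, rfl⟩
        exact h
    have h2 := hdeg (e.symm v)
    rw [h1, Set.ncard_image_of_injective _ e.symm.injective] at h2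
    rw [← h2, ← SimpleGraph.card_neighborSet_eq_degree, ← Nat.card_eq_fintype_card]
    rfl
  · rw [Nat.card_prod]
    have h1 : 0 < Nat.card X := Nat.card_pos
    have h2 := Nat.le_of_dvd h1 hdvd
    nlinarith
  · let F : 𝔊 →* K.autGroup :=
      { toFun := fun h => ⟨(e.symm.trans (Sab.lmul h)).trans e, by
          intro u v
          have := hinv h (e.symm u).1 (e.symm u).2 (e.symm v).1 (e.symm v).2
          simpa [K, ← Sab.lmul_apply] using this⟩
        map_one' := by
          ext x
          simp
        map_mul' := by
          intro a b
          ext x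
          simp }
    have hF : ∀ h g x, (F h).1 (e (g, x)) = e (h * g, x) := by
      intro h g x
      simp [F, Sab.lmul_apply]
    refine ⟨(MulEquiv.ofBijective F ⟨?_, ?_⟩).symm⟩
    · intro a b hab
      obtain ⟨x⟩ := hne
      have h1 := hF a 1 x
      rw [hab, hF] at h1
      simpa using h1.symm
    · rintro ⟨σ, hσ⟩
      obtain ⟨h, hh⟩ := haut ((e.trans σ).trans e.symm) (by
        intro u v
        have := hσ (e u) (e v)
        simpa [K] using this)
      refine ⟨h, ?_⟩
      apply Subtype.ext
      apply Equiv.ext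
      intro v
      obtain ⟨⟨g, x⟩, rfl⟩ := e.surjective v
      rw [hF, ← hh]
      simp
end

section
/- Every nut graph has at least 7 vertices. -/
open scoped Classical

namespace NutProof

/-- Boolean zero test for integers. -/
def isZ : ℤ → Bool
  | .ofNat n => Nat.beq n 0
  | .negSucc _ => false

theorem isZ_iff (z : ℤ) : isZ z = true ↔ z = 0 := by
  cases z with
  | ofNat n => simp [isZ]
  | negSucc n => simp [isZ]

/-- Product of a 0/1 row with an integer vector. -/
def dot : List Bool → List ℤ → ℤ
  | [], _ => 0
  | _ :: _, [] => 0
  | true :: r, k :: y => k + dot r y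
  | false :: r, _ :: y => dot r y

/-- All entries vanish. -/
def allZ : List ℤ → Bool
  | [] => true
  | z :: zs => isZ z && allZ zs

/-- Exactly one entry is nonzero, or all vanish and the flag holds. -/
def chk (hz : Bool) : List ℤ → Bool
  | [] => hz
  | z :: zs => match isZ z with
    | true => chk hz zs
    | false => allZ zs

/-- The vector has length `n`, is nonzero and has a zero entry. -/
def hasZ (n : ℕ) (y : List ℤ) : Bool :=
  Nat.beq y.length n && (y.any isZ && !(allZ y))

/-- Some vector of the list `ys` witnesses that the matrix is not that of a nut graph. -/
def check (n : ℕ) (rows : List (List Bool)) (ys : List (List ℤ)) : Bool :=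
  ys.any fun y => chk (hasZ n y) (rows.map fun r => dot r y)

theorem dot_ofFn : ∀ (n : ℕ) (r : Fin n → Bool) (y : List ℤ),
    dot (List.ofFn r) y = ∑ j, if r j then y.getD j 0 else 0
  | 0, r, y => by simp [dot]
  | n + 1, r, [] => by simp [dot, List.ofFn_succ]
  | n + 1, r, k :: y => by
    rw [List.ofFn_succ, Fin.sum_univ_succ]
    have ih := dot_ofFn n (fun i => r i.succ) y
    cases h : r 0 <;> simp [dot, ih]

theorem allZ_iff (l : List ℤ) : allZ l = true ↔ ∀ z ∈ l, z = 0 := by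
  induction l with
  | nil => simp [allZ]
  | cons a l ih => simp [allZ, ih, isZ_iff]

theorem chk_sound (hz : Bool) : ∀ (n : ℕ) (z : Fin n → ℤ) (x : Fin n → ℝ), (∀ i, x i ≠ 0) →
    chk hz (List.ofFn z) = true → (∑ i, x i * (z i : ℝ)) ≠ 0 ∨ (hz = true ∧ ∀ i, z i = 0)
  | 0, z, x, hx, h => by
    right
    exact ⟨by simpa [chk] using h, fun i => i.elim0⟩
  | n + 1, z, x, hx, h => by
    rw [List.ofFn_succ] at h
    rw [Fin.sum_univ_succ]
    cases h0 : isZ (z 0) with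
    | true =>
      simp only [chk, h0] at h
      have hz0 := (isZ_iff _).1 h0
      rcases chk_sound hz n (fun i => z i.succ) (fun i => x i.succ) (fun i => hx _) h with h1 | h1
      · left
        simpa [hz0] using h1
      · right
        exact ⟨h1.1, fun i => Fin.cases hz0 h1.2 i⟩
    | false =>
      simp only [chk, h0] at h
      left
      have hne : z 0 ≠ 0 := fun hh => by
        rw [(isZ_iff _).2 hh] at h0
        cases h0
      rw [allZ_iff] at h
      have h2 : ∀ i : Fin n, z i.succ = 0 := fun i => h _ (by simp [List.mem_ofFn])
      simp [h2, hx 0, hne]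

/-- A kernel vector without zero entries. -/
theorem exists_ker {V : Type*} [Fintype V] (G : SimpleGraph V) (h : G.IsNut) :
    ∃ x : V → ℝ, (∀ v, x v ≠ 0) ∧ ∀ v, (∑ w, if G.Adj v w then x w else 0) = 0 := by
  obtain ⟨-, h1, h2⟩ := h
  have hpos : 0 < Module.finrank ℝ (LinearMap.ker (Matrix.mulVecLin (G.adjMatrix ℝ))) := by omega
  obtain ⟨⟨x, hx⟩, hne⟩ := (Module.finrank_pos_iff_exists_ne_zero).1 hpos
  have hx' := LinearMap.mem_ker.1 hx
  refine ⟨x, h2 x hx' (fun h0 => hne (Subtype.ext h0)), fun v => ?_⟩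
  have := congrFun hx' v
  simpa [Matrix.mulVec, dotProduct, SimpleGraph.adjMatrix_apply] using this

theorem no_nut {V : Type*} [Fintype V] (G : SimpleGraph V) (h : G.IsNut) {n : ℕ}
    (e : Fin n ≃ V) (a : Fin n → Fin n → Bool) (ha : ∀ i j, a i j = true ↔ G.Adj (e i) (e j))
    (ys : List (List ℤ)) :
    check n (List.ofFn fun i => List.ofFn (a i)) ys = false := by
  by_contra hc
  rw [Bool.not_eq_false] at hc
  obtain ⟨x, hx, hA⟩ := exists_ker G h
  unfold check at hc
  rw [List.any_eq_true] at hc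
  obtain ⟨y, -, hy⟩ := hc
  rw [List.map_ofFn] at hy
  have hrow : ∀ i, dot (List.ofFn (a i)) y = ∑ j, if a i j then y.getD j 0 else 0 :=
    fun i => dot_ofFn n (a i) y
  rcases chk_sound _ n _ (fun i => x (e i)) (fun i => hx _) hy with h1 | ⟨h1, h3⟩
  · apply h1
    simp only [Function.comp, hrow]
    push_cast
    simp only [Finset.mul_sum]
    rw [Finset.sum_comm]
    apply Finset.sum_eq_zero
    intro j _
    have := hA (e j)
    rw [← e.sum_comp] at this
    have h4 : ∀ i, x (e i) * (((if a i j then y.getD j 0 else 0 : ℤ)) : ℝ)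
        = (if G.Adj (e j) (e i) then x (e i) else 0) * (y.getD j 0 : ℝ) := by
      intro i
      by_cases hij : G.Adj (e i) (e j)
      · simp [(ha i j).2 hij, hij.symm]
      · have h5 : ¬ a i j = true := fun hh => hij ((ha i j).1 hh)
        have h6 : ¬ G.Adj (e j) (e i) := fun hh => hij hh.symm
        simp [h5, h6]
    have h7 : ∑ i, x (e i) * (((if a i j then y.getD j 0 else 0 : ℤ)) : ℝ) = 0 := by
      simp only [h4]
      rw [← Finset.sum_mul, this, zero_mul]
    simpa using h7
  · simp only [hasZ, Bool.and_eq_true, List.any_eq_true, Bool.not_eq_true', Nat.beq_eq] at h1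
    obtain ⟨hl, ⟨z, hz, hz0⟩, hnz⟩ := h1
    subst hl
    rw [isZ_iff] at hz0
    subst hz0
    obtain ⟨k, hk⟩ := List.mem_iff_get.1 hz
    set Y : V → ℝ := fun v => ((y.get (e.symm v) : ℤ) : ℝ) with hY
    refine h.2.2 Y ?_ ?_ (e k) (by simp only [hY, Equiv.symm_apply_apply, hk, Int.cast_zero])
    · funext v
      have h4 := h3 (e.symm v)
      simp only [Function.comp, hrow] at h4
      have h5 : ((∑ j, if a (e.symm v) j then y.getD j 0 else 0 : ℤ) : ℝ) = 0 := by
        rw [h4, Int.cast_zero]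
      simp only [Matrix.mulVecLin_apply, Matrix.mulVec, dotProduct, SimpleGraph.adjMatrix_apply,
        Pi.zero_apply]
      rw [← e.sum_comp]
      refine Eq.trans ?_ h5
      push_cast
      refine Finset.sum_congr rfl fun j _ => ?_
      have h6 := ha (e.symm v) j
      rw [Equiv.apply_symm_apply] at h6
      by_cases hij : G.Adj v (e j)
      · simp [h6.2 hij, hij, hY]
      · have h7 : ¬ a (e.symm v) j = true := fun hh => hij (h6.1 hh)
        simp [h7, hij]
    · intro h0
      have : allZ y = true := by
        rw [allZ_iff]
        intro z hz
        obtain ⟨i, rfl⟩ := List.mem_iff_get.1 hz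
        have := congrFun h0 (e i)
        simp only [hY, Equiv.symm_apply_apply, Pi.zero_apply] at this
        exact_mod_cast this
      rw [this] at hnz
      cases hnz

/-- A labelling in which the neighbours of the first vertex come first. -/
theorem exists_label {V : Type*} [Fintype V] (G : SimpleGraph V) {n : ℕ}
    (hn : Fintype.card V = n + 1) :
    ∃ e : Fin (n + 1) ≃ V, ∀ i j : Fin (n + 1), i ≠ 0 → i ≤ j → G.Adj (e 0) (e j) →
      G.Adj (e 0) (e i) := by
  let e₀ : Fin (n + 1) ≃ V := (Fintype.equivFinOfCardEq hn).symm
  let f : Fin (n + 1) → ℕ := fun i => if i = 0 then 0 else if G.Adj (e₀ 0) (e₀ i) then 1 else 2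
  have hm : Monotone (f ∘ Tuple.sort f) := Tuple.monotone_sort f
  have h0 : Tuple.sort f 0 = 0 := by
    have h1 := hm (Fin.zero_le ((Tuple.sort f).symm 0))
    simp only [Function.comp, Equiv.apply_symm_apply] at h1
    by_contra hne
    simp only [f, if_neg hne, if_true] at h1
    split_ifs at h1 <;> omega
  refine ⟨(Tuple.sort f).trans e₀, fun i j hi hij hj => ?_⟩
  simp only [Equiv.trans_apply, h0] at hj ⊢
  have h1 := hm hij
  have hi' : Tuple.sort f i ≠ 0 := fun hh => hi ((Tuple.sort f).injective (hh.trans h0.symm))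
  have hj' : Tuple.sort f j ≠ 0 := fun hh => by
    rw [hh] at hj
    exact G.loopless.irrefl _ hj
  simp only [Function.comp, f, if_neg hi', if_neg hj', if_pos hj] at h1
  by_contra hc
  rw [if_neg hc] at h1
  omega

/-- Test vectors for graphs on 2 vertices. -/
def ys2 : List (List ℤ) :=
  [[0, 1]]

/-- Test vectors for graphs on 3 vertices. -/
def ys3 : List (List ℤ) :=
  [[0, 0, 1], [0, 1, 0], [1, -1, -1]]

/-- Test vectors for graphs on 4 vertices. -/
def ys4 : List (List ℤ) :=
  [[0, 0, 0, 1], [0, 0, 1, 0], [0, 1, 0, 0], [1, 0, 0, 0], [0, 0, 1, -1], [0, 1, -1, 0], [0, 1,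
   0, -1], [0, 1, -1, -1], [1, -1, 0, 0], [1, -2, 1, 1]]

/-- Test vectors for graphs on 5 vertices. -/
def ys5 : List (List ℤ) :=
  [[0, 0, 0, 0, 1], [0, 0, 0, 1, 0], [0, 0, 1, 0, 0], [0, 1, 0, 0, 0], [1, 0, 0, 0, 0], [0, 0,
   0, 1, -1], [0, 0, 1, -1, 0], [0, 0, 1, 0, -1], [0, 1, -1, 0, 0], [0, 1, 0, -1, 0], [0, 1, 0,
   0, -1], [1, -1, -1, -1, 1], [1, -1, 0, 0, 0], [1, -1, -1, 1, -1], [1, 0, -1, 0, 0], [1, -1,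
   -1, -1, -1], [1, -1, 1, 1, 1], [1, 1, -1, 1, 1], [1, 1, 1, -1, 1], [1, 1, 1, 1, -1], [1, 0,
   0, -1, 0], [1, -1, 1, -1, -1], [1, 0, 0, 0, -1], [1, -3, 1, 1, 1]]

set_option maxHeartbeats 4000000 in
/-- Test vectors for graphs on 6 vertices. -/
def ys6 : List (List ℤ) :=
  [[1, 0, 0, 0, 0, 0], [0, 0, 0, 0, 0, 1], [1, 0, 0, 0, 0, -1], [0, 1, -1, 0, 0, 0], [0, 0, 0,
   1, -1, 0], [0, 0, 1, -1, 0, 0], [0, 1, 0, -1, 0, 0], [0, 0, 0, 0, 1, -1], [0, 0, 0, 1, 0,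
   -1], [0, 0, 1, 0, -1, 0], [0, 1, 0, 0, -1, 0], [1, 0, 0, -1, -1, 0], [0, 1, -1, -1, 1, 0],
   [1, 0, 0, 0, -1, 0], [0, 1, -1, 0, -1, 1], [0, 0, 1, -1, -1, 1], [0, 1, 0, -1, -1, 1], [0, 1,
   0, 0, 0, -1], [1, 0, -1, 1, 0, -1], [1, 0, 0, 1, -1, -1], [1, 0, 0, 0, -1, -1], [0, 0, 0, 1,
   -1, -1], [1, 1, 0, -1, 0, -1], [0, 0, 0, 0, 1, 0], [0, 0, 1, -1, 0, -1], [0, 1, 0, -1, 0,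
   -1], [1, 0, 0, -1, 0, -1], [0, 0, 1, 0, 0, -1], [2, -1, -1, -1, -1, -1], [1, -1, 1, 0, 0,
   -1], [0, 1, -1, 0, 0, -1], [0, 1, 0, -1, 1, -1], [0, 0, 1, -1, 1, -1], [0, 1, -1, -1, 0, 1],
   [0, 0, 0, 1, 0, 0], [0, 1, -1, 0, 1, -1], [1, 0, 0, -1, 1, -1], [0, 0, 0, 1, -1, 1], [1, -1,
   0, 0, 1, -1], [1, 0, 0, -1, 0, 0], [0, 0, 1, 0, -1, -1], [0, 1, 0, 0, -1, -1], [1, 0, -1, 0,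
   1, -1], [0, 0, 1, 0, 0, 0], [0, 1, 0, 0, 0, 0], [0, 1, -1, 1, -1, 0], [1, -2, 2, -1, 1, 1],
   [1, -2, 2, 1, -1, 1], [1, 2, -2, -1, 1, 1], [1, 2, -2, 1, -1, 1], [-4, 1, 3, 1, 1, 1], [3, 1,
   1, 1, 1, -4], [3, 1, 1, -4, 1, 1], [-4, 1, 1, 1, 3, 1], [3, -4, 1, 1, 1, 1], [0, 0, 1, -1,
   -1, 0], [0, 0, 1, -1, 0, 1], [0, 1, -1, 0, -1, 0], [0, 1, -1, 0, 0, 1], [0, 1, 0, -1, 0, 1],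
   [0, 1, 0, -1, 1, 0], [0, 1, -1, 1, 0, -1], [-1, -1, 2, -1, -1, -1], [-1, 2, -1, -1, -1, -1],
   [-1, -1, -1, 2, -1, -1], [2, 1, 1, -2, -1, -1], [-2, 2, -1, 1, 1, 1], [2, -2, 1, 1, -1, 1],
   [-2, 1, 2, -1, 1, 1], [-2, 2, 1, -1, 1, 1], [-1, 1, 1, -2, 1, 2], [-2, 1, 1, -1, 2, 1], [2,
   1, 1, -2, 1, -1], [-2, 2, 1, 1, -1, 1], [1, 2, -2, 1, 1, -1], [1, -2, 2, 1, 1, -1], [2, 1,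
   -2, 1, -1, 1], [-2, 1, 1, 2, -1, 1], [2, 1, 1, -2, -1, 1], [-2, 1, 2, 1, -1, 1], [-2, -1, 2,
   1, 1, 1], [3, -2, 1, 1, -1, -1], [3, 1, 1, -2, -1, -1], [3, 1, -2, 1, -1, -1], [-1, 1, -1,
   -2, 2, 1], [-1, -1, 1, 1, 2, -2], [1, -1, -1, 2, -2, 1], [-1, -1, 1, 2, 1, -2], [1, 2, -2, 1,
   -1, -1], [1, -2, 2, -1, -1, 1], [-2, 2, 1, -1, -1, 1], [1, 1, 2, -1, -2, 1], [1, 1, 2, -2,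
   -1, 1], [1, 2, 1, -1, -2, 1], [1, 2, 1, -2, -1, 1], [2, 1, -2, 1, 1, -1], [-1, 1, -2, 1, 1,
   2], [-1, -1, 2, -1, -2, -2], [2, -2, -1, -1, -1, -2], [2, -1, -2, -1, -1, -2], [2, -2, -1,
   -2, -1, -1], [2, -2, -2, -1, -1, -1], [2, -2, -1, -1, -2, -1], [2, -1, -2, -1, -2, -1], [2,
   -1, -2, -2, -1, -1], [2, -1, -1, -2, -1, -2], [2, -1, -1, -2, -2, -1], [2, -1, -1, -1, -2,
   -2], [-1, -1, -1, 2, -2, -2], [-2, -2, 2, -1, -1, -1], [-2, 2, -2, -1, -1, -1], [-1, 2, -1,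
   -1, -2, -2], [-1, -1, 1, -2, 1, 3], [1, -1, 3, -2, -1, 1], [1, -2, 3, -1, -1, 1], [-1, -1, 1,
   1, -2, 3], [1, -1, -2, 3, 1, -1], [1, -2, -1, 3, 1, -1], [-1, -1, 1, 3, -2, 1], [-1, 1, -1,
   1, -2, 3], [-1, 1, -1, 3, 1, -2], [1, 3, -1, -2, -1, 1], [-1, 1, -1, -2, 3, 1], [1, -2, 3,
   -1, 1, -1], [-4, 1, 1, 1, 1, 1], [1, 3, 1, -4, 1, 1], [1, 3, -4, 1, 1, 1], [1, 1, 3, -4, 1,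
   1]]

theorem check2 : ∀ a01 : Bool, check 2
     [[false, a01],
      [a01, false]] ys2 = true := by
  decide +kernel

theorem check3 : ∀ a01 a02 a12 : Bool, check 3
     [[false, a01, a02],
      [a01, false, a12],
      [a02, a12, false]] ys3 = true := by
  decide +kernel

theorem check4 : ∀ a01 a02 a03 a12 a13 a23 : Bool, check 4
     [[false, a01, a02, a03],
      [a01, false, a12, a13],
      [a02, a12, false, a23],
      [a03, a13, a23, false]] ys4 = true := by
  decide +kernel

theorem check5 : ∀ a01 a02 a03 a04 a12 a13 a14 a23 a24 a34 : Bool, check 5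
     [[false, a01, a02, a03, a04],
      [a01, false, a12, a13, a14],
      [a02, a12, false, a23, a24],
      [a03, a13, a23, false, a34],
      [a04, a14, a24, a34, false]] ys5 = true := by
  decide +kernel

theorem check6 : ∀ a01 a02 a03 a04 a05 : Bool,
    ((!a02 || a01) && (!a03 || a02) && (!a04 || a03) && (!a05 || a04)) = true →
    ∀ a12 a13 a14 a15 a23 a24 a25 a34 a35 a45 : Bool, check 6
     [[false, a01, a02, a03, a04, a05],
      [a01, false, a12, a13, a14, a15],
      [a02, a12, false, a23, a24, a25],
      [a03, a13, a23, false, a34, a35],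
      [a04, a14, a24, a34, false, a45],
      [a05, a15, a25, a35, a45, false]] ys6 = true := by
  decide +kernel

end NutProof

open NutProof in
/-- Every nut graph has at least 7 vertices. -/
theorem nut_card_ge_seven {V : Type*} [Fintype V] (G : SimpleGraph V) (h : G.IsNut) :
    7 ≤ Fintype.card V := by
  by_contra hlt
  have h2 := h.1
  have hcases : Fintype.card V = 1 + 1 ∨ Fintype.card V = 2 + 1 ∨ Fintype.card V = 3 + 1 ∨
      Fintype.card V = 4 + 1 ∨ Fintype.card V = 5 + 1 := by omega
  have main : ∀ n, Fintype.card V = n + 1 → ∃ a : Fin (n + 1) → Fin (n + 1) → Bool,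
      (∀ i, a i i = false) ∧ (∀ i j, a i j = a j i) ∧
      (∀ i j, i ≠ 0 → i ≤ j → a 0 j = true → a 0 i = true) ∧
      ∀ ys, check (n + 1) (List.ofFn fun i => List.ofFn (a i)) ys = false := by
    intro n hn
    obtain ⟨e, he⟩ := exists_label G hn
    refine ⟨fun i j => decide (G.Adj (e i) (e j)), ?_, ?_, ?_, ?_⟩
    · intro i
      simp
    · intro i j
      simp [G.adj_comm]
    · intro i j hi hij
      simpa using he i j hi hij
    · intro ys
      exact no_nut G h e _ (fun i j => by simp) ys
  rcases hcases with hn | hn | hn | hn | hn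
  · obtain ⟨a, hirr, hsym, hord, hc⟩ := main _ hn
    have hk := check2 (a 0 1)
    have hf := hc ys2
    have hM : (List.ofFn fun i => List.ofFn (a i)) =
      [[a 0 0, a 0 1],
       [a 1 0, a 1 1]] := rfl
    rw [hM, hirr 0, hirr 1,
      hsym 1 0] at hf
    exact absurd (hk.symm.trans hf) (by decide)
  · obtain ⟨a, hirr, hsym, hord, hc⟩ := main _ hn
    have hk := check3 (a 0 1) (a 0 2) (a 1 2)
    have hf := hc ys3
    have hM : (List.ofFn fun i => List.ofFn (a i)) =
      [[a 0 0, a 0 1, a 0 2],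
       [a 1 0, a 1 1, a 1 2],
       [a 2 0, a 2 1, a 2 2]] := rfl
    rw [hM, hirr 0, hirr 1, hirr 2,
      hsym 1 0, hsym 2 0, hsym 2 1] at hf
    exact absurd (hk.symm.trans hf) (by decide)
  · obtain ⟨a, hirr, hsym, hord, hc⟩ := main _ hn
    have hk := check4 (a 0 1) (a 0 2) (a 0 3) (a 1 2) (a 1 3) (a 2 3)
    have hf := hc ys4
    have hM : (List.ofFn fun i => List.ofFn (a i)) =
      [[a 0 0, a 0 1, a 0 2, a 0 3],
       [a 1 0, a 1 1, a 1 2, a 1 3],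
       [a 2 0, a 2 1, a 2 2, a 2 3],
       [a 3 0, a 3 1, a 3 2, a 3 3]] := rfl
    rw [hM, hirr 0, hirr 1, hirr 2, hirr 3,
      hsym 1 0, hsym 2 0, hsym 3 0, hsym 2 1, hsym 3 1, hsym 3 2] at hf
    exact absurd (hk.symm.trans hf) (by decide)
  · obtain ⟨a, hirr, hsym, hord, hc⟩ := main _ hn
    have hk := check5 (a 0 1) (a 0 2) (a 0 3) (a 0 4) (a 1 2) (a 1 3) (a 1 4) (a 2 3) (a 2 4) (a 3 4)
    have hf := hc ys5
    have hM : (List.ofFn fun i => List.ofFn (a i)) =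
      [[a 0 0, a 0 1, a 0 2, a 0 3, a 0 4],
       [a 1 0, a 1 1, a 1 2, a 1 3, a 1 4],
       [a 2 0, a 2 1, a 2 2, a 2 3, a 2 4],
       [a 3 0, a 3 1, a 3 2, a 3 3, a 3 4],
       [a 4 0, a 4 1, a 4 2, a 4 3, a 4 4]] := rfl
    rw [hM, hirr 0, hirr 1, hirr 2, hirr 3, hirr 4,
      hsym 1 0, hsym 2 0, hsym 3 0, hsym 4 0, hsym 2 1, hsym 3 1, hsym 4 1, hsym 3 2, hsym 4 2, hsym 4 3] at hf
    exact absurd (hk.symm.trans hf) (by decide)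
  · obtain ⟨a, hirr, hsym, hord, hc⟩ := main _ hn
    have hs : ((!a 0 2 || a 0 1) && (!a 0 3 || a 0 2) && (!a 0 4 || a 0 3) &&
        (!a 0 5 || a 0 4)) = true := by
      have h1 := hord 1 2 (by decide) (by decide)
      have h2 := hord 2 3 (by decide) (by decide)
      have h3 := hord 3 4 (by decide) (by decide)
      have h4 := hord 4 5 (by decide) (by decide)
      revert h1 h2 h3 h4
      generalize a 0 1 = b1
      generalize a 0 2 = b2
      generalize a 0 3 = b3
      generalize a 0 4 = b4
      generalize a 0 5 = b5
      revert b1 b2 b3 b4 b5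
      decide
    have hk := check6 (a 0 1) (a 0 2) (a 0 3) (a 0 4) (a 0 5) hs
      (a 1 2) (a 1 3) (a 1 4) (a 1 5) (a 2 3) (a 2 4) (a 2 5) (a 3 4) (a 3 5) (a 4 5)
    have hf := hc ys6
    have hM : (List.ofFn fun i => List.ofFn (a i)) =
      [[a 0 0, a 0 1, a 0 2, a 0 3, a 0 4, a 0 5],
       [a 1 0, a 1 1, a 1 2, a 1 3, a 1 4, a 1 5],
       [a 2 0, a 2 1, a 2 2, a 2 3, a 2 4, a 2 5],
       [a 3 0, a 3 1, a 3 2, a 3 3, a 3 4, a 3 5],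
       [a 4 0, a 4 1, a 4 2, a 4 3, a 4 4, a 4 5],
       [a 5 0, a 5 1, a 5 2, a 5 3, a 5 4, a 5 5]] := rfl
    rw [hM, hirr 0, hirr 1, hirr 2, hirr 3, hirr 4, hirr 5,
      hsym 1 0, hsym 2 0, hsym 3 0, hsym 4 0, hsym 5 0, hsym 2 1, hsym 3 1, hsym 4 1, hsym 5 1, hsym 3 2, hsym 4 2, hsym 5 2, hsym 4 3, hsym 5 3, hsym 5 4] at hf
    exact absurd (hk.symm.trans hf) (by decide)
end
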